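/- arXiv:1207.5869 — 2 statements merged into one kernel-verified Lean document; each statement's English description precedes it below -/
import Mathlib

section
/- Let R be a commutative Noetherian ring with a dualizing complex. Suppose there exist a test module M and a finitely generated R-module N with Supp N = Spec R such that Ext^i_R(M,N)=0 for all i >> 0. Then R is Cohen-Macaulay. If moreover N has finite projective dimension, then R is Gorenstein. -/
open CategoryTheory IsLocalRing

noncomputable def TorM (R : Type) [CommRing R] (i : ℕ) (M N : ModuleCat R) : ModuleCat R :=
  ((Tor (ModuleCat R) i).obj M).obj N

noncomputable def ExtM (R : Type) [CommRing R] (i : ℕ) (M N : ModuleCat R) : ModuleCat R :=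
  ((Ext R (ModuleCat R) i).obj (Opposite.op M)).obj N

/-- Eventual vanishing of `Tor_i^R(M, N)` for `i ≫ 0`. -/
def TorEventuallyZero (R : Type) [CommRing R] (M N : ModuleCat R) : Prop :=
  ∃ n : ℕ, ∀ i : ℕ, n ≤ i → Subsingleton (TorM R i M N)

/-- `N` has projective dimension at most `n`. -/
def ProjDimLE (R : Type) [CommRing R] (N : ModuleCat R) (n : ℕ) : Prop :=
  ∀ i : ℕ, n < i → ∀ L : ModuleCat R, Subsingleton (ExtM R i N L)

/-- `N` has finite projective dimension. -/
def FinProjDim (R : Type) [CommRing R] (N : ModuleCat R) : Prop :=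
  ∃ n : ℕ, ProjDimLE R N n

/-- `N` has finite injective dimension. -/
def FinInjDim (R : Type) [CommRing R] (N : ModuleCat R) : Prop :=
  ∃ n : ℕ, ∀ i : ℕ, n < i → ∀ L : ModuleCat R, Subsingleton (ExtM R i L N)

/-- `M` is a test module: every finitely generated module `N` with
`Tor_i^R(M,N) = 0` for `i ≫ 0` has finite projective dimension. -/
def IsTestModule (R : Type) [CommRing R] (M : ModuleCat R) : Prop :=
  ∀ N : ModuleCat R, Module.Finite R N → TorEventuallyZero R M N → FinProjDim R N

/-- A dualizing complex: a bounded complex of injective modules with finitely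
generated cohomology such that the homothety map `R → Hom_{K(R)}(D, D⟦i⟧)` is
bijective for `i = 0` and trivial for `i ≠ 0` (i.e. `R ≅ RHom(D,D)`). -/
def IsDualizingComplex (R : Type) [CommRing R] (D : CochainComplex (ModuleCat.{0} R) ℤ) : Prop :=
  (∀ i : ℤ, Injective (D.X i)) ∧
  (∃ n : ℕ, ∀ i : ℤ, (n : ℤ) ≤ |i| → Limits.IsZero (D.X i)) ∧
  (∀ i : ℤ, Module.Finite R (D.homology i)) ∧
  (∀ i : ℤ, i ≠ 0 →
    Subsingleton ((HomotopyCategory.quotient (ModuleCat.{0} R) (ComplexShape.up ℤ)).obj D ⟶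
      (((HomotopyCategory.quotient (ModuleCat.{0} R) (ComplexShape.up ℤ)).obj D)⟦i⟧))) ∧
  Function.Bijective (fun r : R =>
    (HomotopyCategory.quotient (ModuleCat.{0} R) (ComplexShape.up ℤ)).map (r • 𝟙 D))

def HasDualizingComplex (R : Type) [CommRing R] : Prop :=
  ∃ D : CochainComplex (ModuleCat.{0} R) ℤ, IsDualizingComplex R D

/-- The depth of a module over a local ring: the least `n` with
`Ext^n_R(k, M) ≠ 0`. -/
noncomputable def moduleDepth (R : Type) [CommRing R] [IsLocalRing R] (M : ModuleCat R) : ℕ∞ :=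
  sInf {d : ℕ∞ | ∃ n : ℕ, d = (n : ℕ∞) ∧
    Nontrivial (ExtM R n (ModuleCat.of R (ResidueField R)) M)}

/-- A Noetherian local ring is Cohen-Macaulay if its depth equals its Krull
dimension. -/
def IsCohenMacaulayLocalRing (R : Type) [CommRing R] [IsLocalRing R] : Prop :=
  (moduleDepth R (ModuleCat.of R R) : WithBot ℕ∞) = ringKrullDim R

/-- A ring is Cohen-Macaulay if all its localizations at primes are
Cohen-Macaulay local rings. -/
def IsCohenMacaulayRing (R : Type) [CommRing R] : Prop :=
  ∀ (p : Ideal R) (hp : p.IsPrime),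
    haveI := hp
    IsCohenMacaulayLocalRing (Localization.AtPrime p)

/-- A ring is Gorenstein if all its localizations at primes have finite
self-injective dimension. -/
def IsGorensteinRing (R : Type) [CommRing R] : Prop :=
  ∀ (p : Ideal R) (hp : p.IsPrime),
    haveI := hp
    FinInjDim (Localization.AtPrime p)
      (ModuleCat.of (Localization.AtPrime p) (Localization.AtPrime p))

/-- Eventual vanishing of `Ext^i_R(M, N)` for `i ≫ 0`. -/
def ExtEventuallyZero (R : Type) [CommRing R] (M N : ModuleCat R) : Prop :=
  ∃ n : ℕ, ∀ i : ℕ, n ≤ i → Subsingleton (ExtM R i M N)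


section Bridge

variable {R : Type} [CommRing R]

lemma extM_succ_subsingleton_iff {X Y : ModuleCat.{0} R} (P : ProjectiveResolution X) (n : ℕ) :
    Subsingleton (ExtM R (n + 1) X Y) ↔
      ∀ f : P.complex.X (n + 1) ⟶ Y, P.complex.d (n + 2) (n + 1) ≫ f = 0 →
        ∃ g : P.complex.X n ⟶ Y, P.complex.d (n + 1) n ≫ g = f := by
  rw [← ModuleCat.isZero_iff_subsingleton]
  unfold ExtM
  rw [(P.isoExt (R := R) (n + 1) Y).isZero_iff,
    ← HomologicalComplex.exactAt_iff_isZero_homology,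
    HomologicalComplex.exactAt_iff' _ n (n + 1) (n + 2) (by simp) (by simp),
    ShortComplex.moduleCat_exact_iff]
  rfl

lemma extM_zero_subsingleton_iff {X Y : ModuleCat.{0} R} (P : ProjectiveResolution X) :
    Subsingleton (ExtM R 0 X Y) ↔
      ∀ f : P.complex.X 0 ⟶ Y, P.complex.d 1 0 ≫ f = 0 → f = 0 := by
  rw [← ModuleCat.isZero_iff_subsingleton]
  unfold ExtM
  rw [(P.isoExt (R := R) 0 Y).isZero_iff,
    ← HomologicalComplex.exactAt_iff_isZero_homology,
    HomologicalComplex.exactAt_iff' _ 0 0 1 (by simp) (by simp),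
    ShortComplex.moduleCat_exact_iff]
  constructor
  · intro h f hf
    obtain ⟨g, hg⟩ := h f hf
    have h0 : (P.complex.linearYonedaObj R Y).d 0 0 = 0 :=
      HomologicalComplex.shape _ _ _ (by simp)
    have : ((P.complex.linearYonedaObj R Y).d 0 0).hom g = f := hg
    rw [h0] at this
    exact this.symm
  · intro h f hf
    refine ⟨0, ?_⟩
    rw [map_zero]
    exact (h f hf).symm

lemma extM_subsingleton_iff (i : ℕ) (X Y : ModuleCat.{0} R) :
    Subsingleton (ExtM R i X Y) ↔ Subsingleton (Abelian.Ext X Y i) := by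
  let P := projectiveResolution X
  cases i with
  | zero =>
    rw [extM_zero_subsingleton_iff P, Abelian.Ext.homEquiv₀.subsingleton_congr]
    constructor
    · intro h
      refine ⟨fun a b => ?_⟩
      have : ∀ a : X ⟶ Y, a = 0 := fun a => by
        let e : P.complex.X 0 ⟶ X := P.π.f 0
        have hd : P.complex.d 1 0 ≫ e = 0 := P.complex_d_comp_π_f_zero
        have hepi : Epi e := inferInstanceAs (Epi (P.π.f 0))
        have := h (e ≫ a) (by rw [reassoc_of% hd, Limits.zero_comp])
        rw [← cancel_epi e, this, Limits.comp_zero]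
      rw [this a, this b]
    · intro h f hf
      have := P.exact₀
      have hepi : Epi (P.π.f 0) := inferInstance
      let g := this.desc f hf
      have hg : P.π.f 0 ≫ g = f := this.g_desc f hf
      rw [← hg, show g = 0 from @Subsingleton.elim (X ⟶ Y) h _ _, Limits.comp_zero]
  | succ n =>
    rw [extM_succ_subsingleton_iff P]
    constructor
    · intro h
      refine subsingleton_of_forall_eq 0 fun a => ?_
      obtain ⟨f, hf, rfl⟩ := P.extMk_surjective a (n + 2) rfl
      rw [P.extMk_eq_zero_iff f _ rfl hf n rfl]
      exact h f hf
    · intro h f hf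
      rw [← P.extMk_eq_zero_iff f _ rfl hf n rfl]
      exact Subsingleton.elim _ _

end Bridge

section SupportExt

open scoped Pointwise

open Abelian

variable {R : Type} [CommRing R]

/-- The short complex attached to an exact pair of linear maps. -/
abbrev mkSC {A B C : Type} [AddCommGroup A] [AddCommGroup B] [AddCommGroup C] [Module R A]
    [Module R B] [Module R C] (f : A →ₗ[R] B) (g : B →ₗ[R] C) (hfg : Function.Exact f g) :
    ShortComplex (ModuleCat.{0} R) :=
  ShortComplex.mk (ModuleCat.ofHom f) (ModuleCat.ofHom g) (by
    ext x; exact hfg.apply_apply_eq_zero x)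

lemma mkSC_shortExact {A B C : Type} [AddCommGroup A] [AddCommGroup B] [AddCommGroup C]
    [Module R A] [Module R B] [Module R C] (f : A →ₗ[R] B) (g : B →ₗ[R] C)
    (hfg : Function.Exact f g) (hf : Function.Injective f) (hg : Function.Surjective g) :
    (mkSC f g hfg).ShortExact where
  exact := by
    rw [ShortComplex.moduleCat_exact_iff]
    intro x hx
    exact (hfg x).1 hx
  mono_f := (ModuleCat.mono_iff_injective _).2 hf
  epi_g := (ModuleCat.epi_iff_surjective _).2 hg

lemma mem_support_of_exact {A B C : Type*} [AddCommGroup A] [AddCommGroup B] [AddCommGroup C]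
    [Module R A] [Module R B] [Module R C] (f : A →ₗ[R] B) (g : B →ₗ[R] C)
    (hfg : ∀ x, g x = 0 → ∃ y, f y = x) {q : PrimeSpectrum R} (hq : q ∈ Module.support R B) :
    q ∈ Module.support R A ∨ q ∈ Module.support R C := by
  have h := Module.support_of_exact (f := (LinearMap.ker g).subtype) (g := g.rangeRestrict)
    (by intro x; simp [Subtype.ext_iff]) (Submodule.injective_subtype _) g.surjective_rangeRestrict
  rw [h] at hq
  rcases hq with hq | hq
  · left
    have hsub : Module.support R (LinearMap.range f) ⊆ Module.support R A :=
      Module.support_subset_of_surjective _ f.surjective_rangeRestrict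
    apply hsub
    exact Module.support_subset_of_injective (Submodule.inclusion (p := LinearMap.ker g)
      (p' := LinearMap.range f) (fun x hx => hfg x hx)) (Submodule.inclusion_injective _) hq
  · right
    exact Module.support_subset_of_injective (LinearMap.range g).subtype
      (Submodule.injective_subtype _) hq

/-- Iso invariance of the support of Ext in the first variable. -/
lemma support_ext_congr {X X' : ModuleCat.{0} R} (e : X ≅ X') (N : ModuleCat.{0} R) (j : ℕ) :
    Module.support R (Ext X N j) ⊆ Module.support R (Ext X' N j) := by
  refine Module.support_subset_of_injective
    (Ext.precompOfLinear (Ext.mk₀ e.inv) R N (zero_add j)) ?_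
  intro a b hab
  have : (Ext.mk₀ e.hom).comp ((Ext.mk₀ e.inv).comp a (zero_add j)) (zero_add j) =
    (Ext.mk₀ e.hom).comp ((Ext.mk₀ e.inv).comp b (zero_add j)) (zero_add j) :=
    congrArg (fun t => (Ext.mk₀ e.hom).comp t (zero_add j)) hab
  simpa using this

lemma ext_smul_eq (r : R) {X N : ModuleCat.{0} R} {j : ℕ} (a : Ext X N j) :
    r • a = (Ext.mk₀ (r • 𝟙 X)).comp a (zero_add j) := by
  rw [Ext.mk₀_smul]; simp

lemma annihilator_le_of_mem_support_ext {X N : ModuleCat.{0} R} {j : ℕ} {q : PrimeSpectrum R}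
    (hq : q ∈ Module.support R (Ext X N j)) : Module.annihilator R X ≤ q.asIdeal := by
  refine le_trans ?_ (Module.annihilator_le_of_mem_support hq)
  intro r hr
  rw [Module.mem_annihilator] at hr ⊢
  intro a
  rw [ext_smul_eq, show r • 𝟙 X = 0 by ext x; exact hr x]
  simp

variable [IsNoetherianRing R]

lemma exists_prime_of_mem_support_ext (N : ModuleCat.{0} R) (j : ℕ) (q : PrimeSpectrum R)
    (L : Type) [AddCommGroup L] [Module R L] [Module.Finite R L]
    (hq : q ∈ Module.support R (Ext (ModuleCat.of R L) N j)) :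
    ∃ p : PrimeSpectrum R, Module.annihilator R L ≤ p.asIdeal ∧
      q ∈ Module.support R (Ext (ModuleCat.of R (R ⧸ p.asIdeal)) N j) := by
  revert hq
  induction ‹Module.Finite R L› using
    IsNoetherianRing.induction_on_isQuotientEquivQuotientPrime R with
  | subsingleton L =>
    intro hq
    exfalso
    have : Subsingleton (Ext (ModuleCat.of R L) N j) := by
      refine subsingleton_of_forall_eq 0 fun a => ?_
      rw [← Ext.mk₀_id_comp a, show 𝟙 (ModuleCat.of R L) = 0 by ext x; exact Subsingleton.elim _ _]
      simp
    rw [Module.support_eq_empty] at hq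
    exact hq
  | quotient L p e =>
    intro hq
    refine ⟨p, ?_, support_ext_congr e.toModuleIso N j hq⟩
    rw [e.annihilator_eq, Ideal.annihilator_quotient]
  | exact L₁ L₂ L₃ f g hf hg hfg h₁ h₃ =>
    intro hq
    have hS := mkSC_shortExact f g hfg hf hg
    rcases mem_support_of_exact
      (Ext.precompOfLinear (Ext.mk₀ (ModuleCat.ofHom g)) R N (zero_add j))
      (Ext.precompOfLinear (Ext.mk₀ (ModuleCat.ofHom f)) R N (zero_add j))
      (fun x hx => Ext.contravariant_sequence_exact₂ hS N x hx) hq with h | h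
    · obtain ⟨p, hp, hp'⟩ := h₃ h
      exact ⟨p, (g.annihilator_le_of_surjective hg).trans hp, hp'⟩
    · obtain ⟨p, hp, hp'⟩ := h₁ h
      exact ⟨p, (f.annihilator_le_of_injective hf).trans hp, hp'⟩

/-- The general step lemma. -/
lemma exists_prime_gt_mem_support_ext (N : ModuleCat.{0} R) [Module.Finite R N] (i : ℕ)
    (p q : PrimeSpectrum R) (x : R) (hxq : x ∈ q.asIdeal) (hxp : x ∉ p.asIdeal)
    (h : q ∈ Module.support R (Ext (ModuleCat.of R (R ⧸ p.asIdeal)) N i)) :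
    ∃ p' : PrimeSpectrum R, p < p' ∧ p' ≤ q ∧
      q ∈ Module.support R (Ext (ModuleCat.of R (R ⧸ p'.asIdeal)) N (i + 1)) := by
  let B := R ⧸ p.asIdeal
  have : p.asIdeal.IsPrime := p.2
  let f : B →ₗ[R] B := LinearMap.lsmul R B x
  have hf : Function.Injective f := by
    rw [injective_iff_map_eq_zero]
    intro b hb
    have hb' : (Ideal.Quotient.mk p.asIdeal x) * b = 0 := by
      rw [← hb]; exact (Algebra.smul_def x b).symm
    rcases mul_eq_zero.1 hb' with h0 | h0
    · exact absurd (Ideal.Quotient.eq_zero_iff_mem.1 h0) hxp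
    · exact h0
  let C := B ⧸ LinearMap.range f
  let g : B →ₗ[R] C := (LinearMap.range f).mkQ
  have hfg : Function.Exact f g := LinearMap.exact_map_mkQ_range f
  have hS := mkSC_shortExact f g hfg hf (Submodule.mkQ_surjective _)
  let E := Ext (ModuleCat.of R B) N i
  have hEq : q ∈ Module.support R E := h
  have hfin : Module.Finite R E := ModuleCat.finite_ext _ _ _ _
  have hQ : q ∈ Module.support R (QuotSMulTop x E) := by
    rw [Module.support_quotSMulTop]
    exact ⟨hEq, by simpa using hxq⟩
  let δ : E →ₗ[R] Ext (ModuleCat.of R C) N (i + 1) :=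
    Ext.precompOfLinear hS.extClass R N (add_comm 1 i)
  have hker : LinearMap.ker δ ≤ x • (⊤ : Submodule R E) := by
    intro a ha
    obtain ⟨b, hb⟩ := Ext.contravariant_sequence_exact₁ hS N a (add_comm 1 i) ha
    refine Submodule.mem_smul_pointwise_iff_exists _ _ _ |>.2 ⟨b, trivial, ?_⟩
    rw [← hb, ext_smul_eq]
    rfl
  have hle : q ∈ Module.support R (Ext (ModuleCat.of R C) N (i + 1)) := by
    have h1 : q ∈ Module.support R (LinearMap.range δ) := by
      let e : (E ⧸ LinearMap.ker δ) →ₗ[R] QuotSMulTop x E :=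
        Submodule.factor hker
      have := Module.support_subset_of_surjective e (Submodule.factor_surjective hker) hQ
      rwa [(δ.quotKerEquivRange).support_eq] at this
    exact Module.support_subset_of_injective (LinearMap.range δ).subtype
      (Submodule.injective_subtype _) h1
  obtain ⟨p', hp', hq'⟩ := exists_prime_of_mem_support_ext N (i + 1) q C hle
  have h1 : p'.asIdeal ≤ q.asIdeal := by
    have := annihilator_le_of_mem_support_ext hq'
    rwa [show Module.annihilator R (ModuleCat.of R (R ⧸ p'.asIdeal)) = p'.asIdeal from
      Ideal.annihilator_quotient] at this
  have h2 : p.asIdeal ≤ p'.asIdeal := by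
    refine le_trans ?_ hp'
    refine le_trans (le_of_eq ?_) (g.annihilator_le_of_surjective (Submodule.mkQ_surjective _))
    exact Ideal.annihilator_quotient.symm
  have h3 : x ∈ p'.asIdeal := by
    apply hp'
    rw [Module.mem_annihilator]
    intro c
    obtain ⟨b, rfl⟩ := Submodule.mkQ_surjective _ c
    rw [← map_smul]
    exact (Submodule.Quotient.mk_eq_zero _).2 ⟨b, rfl⟩
  have h4 : p < p' := lt_of_le_of_ne h2 (by rintro rfl; exact hxp h3)
  exact ⟨p', h4, h1, hq'⟩

/-- The step lemma for Bass numbers. -/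
lemma mem_support_ext_succ (N : ModuleCat.{0} R) [Module.Finite R N] (i : ℕ)
    (p q : PrimeSpectrum R) (hpq : p ⋖ q)
    (h : p ∈ Module.support R (Ext (ModuleCat.of R (R ⧸ p.asIdeal)) N i)) :
    q ∈ Module.support R (Ext (ModuleCat.of R (R ⧸ q.asIdeal)) N (i + 1)) := by
  obtain ⟨x, hxq, hxp⟩ := SetLike.exists_of_lt (show p.asIdeal < q.asIdeal from hpq.lt)
  obtain ⟨p', h4, h1, hq'⟩ := exists_prime_gt_mem_support_ext N i p q x hxq hxp
    (Module.mem_support_mono hpq.le h)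
  have h5 : p' = q := by
    by_contra hne
    exact hpq.2 h4 (lt_of_le_of_ne h1 hne)
  rwa [h5] at hq'

lemma mem_support_ext_zero (N : ModuleCat.{0} R) (p : PrimeSpectrum R)
    (hp : p.asIdeal ∈ associatedPrimes R N) :
    p ∈ Module.support R (Ext (ModuleCat.of R (R ⧸ p.asIdeal)) N 0) := by
  rw [(Ext.linearEquiv₀ (R := R)).support_eq]
  rw [Module.mem_support_iff_exists_annihilator]
  obtain ⟨-, f, hf⟩ := (isAssociatedPrime_iff_exists_injective_linearMap _ _).1 hp
  refine ⟨ModuleCat.ofHom f, ?_⟩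
  intro r hr
  rw [Submodule.mem_annihilator_span_singleton] at hr
  have h1 : r • f 1 = 0 := LinearMap.congr_fun (congrArg ModuleCat.Hom.hom hr) 1
  rw [← map_smul, map_eq_zero_iff f hf, Algebra.smul_def, mul_one] at h1
  exact Ideal.Quotient.eq_zero_iff_mem.1 h1

end SupportExt

section LocalCM

open Abelian

variable {R : Type} [CommRing R] [IsNoetherianRing R]

lemma mem_support_ext_height (N : ModuleCat.{0} R) [Module.Finite R N]
    (hsupp : Module.support R N = Set.univ) (n : ℕ) :
    ∀ q : PrimeSpectrum R, Order.height q = n →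
      q ∈ Module.support R (Ext (ModuleCat.of R (R ⧸ q.asIdeal)) N n) := by
  induction n with
  | zero =>
    intro q hq
    apply mem_support_ext_zero
    apply Module.associatedPrimes.minimalPrimes_annihilator_subset_associatedPrimes
    have hmin : IsMin q := Order.height_eq_zero.1 (by simpa using hq)
    refine ⟨⟨q.2, ?_⟩, ?_⟩
    · exact Module.annihilator_le_of_mem_support (by rw [hsupp]; trivial)
    · rintro J ⟨hJ, -⟩ hJq
      exact hmin (b := ⟨J, hJ⟩) hJq
  | succ n ih =>
    intro q hq
    have hfin : Order.height q < ⊤ := by rw [hq]; exact ENat.natCast_lt_top _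
    obtain ⟨p, hp, hpn⟩ := (Order.coe_lt_height_iff (n := n) hfin).1 (by
      rw [hq]; exact_mod_cast Nat.lt_succ_self n)
    refine mem_support_ext_succ N n p q ⟨hp, ?_⟩ (ih p hpn)
    intro c hpc hcq
    have h1 := Order.height_strictMono hpc (by rw [hpn]; exact ENat.natCast_lt_top _)
    have hc : Order.height c < ⊤ := lt_of_le_of_lt (Order.height_mono hcq.le) hfin
    have h2 := Order.height_strictMono hcq hc
    rw [hpn] at h1
    rw [hq] at h2
    obtain ⟨m, hm⟩ := ENat.ne_top_iff_exists.1 hc.ne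
    rw [← hm] at h1 h2
    have h1' : n < m := by exact_mod_cast h1
    have h2' : m < n + 1 := by exact_mod_cast h2
    omega

variable [IsLocalRing R]

/-- Bass: vanishing of Ext from the residue field propagates to all f.g. modules. -/
lemma ext_subsingleton_of_residueField (N : ModuleCat.{0} R) [Module.Finite R N] (c : ℕ)
    (h : ∀ i, c < i → Subsingleton (Ext (ModuleCat.of R (ResidueField R)) N i))
    (L : Type) [AddCommGroup L] [Module R L] [Module.Finite R L] (i : ℕ) (hi : c < i) :
    Subsingleton (Ext (ModuleCat.of R L) N i) := by
  have key : ∀ p : PrimeSpectrum R, ∀ i, c < i → closedPoint R ∉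
      Module.support R (Ext (ModuleCat.of R (R ⧸ p.asIdeal)) N i) := by
    have wf : WellFoundedGT (PrimeSpectrum R) :=
      ⟨InvImage.wf PrimeSpectrum.asIdeal (wellFounded_gt (α := Ideal R))⟩
    intro p
    induction p using WellFoundedGT.induction with
    | ind p ih =>
      intro i hi hmem
      by_cases hp : p.asIdeal = maximalIdeal R
      · have := h i hi
        have h0 : Subsingleton (Ext (ModuleCat.of R (R ⧸ p.asIdeal)) N i) := by
          rw [hp]; exact this
        rw [Module.support_eq_empty] at hmem
        exact hmem
      · have hlt : p.asIdeal < maximalIdeal R :=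
          lt_of_le_of_ne (IsLocalRing.le_maximalIdeal p.2.ne_top) hp
        obtain ⟨x, hxq, hxp⟩ := SetLike.exists_of_lt hlt
        obtain ⟨p', hpp', -, hq'⟩ := exists_prime_gt_mem_support_ext N i p (closedPoint R) x
          hxq hxp hmem
        exact ih p' hpp' (i + 1) (by omega) hq'
  by_contra hns
  rw [not_subsingleton_iff_nontrivial] at hns
  obtain ⟨q, hq⟩ := Module.nonempty_support_of_nontrivial (R := R)
    (M := Ext (ModuleCat.of R L) N i)
  have hq' : closedPoint R ∈ Module.support R (Ext (ModuleCat.of R L) N i) :=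
    Module.mem_support_mono (IsLocalRing.le_maximalIdeal q.2.ne_top) hq
  obtain ⟨p, -, hp⟩ := exists_prime_of_mem_support_ext N i _ L hq'
  exact key p i hi hp

lemma cm_of_finInjDim (N : ModuleCat.{0} R) [Module.Finite R N]
    (hsupp : Module.support R N = Set.univ) (c : ℕ)
    (h : ∀ i, c < i → Subsingleton (Ext (ModuleCat.of R (ResidueField R)) N i)) :
    IsCohenMacaulayLocalRing R := by
  -- the Krull dimension
  have hfinh : (maximalIdeal R).FiniteHeight := Ideal.finiteHeight_of_isNoetherianRing _
  obtain ⟨d, hd⟩ := ENat.ne_top_iff_exists.1 ((Ideal.finiteHeight_iff _).1 hfinh |>.resolve_left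
    Ideal.IsPrime.ne_top')
  have hdim : ringKrullDim R = (d : ℕ∞) := by
    rw [← IsLocalRing.maximalIdeal_height_eq_ringKrullDim, ← hd]
  -- nonvanishing in degree d
  have hnd : Nontrivial (Ext (ModuleCat.of R (ResidueField R)) N d) := by
    have := mem_support_ext_height N hsupp d (closedPoint R) (by
      rw [hd]; exact (PrimeSpectrum.height_eq_orderHeight (closedPoint R)).symm)
    exact (Module.nonempty_support_iff (R := R)
      (M := Ext (ModuleCat.of R (R ⧸ (closedPoint R).asIdeal)) N d)).1 ⟨_, this⟩
  -- top nonvanishing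
  obtain ⟨r, hdr, hr, hr'⟩ : ∃ r, d ≤ r ∧
      Nontrivial (Ext (ModuleCat.of R (ResidueField R)) N r) ∧
      ∀ i, r < i → Subsingleton (Ext (ModuleCat.of R (ResidueField R)) N i) := by
    classical
    let P : ℕ → Prop := fun i => Nontrivial (Ext (ModuleCat.of R (ResidueField R)) N i)
    have hPb : ∀ i, P i → i ≤ c := by
      intro i hi
      by_contra hlt
      exact not_subsingleton_iff_nontrivial.2 hi (h i (by omega))
    refine ⟨Nat.findGreatest P c, Nat.le_findGreatest (hPb d hnd) hnd,
      Nat.findGreatest_spec (P := P) (hPb d hnd) hnd, ?_⟩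
    intro i hi
    by_contra hns
    have hi' : P i := not_subsingleton_iff_nontrivial.1 hns
    exact absurd (Nat.le_findGreatest (hPb i hi') hi') (by omega)
  -- regular sequences
  have hlen : ∀ rs : List R, RingTheory.Sequence.IsRegular R rs → rs.length ≤ d := by
    intro rs hrs
    have h1 := ringKrullDim_add_length_eq_ringKrullDim_of_isRegular rs hrs
    have hne : Ideal.ofList rs ≠ ⊤ := by
      intro htop
      apply hrs.2
      rw [htop]; simp
    have : Nontrivial (R ⧸ Ideal.ofList rs) := Ideal.Quotient.nontrivial_iff.2 hne
    have h0 : (0 : WithBot ℕ∞) ≤ ringKrullDim (R ⧸ Ideal.ofList rs) := ringKrullDim_nonneg_of_nontrivial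
    have h2 : ((rs.length : ℕ∞) : WithBot ℕ∞) ≤ (d : ℕ∞) := by
      rw [← hdim, ← h1]
      calc ((rs.length : ℕ∞) : WithBot ℕ∞) = 0 + (rs.length : WithBot ℕ∞) := by simp
        _ ≤ _ := by gcongr
    exact_mod_cast h2
  have hmaxlt : maximalIdeal R • (⊤ : Submodule R (ModuleCat.of R R)) < ⊤ := by
    rw [lt_top_iff_ne_top]
    intro h
    have : (maximalIdeal R • (⊤ : Submodule R R)) = ⊤ := h
    simp at this
    exact Ideal.IsPrime.ne_top' this
  let T : ℕ → Prop := fun n => ∃ rs : List R, rs.length = n ∧ (∀ x ∈ rs, x ∈ maximalIdeal R) ∧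
    RingTheory.Sequence.IsRegular R rs
  have hT0 : T 0 := ⟨[], rfl, by simp, RingTheory.Sequence.IsRegular.nil R R⟩
  have hTb : ∀ n, T n → n ≤ d := by
    rintro n ⟨rs, rfl, -, hrs⟩
    exact hlen rs hrs
  classical
  let t := Nat.findGreatest T d
  have hTt : T t := Nat.findGreatest_spec (Nat.zero_le _) hT0
  have hTt1 : ¬ T (t + 1) := fun hT => by
    have := Nat.le_findGreatest (hTb _ hT) hT
    have h' : t + 1 ≤ t := this
    omega
  have htd : t ≤ d := hTb t hTt
  have hrt : r ≤ t := by
    obtain ⟨rs, hl, hmem, hreg⟩ := hTt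
    by_contra hlt
    let Q := R ⧸ (Ideal.ofList rs • (⊤ : Submodule R R))
    have hpd : projectiveDimension (ModuleCat.of R Q) = rs.length := by
      have := ModuleCat.projectiveDimension_quotient_eq_add_length_of_isWeaklyRegular
        (ModuleCat.of R R) rs hreg.1 hmem
      rw [ModuleCat.projectiveDimension_eq_zero_of_projective (ModuleCat.of R R), zero_add] at this
      exact this
    have hlt' : HasProjectiveDimensionLT (ModuleCat.of R Q) r := by
      rw [← projectiveDimension_lt_iff, hpd]
      exact_mod_cast (by omega)
    have hns : ¬ Subsingleton (ResidueField R →ₗ[R] Q) := by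
      intro hs
      obtain ⟨y, hy, hyreg⟩ := IsSMulRegular.subsingleton_linearMap_iff.1 hs
      have hy' : y ∈ maximalIdeal R := by
        rwa [show Module.annihilator R (ResidueField R) = maximalIdeal R from
          Ideal.annihilator_quotient] at hy
      apply hTt1
      have hall : ∀ x ∈ rs ++ [y], x ∈ maximalIdeal R := by
        intro x hx
        rcases List.mem_append.1 hx with hx | hx
        · exact hmem x hx
        · rw [List.mem_singleton.1 hx]; exact hy'
      refine ⟨rs ++ [y], by simp [hl], hall, ?_⟩
      refine ⟨?_, ?_⟩
      · rw [RingTheory.Sequence.isWeaklyRegular_append_iff]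
        refine ⟨hreg.1, ?_⟩
        rw [RingTheory.Sequence.isWeaklyRegular_singleton_iff]
        exact hyreg
      · intro htop
        have hle : Ideal.ofList (rs ++ [y]) ≤ maximalIdeal R := Ideal.span_le.2 hall
        have : (⊤ : Ideal R) ≤ maximalIdeal R := by
          rw [htop]; simpa using hle
        exact Ideal.IsPrime.ne_top' (top_le_iff.1 this)
    rw [not_subsingleton_iff_nontrivial] at hns
    obtain ⟨f, hf⟩ := exists_ne (0 : ResidueField R →ₗ[R] Q)
    have hfinj : Function.Injective f := by
      have : IsSimpleModule R (ResidueField R) :=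
        isSimpleModule_iff_isCoatom.2 (maximalIdeal.isMaximal R).out
      exact f.injective_or_eq_zero.resolve_right hf
    have hS := mkSC_shortExact f (LinearMap.range f).mkQ (LinearMap.exact_map_mkQ_range f) hfinj
      (Submodule.mkQ_surjective _)
    have h1 : Subsingleton (Ext (ModuleCat.of R (Q ⧸ LinearMap.range f)) N (r + 1)) :=
      ext_subsingleton_of_residueField N r hr' _ (r + 1) (by omega)
    have h2 : Subsingleton (Ext (ModuleCat.of R Q) N r) :=
      HasProjectiveDimensionLT.subsingleton _ r r le_rfl _
    obtain ⟨a, ha⟩ := exists_ne (0 : Ext (ModuleCat.of R (ResidueField R)) N r)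
    obtain ⟨b, hb⟩ := Ext.contravariant_sequence_exact₁ hS N a (add_comm 1 r)
      (Subsingleton.elim (α := Ext (ModuleCat.of R (Q ⧸ LinearMap.range f)) N (r + 1)) _ _)
    apply ha
    rw [← hb, show b = 0 from Subsingleton.elim (α := Ext (ModuleCat.of R Q) N r) _ _]
    simp
  have htd' : t = d := by omega
  -- depth
  have hrees (n : ℕ) := (ModuleCat.exists_isRegular_tfae (maximalIdeal R) n
    (ModuleCat.of R R) hmaxlt)
  have hfk : Module.Finite R (ResidueField R) := inferInstance
  have hsuppk : Module.support R (ResidueField R) = PrimeSpectrum.zeroLocus (maximalIdeal R) := by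
    rw [Module.support_eq_zeroLocus]
    congr 1
    exact congrArg _ Ideal.annihilator_quotient
  have hlow : ∀ i < d, Subsingleton (Ext (ModuleCat.of R (ResidueField R)) (ModuleCat.of R R) i) := by
    have h41 := ((hrees d).out 3 0 rfl rfl).1 (by rw [← htd']; exact hTt)
    intro i hi
    exact h41 (ModuleCat.of R (ResidueField R)) inferInstance hfk hsuppk.subset i hi
  have hdne : Nontrivial (Ext (ModuleCat.of R (ResidueField R)) (ModuleCat.of R R) d) := by
    rw [← not_subsingleton_iff_nontrivial]
    intro hs
    apply hTt1
    rw [htd']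
    refine ((hrees (d + 1)).out 2 3 rfl rfl).1 ⟨ModuleCat.of R (ResidueField R), inferInstance,
      hfk, hsuppk, ?_⟩
    intro i hi
    rcases Nat.lt_succ_iff_lt_or_eq.1 hi with h | rfl
    · exact hlow i h
    · exact hs
  unfold IsCohenMacaulayLocalRing
  rw [hdim]
  congr 1
  apply le_antisymm
  · apply sInf_le
    refine ⟨d, rfl, ?_⟩
    rw [← not_subsingleton_iff_nontrivial, extM_subsingleton_iff, not_subsingleton_iff_nontrivial]
    exact hdne
  · apply le_sInf
    rintro _ ⟨n, rfl, hn⟩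
    rw [← not_subsingleton_iff_nontrivial, extM_subsingleton_iff] at hn
    have : ¬ n < d := fun hlt => hn (hlow n hlt)
    exact_mod_cast not_lt.1 this

end LocalCM

section Baer

open Abelian

variable {R : Type} [CommRing R]

lemma baer_injDim (c : ℕ) : ∀ (N : ModuleCat.{0} R)
    (_ : ∀ (I : Ideal R) (i : ℕ), c < i → Subsingleton (Ext (ModuleCat.of R (R ⧸ I)) N i)),
    HasInjectiveDimensionLT N (c + 1) := by
  induction c with
  | zero =>
    intro N h
    rw [← injective_iff_hasInjectiveDimensionLT_one]
    have : Module.Injective R N := by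
      apply Module.Baer.injective
      intro I g
      have hS := mkSC_shortExact I.subtype I.mkQ
        (by intro x; simp [Ideal.Quotient.eq_zero_iff_mem]) (Submodule.injective_subtype _) I.mkQ_surjective
      obtain ⟨y, hy⟩ := Ext.contravariant_sequence_exact₁ hS N (Ext.mk₀ (ModuleCat.ofHom g))
        (zero_add 1) (by
          have := h I 1 (by omega)
          exact Subsingleton.elim _ _)
      obtain ⟨y, rfl⟩ := Ext.homEquiv₀.symm.surjective y
      simp only [Ext.homEquiv₀_symm_apply, Ext.mk₀_comp_mk₀] at hy
      have hy' := Ext.homEquiv₀.symm.injective hy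
      refine ⟨y.hom, fun x hx => ?_⟩
      have := congr_arg (fun f => f.hom ⟨x, hx⟩) hy'
      exact this
    exact Module.injective_object_of_injective_module R N
  | succ c ih =>
    intro N h
    let ⟨J, _, f, _⟩ := EnoughInjectives.presentation N
    have hinj : Injective J := inferInstance
    let S := ShortComplex.mk f (Limits.cokernel.π f) (Limits.cokernel.condition f)
    have hS : S.ShortExact := { exact := ShortComplex.exact_cokernel f }
    refine (hS.hasInjectiveDimensionLT_X₃_iff c hinj).1 (ih _ ?_)
    intro I i hi
    refine ⟨fun a b => ?_⟩
    have key : ∀ a : Ext (ModuleCat.of R (R ⧸ I)) S.X₃ i, a = 0 := by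
      intro a
      have := h I (i+1) (by omega)
      obtain ⟨y, rfl⟩ := Ext.covariant_sequence_exact₃ _ hS a rfl (Subsingleton.elim _ _)
      have : Subsingleton (Ext (ModuleCat.of R (R ⧸ I)) S.X₂ i) :=
        HasInjectiveDimensionLT.subsingleton J 1 i (by omega) _
      rw [Subsingleton.elim y 0, Ext.zero_comp]
    rw [key a, key b]

lemma finInjDim_of_hasInjectiveDimensionLT (N : ModuleCat.{0} R) (c : ℕ)
    [HasInjectiveDimensionLT N (c + 1)] : FinInjDim R N :=
  ⟨c, fun i hi L => (extM_subsingleton_iff i L N).2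
    (HasInjectiveDimensionLT.subsingleton N (c + 1) i hi L)⟩

lemma hasProjectiveDimensionLE_of_finProjDim (N : ModuleCat.{0} R) (h : FinProjDim R N) :
    ∃ n : ℕ, HasProjectiveDimensionLE N n := by
  obtain ⟨n, hn⟩ := h
  refine ⟨n, ?_⟩
  rw [HasProjectiveDimensionLE, hasProjectiveDimensionLT_iff]
  intro i hi Y e
  have := (extM_subsingleton_iff i N Y).1 (hn i (by omega) Y)
  exact Subsingleton.elim _ _

lemma support_localizedModule (p : Ideal R) [p.IsPrime] (N : ModuleCat.{0} R)
    (hsupp : Module.support R N = Set.univ) :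
    Module.support (Localization.AtPrime p) (N.localizedModule p.primeCompl) = Set.univ := by
  rw [Set.eq_univ_iff_forall]
  intro q
  have hq : PrimeSpectrum.comap (algebraMap R (Localization.AtPrime p)) q ∈ Module.support R N := by
    rw [hsupp]; trivial
  rw [Module.mem_support_iff'] at hq ⊢
  obtain ⟨m, hm⟩ := hq
  refine ⟨N.localizedModuleMkLinearMap p.primeCompl m, ?_⟩
  intro r hr h0
  obtain ⟨a, s, rfl⟩ := IsLocalization.exists_mk'_eq p.primeCompl r
  have h1 : a • N.localizedModuleMkLinearMap p.primeCompl m = 0 := by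
    have := congr_arg (fun x => algebraMap R (Localization.AtPrime p) s • x) h0
    simp only [smul_zero, smul_smul] at this
    rw [IsLocalization.mk'_spec'] at this
    rw [← this, algebraMap_smul]
  rw [← map_smul, IsLocalizedModule.eq_zero_iff p.primeCompl] at h1
  obtain ⟨t, ht⟩ := h1
  refine hm (t * a) ?_ (by rw [mul_smul]; exact ht)
  intro hta
  apply hr
  have ha : algebraMap R (Localization.AtPrime p) (t * a) ∈ q.asIdeal := hta
  rw [map_mul] at ha
  have hu := IsLocalization.map_units (Localization.AtPrime p) t
  have ha' := (Ideal.unit_mul_mem_iff_mem _ hu).1 ha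
  rw [IsLocalization.mk'_eq_mul_mk'_one]
  exact Ideal.mul_mem_right _ _ ha'

lemma finite_localizedModule (p : Ideal R) [p.IsPrime] (N : ModuleCat.{0} R)
    [Module.Finite R N] :
    Module.Finite (Localization.AtPrime p) (N.localizedModule p.primeCompl) :=
  Module.Finite.of_isLocalizedModule p.primeCompl (N.localizedModuleMkLinearMap p.primeCompl)

lemma cm_of_injDim [IsNoetherianRing R] (N : ModuleCat.{0} R) [Module.Finite R N]
    (hsupp : Module.support R N = Set.univ) (c : ℕ) (h : HasInjectiveDimensionLE N c) :
    IsCohenMacaulayRing R := by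
  intro p hp
  have := finite_localizedModule p N
  have : HasInjectiveDimensionLE (N.localizedModule p.primeCompl) c :=
    ModuleCat.localizedModule_hasInjectiveDimensionLE c p.primeCompl N
  have : IsNoetherianRing (Localization.AtPrime p) :=
    IsLocalization.isNoetherianRing p.primeCompl _ inferInstance
  exact cm_of_finInjDim (N.localizedModule p.primeCompl) (support_localizedModule p N hsupp) c
    (fun i hi => HasInjectiveDimensionLT.subsingleton _ (c + 1) i hi _)

end Baer

section Derived

open Limits Pretriangulated DerivedCategory

universe w

variable {R : Type} [CommRing R] [HasDerivedCategory.{w} (ModuleCat.{0} R)]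

/-- Uniform eventual vanishing of morphisms into the shifts of the objects of a class. -/
def Van (S : Set (DerivedCategory (ModuleCat.{0} R))) (A : DerivedCategory (ModuleCat.{0} R)) :
    Prop :=
  ∃ c : ℤ, ∀ i : ℤ, c ≤ i → ∀ Y ∈ S, ∀ f : A ⟶ Y⟦i⟧, f = 0

/-- A module seen as an object of the derived category, in degree `n`. -/
noncomputable abbrev sgl (n : ℤ) (X : ModuleCat.{0} R) : DerivedCategory (ModuleCat.{0} R) :=
  (singleFunctor (ModuleCat.{0} R) n).obj X

variable {S : Set (DerivedCategory (ModuleCat.{0} R))}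

lemma Van.of_iso {A B : DerivedCategory (ModuleCat.{0} R)} (e : A ≅ B) (h : Van S A) :
    Van S B := by
  obtain ⟨c, hc⟩ := h
  refine ⟨c, fun i hi Y hY f => ?_⟩
  rw [← cancel_epi e.hom, hc i hi Y hY (e.hom ≫ f), comp_zero]

lemma Van.shift {A : DerivedCategory (ModuleCat.{0} R)} (h : Van S A) (n : ℤ) :
    Van S (A⟦n⟧) := by
  obtain ⟨c, hc⟩ := h
  refine ⟨c + n, fun i hi Y hY f => ?_⟩
  let e := (shiftFunctorAdd' (DerivedCategory (ModuleCat.{0} R)) (i - n) n i (by lia)).app Y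
  have h1 : f ≫ e.hom = 0 := by
    obtain ⟨g, hg⟩ := (shiftFunctor (DerivedCategory (ModuleCat.{0} R)) n).map_surjective
      (f ≫ e.hom)
    rw [← hg, hc (i - n) (by lia) Y hY g, Functor.map_zero]
  rw [← cancel_mono e.hom, h1, zero_comp]

lemma Van.of_shift {A : DerivedCategory (ModuleCat.{0} R)} (n : ℤ) (h : Van S (A⟦n⟧)) :
    Van S A :=
  (h.shift (-n)).of_iso ((shiftEquiv (DerivedCategory (ModuleCat.{0} R)) n).unitIso.symm.app A)

lemma Van.mid {T : Triangle (DerivedCategory (ModuleCat.{0} R))} (hT : T ∈ distTriang _)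
    (h₁ : Van S T.obj₁) (h₃ : Van S T.obj₃) : Van S T.obj₂ := by
  obtain ⟨c, hc⟩ := h₁
  obtain ⟨d, hd⟩ := h₃
  refine ⟨max c d, fun i hi Y hY f => ?_⟩
  obtain ⟨g, rfl⟩ := Triangle.yoneda_exact₂ T hT f
    (hc i ((le_max_left _ _).trans hi) Y hY _)
  rw [hd i ((le_max_right _ _).trans hi) Y hY g, comp_zero]

lemma Van.third {T : Triangle (DerivedCategory (ModuleCat.{0} R))} (hT : T ∈ distTriang _)
    (h₁ : Van S T.obj₁) (h₂ : Van S T.obj₂) : Van S T.obj₃ :=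
  Van.mid (rot_of_distTriang _ hT) h₂ (h₁.shift 1)

lemma Van.first {T : Triangle (DerivedCategory (ModuleCat.{0} R))} (hT : T ∈ distTriang _)
    (h₂ : Van S T.obj₂) (h₃ : Van S T.obj₃) : Van S T.obj₁ :=
  Van.mid (inv_rot_of_distTriang _ hT) (h₃.shift (-1)) h₂

lemma van_sgl_iff (n : ℤ) (X : ModuleCat.{0} R) : Van S (sgl n X) ↔ Van S (sgl 0 X) := by
  let e : (sgl n X)⟦n⟧ ≅ sgl 0 X :=
    ((singleFunctors (ModuleCat.{0} R)).shiftIso n 0 n (by lia)).app X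
  exact ⟨fun h => (h.shift n).of_iso e, fun h => (h.of_iso e.symm).of_shift n⟩

/-- Morphisms in the derived category out of a K-projective complex. -/
lemma exists_Q_map_of_isKProjective {K L : CochainComplex (ModuleCat.{0} R) ℤ} [K.IsKProjective]
    (g : Q.obj K ⟶ Q.obj L) : ∃ f : K ⟶ L, Q.map f = g := by
  obtain ⟨f, hf⟩ := (CochainComplex.IsKProjective.Qh_map_bijective K
    ((HomotopyCategory.quotient _ _).obj L)).surjective
    ((quotientCompQhIso _).hom.app K ≫ g ≫ (quotientCompQhIso _).inv.app L)
  obtain ⟨f, rfl⟩ := (HomotopyCategory.quotient _ _).map_surjective f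
  refine ⟨f, ?_⟩
  rw [← cancel_epi ((quotientCompQhIso _).hom.app K), ← quotientCompQhIso_hom_naturality, hf]
  simp

lemma exists_Q_map_of_isKInjective {K L : CochainComplex (ModuleCat.{0} R) ℤ} [L.IsKInjective]
    (g : Q.obj K ⟶ Q.obj L) : ∃ f : K ⟶ L, Q.map f = g := by
  obtain ⟨f, hf⟩ := (CochainComplex.IsKInjective.Qh_map_bijective
    ((HomotopyCategory.quotient _ _).obj K) L).surjective
    ((quotientCompQhIso _).hom.app K ≫ g ≫ (quotientCompQhIso _).inv.app L)
  obtain ⟨f, rfl⟩ := (HomotopyCategory.quotient _ _).map_surjective f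
  refine ⟨f, ?_⟩
  rw [← cancel_epi ((quotientCompQhIso _).hom.app K), ← quotientCompQhIso_hom_naturality, hf]
  simp

lemma isKProjective_single (n : ℤ) (P : ModuleCat.{0} R) [Projective P] :
    CochainComplex.IsKProjective ((HomologicalComplex.single _ (ComplexShape.up ℤ) n).obj P) := by
  have : ∀ i : ℤ, Projective (((HomologicalComplex.single (ModuleCat.{0} R)
      (ComplexShape.up ℤ) n).obj P).X i) := by
    intro i
    by_cases h : i = n
    · subst h
      exact Projective.of_iso (HomologicalComplex.singleObjXSelf _ i P).symm inferInstance
    · exact (HomologicalComplex.isZero_single_obj_X _ _ _ _ h).projective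
  exact CochainComplex.isKProjective_of_projective _ n

/-- Projective modules have no higher maps to bounded above complexes. -/
lemma hom_proj_eq_zero (P : ModuleCat.{0} R) [Projective P]
    (C : CochainComplex (ModuleCat.{0} R) ℤ) (i : ℤ) (hC : IsZero (C.X i))
    (f : sgl 0 P ⟶ (Q.obj C)⟦i⟧) : f = 0 := by
  have := isKProjective_single 0 P
  let e := (Q.commShiftIso i).app C
  obtain ⟨g, hg⟩ := exists_Q_map_of_isKProjective
    (K := (HomologicalComplex.single _ (ComplexShape.up ℤ) 0).obj P) (L := C⟦i⟧) (f ≫ e.inv)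
  have hg0 : g = 0 := by
    refine HomologicalComplex.hom_ext _ _ (fun j => ?_)
    by_cases h : j = 0
    · subst h
      apply IsZero.eq_of_tgt
      dsimp
      rwa [zero_add]
    · exact (HomologicalComplex.isZero_single_obj_X _ _ _ _ h).eq_of_src _ _
  rw [← cancel_mono e.inv, zero_comp]
  exact hg.symm.trans (by rw [hg0, Functor.map_zero]; rfl)

lemma van_proj (P : ModuleCat.{0} R) [Projective P]
    (S : Set (DerivedCategory (ModuleCat.{0} R))) (n : ℤ)
    (hS : ∀ Y ∈ S, ∃ C : CochainComplex (ModuleCat.{0} R) ℤ, Y = Q.obj C ∧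
      ∀ i, n ≤ i → IsZero (C.X i)) : Van S (sgl 0 P) := by
  refine ⟨n, fun i hi Y hY f => ?_⟩
  obtain ⟨C, rfl, hC⟩ := hS Y hY
  exact hom_proj_eq_zero P C i (hC i hi) f

end Derived

section Devissage

open Limits Pretriangulated DerivedCategory

universe w

variable {R : Type} [CommRing R]

lemma finite_of_isZero (X : ModuleCat.{0} R) (h : IsZero X) : Module.Finite R X := by
  have := ModuleCat.subsingleton_of_isZero h
  infer_instance

lemma finite_of_iso {X Y : ModuleCat.{0} R} (e : X ≅ Y) (h : Module.Finite R X) :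
    Module.Finite R Y :=
  Module.Finite.equiv e.toLinearEquiv

lemma finite_of_shortComplex_exact [IsNoetherianRing R] {S : ShortComplex (ModuleCat.{0} R)}
    (hS : S.Exact) (h₁ : Module.Finite R S.X₁) (h₃ : Module.Finite R S.X₃) :
    Module.Finite R S.X₂ := by
  rw [ShortComplex.moduleCat_exact_iff_range_eq_ker] at hS
  have h₃' : IsNoetherian R S.X₃ := isNoetherian_of_isNoetherianRing_of_finite R _
  have h4 : Module.Finite R (LinearMap.ker S.g.hom) := by
    rw [← hS]; infer_instance
  refine ⟨Submodule.fg_of_fg_map_of_fg_inf_ker S.g.hom (IsNoetherian.noetherian _) ?_⟩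
  rw [top_inf_eq]
  exact Module.Finite.iff_fg.1 h4

variable [HasDerivedCategory.{w} (ModuleCat.{0} R)]

lemma homologyFunctor_sgl_isZero (n i : ℤ) (hi : i ≠ n) (X : ModuleCat.{0} R) :
    IsZero ((homologyFunctor (ModuleCat.{0} R) i).obj (sgl n X)) :=
  (HomologicalComplex.isZero_single_obj_homology (ComplexShape.up ℤ) n X i hi).of_iso
    ((homologyFunctorFactors (ModuleCat.{0} R) i).app
      ((HomologicalComplex.single _ (ComplexShape.up ℤ) n).obj X))

/-- The homology of a single complex. -/
noncomputable def homologyFunctorSglIso (n : ℤ) (X : ModuleCat.{0} R) :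
    (homologyFunctor (ModuleCat.{0} R) n).obj (sgl n X) ≅ X :=
  (homologyFunctorFactors (ModuleCat.{0} R) n).app
      ((HomologicalComplex.single _ (ComplexShape.up ℤ) n).obj X) ≪≫
    HomologicalComplex.singleObjHomologySelfIso (ComplexShape.up ℤ) n X

/-- A map from a finite free module in degree `b`, surjective on the top homology. -/
lemma exists_map_epi (A : DerivedCategory (ModuleCat.{0} R)) (b : ℤ) [A.IsLE b]
    (hfin : Module.Finite R ((homologyFunctor (ModuleCat.{0} R) b).obj A)) :
    ∃ (F : ModuleCat.{0} R) (_ : Projective F) (_ : Module.Finite R F) (f : sgl b F ⟶ A),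
      Epi ((homologyFunctor (ModuleCat.{0} R) b).map f) := by
  obtain ⟨K, _, ⟨e⟩⟩ := exists_iso_Q_obj_of_isLE A b
  let e' : (homologyFunctor (ModuleCat.{0} R) b).obj A ≅ K.homology b :=
    (homologyFunctor (ModuleCat.{0} R) b).mapIso e ≪≫
      (homologyFunctorFactors (ModuleCat.{0} R) b).app K
  have hK : Module.Finite R (K.homology b) := finite_of_iso e' hfin
  obtain ⟨m, g, hg⟩ := Module.Finite.exists_fin' R (K.homology b)
  let F : ModuleCat.{0} R := ModuleCat.of R (Fin m → R)
  have hF : Projective F := by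
    rw [← IsProjective.iff_projective]
    infer_instance
  have hgepi : Epi (ModuleCat.ofHom g : F ⟶ K.homology b) := (ModuleCat.epi_iff_surjective _).2 hg
  let φ : F ⟶ K.cycles b := Projective.factorThru (ModuleCat.ofHom g) (K.homologyπ b)
  have hφ : φ ≫ K.homologyπ b = ModuleCat.ofHom g := Projective.factorThru_comp _ _
  let f : (HomologicalComplex.single _ (ComplexShape.up ℤ) b).obj F ⟶ K :=
    HomologicalComplex.mkHomFromSingle (φ ≫ K.iCycles b) (by intro k hk; simp)
  have hf : Epi (HomologicalComplex.homologyMap f b) := by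
    have h1 : (HomologicalComplex.singleObjCyclesSelfIso (ComplexShape.up ℤ) b F).inv ≫
        HomologicalComplex.cyclesMap f b = φ := by
      rw [← cancel_mono (K.iCycles b)]
      simp [f]
    have h2 : (HomologicalComplex.singleObjCyclesSelfIso (ComplexShape.up ℤ) b F).inv ≫
        ((HomologicalComplex.single _ (ComplexShape.up ℤ) b).obj F).homologyπ b ≫
        HomologicalComplex.homologyMap f b = ModuleCat.ofHom g := by
      rw [HomologicalComplex.homologyπ_naturality, reassoc_of% h1, hφ]
    have h3 : Epi (((HomologicalComplex.singleObjCyclesSelfIso (ComplexShape.up ℤ) b F).inv ≫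
        ((HomologicalComplex.single _ (ComplexShape.up ℤ) b).obj F).homologyπ b) ≫
        HomologicalComplex.homologyMap f b) := by
      rw [Category.assoc, h2]; exact hgepi
    exact @epi_of_epi _ _ _ _ _ _ (HomologicalComplex.homologyMap f b) h3
  refine ⟨F, hF, (inferInstance : Module.Finite R (Fin m → R)), Q.map f ≫ e.inv, ?_⟩
  have h4 : Epi ((homologyFunctor (ModuleCat.{0} R) b).map (Q.map f)) := by
    have := homologyFunctorFactors_hom_naturality f b
    have h5 : Epi ((homologyFunctor (ModuleCat.{0} R) b).map (Q.map f) ≫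
        (homologyFunctorFactors (ModuleCat.{0} R) b).hom.app K) := by
      rw [this]; exact @epi_comp _ _ _ _ _ _ inferInstance _ hf
    have h6 := epi_comp ((homologyFunctor (ModuleCat.{0} R) b).map (Q.map f) ≫
        (homologyFunctorFactors (ModuleCat.{0} R) b).hom.app K)
        ((homologyFunctorFactors (ModuleCat.{0} R) b).inv.app K)
    simpa using h6
  have h7 : Epi ((homologyFunctor (ModuleCat.{0} R) b).map (Q.map f) ≫
      (homologyFunctor (ModuleCat.{0} R) b).map e.inv) := @epi_comp _ _ _ _ _ _ h4 _ inferInstance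
  rw [← Functor.map_comp] at h7
  exact h7

lemma devissage [IsNoetherianRing R] (a : ℤ) (m : ℕ) :
    ∀ (A : DerivedCategory (ModuleCat.{0} R)) (_ : A.IsGE a) (_ : A.IsLE (a + m))
    (_ : ∀ i, Module.Finite R ((homologyFunctor (ModuleCat.{0} R) i).obj A)),
    ∃ (Z : ModuleCat.{0} R) (_ : Module.Finite R Z), ∀ S : Set (DerivedCategory (ModuleCat.{0} R)),
      (∀ (P : ModuleCat.{0} R) (_ : Projective P), Van S (sgl 0 P)) →
      (Van S A ↔ Van S (sgl 0 Z)) := by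
  induction m with
  | zero =>
    intro A _ hle hfin
    have : A.IsLE a := by simpa using hle
    obtain ⟨Z, ⟨e⟩⟩ := exists_iso_singleFunctor_obj_of_isGE_of_isLE A a
    refine ⟨Z, ?_, fun S hS => ?_⟩
    · exact finite_of_iso ((homologyFunctor (ModuleCat.{0} R) a).mapIso e ≪≫
        homologyFunctorSglIso a Z) (hfin a)
    · rw [← van_sgl_iff a Z]
      exact ⟨fun h => h.of_iso e, fun h => h.of_iso e.symm⟩
  | succ m ih =>
    intro A hge hle hfin
    obtain ⟨F, _, _, f, hf⟩ := exists_map_epi A (a + (m + 1 : ℕ)) (hfin _)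
    obtain ⟨B, g, h, hT⟩ := distinguished_cocone_triangle f
    let T := Triangle.mk f g h
    have hFfin : ∀ i, Module.Finite R ((homologyFunctor (ModuleCat.{0} R) i).obj
        (sgl (a + (m + 1 : ℕ)) F)) := by
      intro i
      by_cases hi : i = a + (m + 1 : ℕ)
      · rw [hi]
        exact finite_of_iso (homologyFunctorSglIso _ F).symm inferInstance
      · exact finite_of_isZero _ (homologyFunctor_sgl_isZero _ _ hi F)
    have ex : ∀ i, (ShortComplex.mk _ _ (HomologySequence.comp_δ T hT i (i + 1) rfl)).Exact :=
      fun i => HomologySequence.exact₃ T hT i (i + 1) rfl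
    have hzero : ∀ i, i ≠ a + m → IsZero ((homologyFunctor (ModuleCat.{0} R) i).obj A) →
        IsZero ((homologyFunctor (ModuleCat.{0} R) i).obj B) := by
      intro i hi hA
      exact (ex i).isZero_of_both_zeros (hA.eq_of_src _ _)
        ((homologyFunctor_sgl_isZero _ _ (by push_cast; lia) F).eq_of_tgt _ _)
    have hBle : B.IsLE (a + m) := by
      rw [isLE_iff]
      intro i hi
      by_cases hib : i = a + (m + 1 : ℕ)
      · subst hib
        have := (HomologySequence.epi_homologyMap_mor₁_iff T hT (a + (m + 1 : ℕ))).1 hf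
        exact (ex _).isZero_of_both_zeros this
          ((homologyFunctor_sgl_isZero _ _ (by lia) F).eq_of_tgt _ _)
      · exact hzero i (by lia) (A.isZero_of_isLE (a + (m + 1 : ℕ)) i (by push_cast at hib ⊢; lia))
    have hBge : B.IsGE a := by
      rw [isGE_iff]
      intro i hi
      exact hzero i (by lia) (A.isZero_of_isGE a i hi)
    obtain ⟨Z, hZ, hZ'⟩ := ih B hBge hBle (fun i =>
      finite_of_shortComplex_exact (ex i) (hfin i) (hFfin (i + 1)))
    refine ⟨Z, hZ, fun S hS => ?_⟩
    rw [← hZ' S hS]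
    have hF : Van S (sgl (a + (m + 1 : ℕ)) F) := (van_sgl_iff _ F).2 (hS F inferInstance)
    exact ⟨fun hA => Van.third hT hF hA, fun hB => Van.mid hT hF hB⟩

/-- Finite projective dimension implies eventual vanishing. -/
lemma van_of_projDim (S : Set (DerivedCategory (ModuleCat.{0} R)))
    (hS : ∀ (P : ModuleCat.{0} R) (_ : Projective P), Van S (sgl 0 P)) (d : ℕ) :
    ∀ (Z : ModuleCat.{0} R) (_ : HasProjectiveDimensionLT Z (d + 1)), Van S (sgl 0 Z) := by
  induction d with
  | zero =>
    intro Z h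
    exact hS Z (projective_iff_hasProjectiveDimensionLT_one.2 h)
  | succ d ih =>
    intro Z h
    have hE := ModuleCat.shortExact_projectiveShortComplex Z
    have : Van S (sgl 0 Z.projectiveShortComplex.X₁) := by
      apply ih
      exact (hE.hasProjectiveDimensionLT_X₃_iff d inferInstance).1 h
    exact Van.third hE.singleTriangle_distinguished this (hS _ inferInstance)

end Devissage

section Abstract

open Limits Pretriangulated Opposite

universe v u

set_option linter.unusedSectionVars false

variable {T : Type u} [Category.{v} T] [Preadditive T] [HasZeroObject T] [HasShift T ℤ]
  [∀ n : ℤ, (shiftFunctor T n).Additive] [Pretriangulated T]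

/-- All morphisms from `X` to `Y⟦i⟧` vanish. -/
def HV (X Y : T) (i : ℤ) : Prop := ∀ f : X ⟶ Y⟦i⟧, f = 0

lemma HV.zero_of {X Y : T} {i j k : ℤ} (h : HV X Y k) (hk : i + j = k) (f : X ⟶ (Y⟦i⟧)⟦j⟧) :
    f = 0 := by
  let e := (shiftFunctorAdd' T i j k hk).app Y
  rw [← cancel_mono e.inv, zero_comp]
  exact h _

lemma HV.shift_of {X Y : T} {i j k : ℤ} (h : HV X Y k) (hk : k + j = i)
    (f : X⟦j⟧ ⟶ Y⟦i⟧) : f = 0 := by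
  let e := (shiftFunctorAdd' T k j i hk).app Y
  rw [← cancel_mono e.hom, zero_comp]
  obtain ⟨g, hg⟩ := (shiftFunctor T j).map_surjective (f ≫ e.hom)
  rw [← hg, h g, Functor.map_zero]

lemma HV.of_iso {X X' Y Y' : T} {i : ℤ} (e : X ≅ X') (e' : Y ≅ Y') (h : HV X Y i) :
    HV X' Y' i := by
  intro f
  rw [← cancel_epi e.hom, ← cancel_mono (e'.inv⟦i⟧')]
  simp only [comp_zero, zero_comp]
  exact h _

section Tri

variable {A B C : T} {f : A ⟶ B} {g : B ⟶ C} {δ : C ⟶ A⟦(1 : ℤ)⟧}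

lemma tri_c1 (hT : Triangle.mk f g δ ∈ distTriang T) {Y : T} {i : ℤ} (h : HV C Y (i + 1)) (φ : A ⟶ Y⟦i⟧) :
    ∃ ψ : B ⟶ Y⟦i⟧, φ = f ≫ ψ := by
  have h0 : δ ≫ φ⟦(1 : ℤ)⟧' = 0 := h.zero_of rfl _
  obtain ⟨ψ, hψ⟩ : ∃ ψ : B⟦(1 : ℤ)⟧ ⟶ (Y⟦i⟧)⟦(1 : ℤ)⟧, φ⟦(1 : ℤ)⟧' = (-f⟦(1 : ℤ)⟧') ≫ ψ :=
    Triangle.yoneda_exact₃ _ (rot_of_distTriang _ hT) (φ⟦(1 : ℤ)⟧') h0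
  obtain ⟨χ, hχ⟩ := (shiftFunctor T (1 : ℤ)).map_surjective ψ
  refine ⟨-χ, (shiftFunctor T (1 : ℤ)).map_injective ?_⟩
  rw [hψ, ← hχ]
  simp

lemma tri_c2 (hT : Triangle.mk f g δ ∈ distTriang T) {Y : T} (ψ : B ⟶ Y) (h : f ≫ ψ = 0) : ∃ χ : C ⟶ Y, ψ = g ≫ χ :=
  Triangle.yoneda_exact₂ _ hT ψ h

lemma tri_c3 (hT : Triangle.mk f g δ ∈ distTriang T) {Y : T} {i j : ℤ} (h : HV A Y j) (hj : j + 1 = i) (χ : C ⟶ Y⟦i⟧)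
    (hχ : g ≫ χ = 0) : χ = 0 := by
  obtain ⟨ψ, hψ⟩ : ∃ ψ : A⟦(1 : ℤ)⟧ ⟶ Y⟦i⟧, χ = δ ≫ ψ := Triangle.yoneda_exact₃ _ hT χ hχ
  have : ψ = 0 := h.shift_of hj ψ
  rw [hψ, this, comp_zero]

lemma tri_shift (hT : Triangle.mk f g δ ∈ distTriang T) (i : ℤ) : ∃ δ' : C⟦i⟧ ⟶ (A⟦i⟧)⟦(1 : ℤ)⟧,
    Triangle.mk (i.negOnePow • f⟦i⟧') (i.negOnePow • g⟦i⟧') δ' ∈ distTriang T :=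
  ⟨_, Triangle.shift_distinguished _ hT i⟩

lemma tri_d2 (hT : Triangle.mk f g δ ∈ distTriang T) {X : T} {i : ℤ} (ψ : X ⟶ B⟦i⟧) (h : ψ ≫ g⟦i⟧' = 0) :
    ∃ χ : X ⟶ A⟦i⟧, ψ = χ ≫ f⟦i⟧' := by
  obtain ⟨δ', hδ'⟩ := tri_shift hT i
  have h0 : ψ ≫ (i.negOnePow • g⟦i⟧') = 0 := by
    rcases Int.units_eq_one_or i.negOnePow with e | e
    · simpa [e] using h
    · simpa [e] using h
  obtain ⟨χ, hχ⟩ : ∃ χ : X ⟶ A⟦i⟧, ψ = χ ≫ (i.negOnePow • f⟦i⟧') :=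
    Triangle.coyoneda_exact₂ _ hδ' ψ h0
  rcases Int.units_eq_one_or i.negOnePow with e | e
  · exact ⟨χ, by simpa [e] using hχ⟩
  · exact ⟨-χ, by simpa [e] using hχ⟩

lemma tri_d1 (hT : Triangle.mk f g δ ∈ distTriang T) {X : T} {i : ℤ} (h : HV X A (i + 1)) (φ : X ⟶ C⟦i⟧) :
    ∃ ψ : X ⟶ B⟦i⟧, φ = ψ ≫ g⟦i⟧' := by
  obtain ⟨δ', hδ'⟩ := tri_shift hT i
  obtain ⟨χ, hχ⟩ : ∃ χ : X ⟶ B⟦i⟧, φ = χ ≫ (i.negOnePow • g⟦i⟧') :=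
    Triangle.coyoneda_exact₃ _ hδ' φ (h.zero_of rfl _)
  rcases Int.units_eq_one_or i.negOnePow with e | e
  · exact ⟨χ, by simpa [e] using hχ⟩
  · exact ⟨-χ, by simpa [e] using hχ⟩

lemma tri_d3 (hT : Triangle.mk f g δ ∈ distTriang T) {X : T} {i j : ℤ} (h : HV X C j) (hj : j + 1 = i) (χ : X ⟶ A⟦i⟧)
    (hχ : χ ≫ f⟦i⟧' = 0) : χ = 0 := by
  obtain ⟨ψ, hψ⟩ := tri_d2 (inv_rot_of_distTriang _ hT) χ hχ
  have h1 : ψ = 0 := HV.zero_of (Y := C) (i := -1) h (by lia) ψ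
  exact hψ.trans (by rw [h1]; exact zero_comp)

end Tri

end Abstract

section AbstractDual

open Limits Pretriangulated Opposite

universe v u

set_option linter.unusedSectionVars false

section TriZero

variable {T : Type u} [Category.{v} T] [Preadditive T] [HasZeroObject T] [HasShift T ℤ]
  [∀ n : ℤ, (shiftFunctor T n).Additive] [Pretriangulated T]
variable {A B C : T} {f : A ⟶ B} {g : B ⟶ C} {δ : C ⟶ A⟦(1 : ℤ)⟧}

lemma tri_c1_zero (hT : Triangle.mk f g δ ∈ distTriang T) {Y : T} (h : HV C Y 1) (φ : A ⟶ Y) : ∃ ψ : B ⟶ Y, φ = f ≫ ψ := by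
  let e := (shiftFunctorZero T ℤ).app Y
  obtain ⟨ψ, hψ⟩ := tri_c1 hT (i := 0) (by simpa using h) (φ ≫ e.inv)
  exact ⟨ψ ≫ e.hom, by rw [← Category.assoc, ← hψ]; simp [e]⟩

lemma tri_c3_zero (hT : Triangle.mk f g δ ∈ distTriang T) {Y : T} (h : HV A Y (-1)) (χ : C ⟶ Y) (hχ : g ≫ χ = 0) : χ = 0 := by
  let e := (shiftFunctorZero T ℤ).app Y
  rw [← cancel_mono e.inv, zero_comp]
  exact tri_c3 hT (i := 0) h (by lia) (χ ≫ e.inv) (by rw [reassoc_of% hχ, zero_comp])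

lemma tri_d1_zero (hT : Triangle.mk f g δ ∈ distTriang T) {X : T} (h : HV X A 1) (φ : X ⟶ C) : ∃ ψ : X ⟶ B, φ = ψ ≫ g := by
  have h0 : φ ≫ δ = 0 := h _
  exact Triangle.coyoneda_exact₃ _ hT φ h0

lemma tri_d3_zero (hT : Triangle.mk f g δ ∈ distTriang T) {X : T} (h : HV X C (-1)) (χ : X ⟶ A) (hχ : χ ≫ f = 0) : χ = 0 := by
  let e := (shiftFunctorZero T ℤ).app A
  let e' := (shiftFunctorZero T ℤ).app B
  rw [← cancel_mono e.inv, zero_comp]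
  refine tri_d3 hT (i := 0) h (by lia) (χ ≫ e.inv) ?_
  have := (shiftFunctorZero T ℤ).inv.naturality f
  simp only [Functor.id_map] at this
  rw [Category.assoc]
  simp only [e, Iso.app_inv]
  rw [← this, reassoc_of% hχ, zero_comp]

end TriZero

variable {R : Type} [CommRing R]

/-- The free module of rank `m`. -/
abbrev Fr (R : Type) [CommRing R] (m : ℕ) : ModuleCat.{0} R := ModuleCat.of R (Fin m → R)

/-- The ring as a module. -/
abbrev A1 (R : Type) [CommRing R] : ModuleCat.{0} R := ModuleCat.of R R

/-- The projections. -/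
def prF (m : ℕ) (j : Fin m) : Fr R m ⟶ A1 R := ModuleCat.ofHom (LinearMap.proj j)

/-- The inclusions. -/
def inF (m : ℕ) (j : Fin m) : A1 R ⟶ Fr R m := ModuleCat.ofHom (LinearMap.single R (fun _ => R) j)

lemma sum_prF_inF (m : ℕ) : ∑ j, prF (R := R) m j ≫ inF m j = 𝟙 (Fr R m) := by
  apply ModuleCat.hom_ext
  refine LinearMap.ext fun v => ?_
  rw [ModuleCat.hom_sum, LinearMap.sum_apply]
  simp only [prF, inF, ModuleCat.hom_comp, ModuleCat.hom_ofHom, LinearMap.comp_apply]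
  exact Finset.univ_sum_single v

/-- The map corresponding to an element. -/
def elt {L : ModuleCat.{0} R} (x : L) : A1 R ⟶ L := ModuleCat.ofHom (LinearMap.toSpanSingleton R L x)

lemma eq_zero_of_elt {L N : ModuleCat.{0} R} (f : L ⟶ N) (h : ∀ x : L, elt x ≫ f = 0) : f = 0 := by
  apply ModuleCat.hom_ext
  refine LinearMap.ext fun x => ?_
  have := congrArg (fun φ : A1 R ⟶ N => φ.hom (1 : R)) (h x)
  simpa [elt] using this

instance (m : ℕ) : Projective (Fr R m) := by
  rw [← IsProjective.iff_projective]
  infer_instance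

lemma exists_cover [IsNoetherianRing R] (N : ModuleCat.{0} R) [Module.Finite R N] :
    ∃ (m : ℕ) (K : ModuleCat.{0} R) (_ : Module.Finite R K) (i : K ⟶ Fr R m) (p : Fr R m ⟶ N)
      (w : i ≫ p = 0), (ShortComplex.mk i p w).ShortExact := by
  obtain ⟨m, g, hg⟩ := Module.Finite.exists_fin' R N
  exact ⟨m, ModuleCat.of R (LinearMap.ker g), (inferInstance : Module.Finite R (LinearMap.ker g)),
    ModuleCat.ofHom (LinearMap.ker g).subtype, ModuleCat.ofHom g, _,
    LinearMap.shortExact_shortComplexKer hg⟩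

variable {T : Type u} [Category.{v} T] [Preadditive T] [HasZeroObject T] [HasShift T ℤ]
  [∀ n : ℤ, (shiftFunctor T n).Additive] [Pretriangulated T]

variable (F : (ModuleCat.{0} R)ᵒᵖ ⥤ T) [F.Additive]

lemma F_decomp (m : ℕ) : ∑ j, F.map (inF (R := R) m j).op ≫ F.map (prF m j).op =
    𝟙 (F.obj (op (Fr R m))) := by
  rw [← F.map_id, ← op_id, ← sum_prF_inF, op_sum, F.map_sum]
  simp

/-- The functor sends short exact sequences to triangles. -/
def IsTri : Prop := ∀ {A B C : ModuleCat.{0} R} (i : A ⟶ B) (p : B ⟶ C) (w : i ≫ p = 0),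
  (ShortComplex.mk i p w).ShortExact →
  ∃ δ : F.obj (op A) ⟶ (F.obj (op C))⟦(1 : ℤ)⟧,
    Triangle.mk (F.map p.op) (F.map i.op) δ ∈ distTriang T

variable {F}

lemma hv_free_left {Y : T} {i : ℤ} (h : HV (F.obj (op (A1 R))) Y i) (m : ℕ) :
    HV (F.obj (op (Fr R m))) Y i := by
  intro φ
  rw [← Category.id_comp φ, ← F_decomp, Preadditive.sum_comp]
  refine Finset.sum_eq_zero fun j _ => ?_
  rw [Category.assoc, h (F.map (prF m j).op ≫ φ), comp_zero]

lemma hv_free_right {X : T} {i : ℤ} (h : HV X (F.obj (op (A1 R))) i) (m : ℕ) :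
    HV X (F.obj (op (Fr R m))) i := by
  intro φ
  rw [← Category.comp_id φ, ← (shiftFunctor T i).map_id, ← F_decomp, Functor.map_sum,
    Preadditive.comp_sum]
  refine Finset.sum_eq_zero fun j _ => ?_
  rw [Functor.map_comp, ← Category.assoc, h (φ ≫ (F.map (inF m j).op)⟦i⟧'), zero_comp]

lemma hv_retract_left {Y : T} {i : ℤ} {P N : ModuleCat.{0} R} (s : N ⟶ P) (p : P ⟶ N)
    (hsp : s ≫ p = 𝟙 N) (h : HV (F.obj (op P)) Y i) : HV (F.obj (op N)) Y i := by
  intro φ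
  have : F.map p.op ≫ F.map s.op = 𝟙 _ := by
    rw [← F.map_comp, ← op_comp, hsp, op_id, F.map_id]
  rw [← Category.id_comp φ, ← this, Category.assoc, h (F.map s.op ≫ φ), comp_zero]

/-- The hypotheses for the duality. -/
structure DualHyp (F : (ModuleCat.{0} R)ᵒᵖ ⥤ T) (𝒩 : ModuleCat.{0} R → Prop) : Prop where
  fin : ∀ N, 𝒩 N → Module.Finite R N
  closed : ∀ (N : ModuleCat.{0} R) (_ : 𝒩 N) (m : ℕ) (K : ModuleCat.{0} R) (i : K ⟶ Fr R m)
    (p : Fr R m ⟶ N) (w : i ≫ p = 0), (ShortComplex.mk i p w).ShortExact → 𝒩 K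
  van : ∀ N, 𝒩 N → ∀ i : ℤ, 1 ≤ i → HV (F.obj (op N)) (F.obj (op (A1 R))) i
  surj : ∀ φ : F.obj (op (A1 R)) ⟶ F.obj (op (A1 R)), ∃ r : A1 R ⟶ A1 R, φ = F.map r.op
  inj : ∀ r : A1 R ⟶ A1 R, F.map r.op = 0 → r = 0
  tri : IsTri F

namespace DualHyp

variable {𝒩 : ModuleCat.{0} R → Prop}

lemma surj_free (H : DualHyp F 𝒩) (m : ℕ) (φ : F.obj (op (Fr R m)) ⟶ F.obj (op (A1 R))) :
    ∃ f : A1 R ⟶ Fr R m, φ = F.map f.op := by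
  choose r hr using fun j => H.surj (F.map (prF m j).op ≫ φ)
  refine ⟨∑ j, r j ≫ inF m j, ?_⟩
  rw [← Category.id_comp φ, ← F_decomp, Preadditive.sum_comp, op_sum, F.map_sum]
  refine Finset.sum_congr rfl fun j _ => ?_
  rw [Category.assoc, hr, op_comp, F.map_comp]

lemma inj_free (H : DualHyp F 𝒩) (m : ℕ) (f : A1 R ⟶ Fr R m) (hf : F.map f.op = 0) : f = 0 := by
  rw [← Category.comp_id f, ← sum_prF_inF, Preadditive.comp_sum]
  refine Finset.sum_eq_zero fun j _ => ?_
  rw [← Category.assoc, H.inj (f ≫ prF m j) (by rw [op_comp, F.map_comp, hf, comp_zero]), zero_comp]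

variable [IsNoetherianRing R]

lemma surj_all (H : DualHyp F 𝒩) (N : ModuleCat.{0} R) (hN : 𝒩 N)
    (φ : F.obj (op N) ⟶ F.obj (op (A1 R))) : ∃ f : A1 R ⟶ N, φ = F.map f.op := by
  have := H.fin N hN
  obtain ⟨m, K, _, i, p, w, hS⟩ := exists_cover N
  have hK := H.closed N hN m K i p w hS
  obtain ⟨δ, hT⟩ := H.tri i p w hS
  obtain ⟨ψ, rfl⟩ := tri_c1_zero hT (H.van K hK 1 le_rfl) φ
  obtain ⟨f, rfl⟩ := H.surj_free m ψ
  exact ⟨f ≫ p, by rw [op_comp, F.map_comp]⟩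

lemma inj_one (H : DualHyp F 𝒩) (N : ModuleCat.{0} R) (hN : 𝒩 N)
    (f : A1 R ⟶ N) (hf : F.map f.op = 0) : f = 0 := by
  have := H.fin N hN
  obtain ⟨m, K, _, i, p, w, hS⟩ := exists_cover N
  have hK := H.closed N hN m K i p w hS
  obtain ⟨δ, hT⟩ := H.tri i p w hS
  have := hS.epi_g
  obtain ⟨f', rfl⟩ : ∃ f' : A1 R ⟶ Fr R m, f = f' ≫ p := by
    have : Projective (A1 R) := by
      rw [← IsProjective.iff_projective]; infer_instance
    exact ⟨Projective.factorThru f p, (Projective.factorThru_comp f p).symm⟩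
  rw [op_comp, F.map_comp] at hf
  obtain ⟨y, hy⟩ := tri_c2 hT (F.map f'.op) hf
  obtain ⟨g, rfl⟩ := H.surj_all K hK y
  have : f' - g ≫ i = 0 := by
    apply H.inj_free
    rw [op_sub, F.map_sub, hy, op_comp, F.map_comp, sub_self]
  rw [sub_eq_zero.1 this, Category.assoc, w, comp_zero]

lemma inj_all (H : DualHyp F 𝒩) (N : ModuleCat.{0} R) (hN : 𝒩 N) (L : ModuleCat.{0} R)
    (f : L ⟶ N) (hf : F.map f.op = 0) : f = 0 := by
  refine eq_zero_of_elt f fun x => H.inj_one N hN _ ?_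
  rw [op_comp, F.map_comp, hf, zero_comp]

lemma surj_to_free (H : DualHyp F 𝒩) (N : ModuleCat.{0} R) (hN : 𝒩 N) (m : ℕ)
    (φ : F.obj (op N) ⟶ F.obj (op (Fr R m))) : ∃ f : Fr R m ⟶ N, φ = F.map f.op := by
  choose r hr using fun j => H.surj_all N hN (φ ≫ F.map (inF m j).op)
  refine ⟨∑ j, prF m j ≫ r j, ?_⟩
  rw [← Category.comp_id φ, ← F_decomp, Preadditive.comp_sum, op_sum, F.map_sum]
  refine Finset.sum_congr rfl fun j _ => ?_
  rw [← Category.assoc, hr, op_comp, F.map_comp]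

lemma van_to_free (H : DualHyp F 𝒩) (N : ModuleCat.{0} R) (hN : 𝒩 N) (m : ℕ) (i : ℤ)
    (hi : 1 ≤ i) : HV (F.obj (op N)) (F.obj (op (Fr R m))) i :=
  hv_free_right (H.van N hN i hi) m

lemma ext_of_hv (H : DualHyp F 𝒩) (N : ModuleCat.{0} R) (hN : 𝒩 N) (n : ℕ) :
    ∀ (L : ModuleCat.{0} R) (_ : Module.Finite R L)
      (_ : HV (F.obj (op N)) (F.obj (op L)) ((n + 1 : ℕ) : ℤ)),
      Subsingleton (Abelian.Ext L N (n + 1)) := by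
  induction n with
  | zero =>
    intro L _ hL
    obtain ⟨m, K, _, i, p, w, hS⟩ := exists_cover L
    obtain ⟨δ, hT⟩ := H.tri i p w hS
    refine subsingleton_of_forall_eq 0 fun x => ?_
    obtain ⟨x₁, hx₁⟩ := Abelian.Ext.contravariant_sequence_exact₃ hS N x
      (Abelian.Ext.eq_zero_of_projective _) (by lia : 1 + 0 = 0 + 1)
    obtain ⟨g, rfl⟩ := (Abelian.Ext.mk₀_bijective _ _).2 x₁
    obtain ⟨ψ, hψ⟩ := tri_d1_zero hT (by simpa using hL) (F.map g.op)
    obtain ⟨h, rfl⟩ := H.surj_to_free N hN m ψ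
    have : g - i ≫ h = 0 := by
      apply H.inj_all N hN
      rw [op_sub, F.map_sub, hψ, op_comp, F.map_comp, sub_self]
    rw [← hx₁, sub_eq_zero.1 this, ← Abelian.Ext.mk₀_comp_mk₀]
    exact hS.extClass_comp_assoc _
  | succ n ih =>
    intro L _ hL
    obtain ⟨m, K, _, i, p, w, hS⟩ := exists_cover L
    obtain ⟨δ, hT⟩ := H.tri i p w hS
    have hK := ih K inferInstance (by
      intro φ
      obtain ⟨ψ, rfl⟩ := tri_d1 hT (by push_cast at hL ⊢; exact hL) φ
      rw [H.van_to_free N hN m _ (by push_cast; lia) ψ, zero_comp])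
    refine subsingleton_of_forall_eq 0 fun x => ?_
    obtain ⟨x₁, hx₁⟩ := Abelian.Ext.contravariant_sequence_exact₃ hS N x
      (Abelian.Ext.eq_zero_of_projective _) (by lia : 1 + (n + 1) = (n + 1) + 1)
    rw [← hx₁, Subsingleton.elim x₁ 0, Abelian.Ext.comp_zero]

/-- Negative vanishing. -/
lemma hv_neg (H : DualHyp F 𝒩) (N : ModuleCat.{0} R)
    (hneg : ∀ i : ℤ, i ≤ -1 → HV (F.obj (op N)) (F.obj (op (A1 R))) i) (c : ℤ)
    (hc : ∀ (L : ModuleCat.{0} R), Module.Finite R L → ∀ i : ℤ, i ≤ c →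
      HV (F.obj (op N)) (F.obj (op L)) i) (n : ℕ) :
    ∀ (L : ModuleCat.{0} R), Module.Finite R L → ∀ i : ℤ, i ≤ -1 → i ≤ c + n →
      HV (F.obj (op N)) (F.obj (op L)) i := by
  induction n with
  | zero => intro L hL i _ hi; exact hc L hL i (by simpa using hi)
  | succ n ih =>
    intro L hL i hi hi'
    obtain ⟨m, K, hK, j, p, w, hS⟩ := exists_cover L
    obtain ⟨δ, hT⟩ := H.tri j p w hS
    intro φ
    exact tri_d3 hT (ih K hK (i - 1) (by lia) (by push_cast at hi'; lia)) (by lia) φ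
      (hv_free_right (hneg i hi) m _)

lemma surj_gen (H : DualHyp F 𝒩) (N : ModuleCat.{0} R) (hN : 𝒩 N)
    (hneg : ∀ (L : ModuleCat.{0} R), Module.Finite R L →
      HV (F.obj (op N)) (F.obj (op L)) (-1))
    (L : ModuleCat.{0} R) (hL : Module.Finite R L) (φ : F.obj (op N) ⟶ F.obj (op L)) :
    ∃ f : L ⟶ N, φ = F.map f.op := by
  obtain ⟨m, K, hK, j, p, w, hS⟩ := exists_cover L
  obtain ⟨δ, hT⟩ := H.tri j p w hS
  obtain ⟨f, hf⟩ := H.surj_to_free N hN m (φ ≫ F.map p.op)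
  have h0 : j ≫ f = 0 := by
    apply H.inj_all N hN
    rw [op_comp, F.map_comp, ← hf, Category.assoc, ← F.map_comp, ← op_comp, w, op_zero,
      F.map_zero, comp_zero]
  have := hS.epi_g
  refine ⟨hS.exact.desc f h0, ?_⟩
  have h1 : p ≫ hS.exact.desc f h0 = f := hS.exact.g_desc f h0
  rw [← sub_eq_zero]
  refine tri_d3_zero hT (hneg K hK) _ ?_
  rw [Preadditive.sub_comp, ← F.map_comp, ← op_comp, h1, hf, sub_self]

lemma hv_of_ext (H : DualHyp F 𝒩) (N : ModuleCat.{0} R) (hN : 𝒩 N)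
    (hneg : ∀ (L : ModuleCat.{0} R), Module.Finite R L →
      HV (F.obj (op N)) (F.obj (op L)) (-1)) (n : ℕ) :
    ∀ (L : ModuleCat.{0} R) (_ : Module.Finite R L)
      (_ : Subsingleton (Abelian.Ext L N (n + 1))),
      HV (F.obj (op N)) (F.obj (op L)) ((n + 1 : ℕ) : ℤ) := by
  induction n with
  | zero =>
    intro L _ hL
    obtain ⟨m, K, hK, i, p, w, hS⟩ := exists_cover L
    obtain ⟨δ, hT⟩ := H.tri i p w hS
    simp only [zero_add, Nat.cast_one]
    intro φ
    obtain ⟨ψ, hψ⟩ : ∃ ψ : F.obj (op N) ⟶ F.obj (op K), φ = ψ ≫ δ :=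
      Triangle.coyoneda_exact₁ _ hT φ (H.van_to_free N hN m 1 le_rfl _)
    obtain ⟨g, rfl⟩ := H.surj_gen N hN hneg K hK ψ
    obtain ⟨x, hx⟩ := Abelian.Ext.contravariant_sequence_exact₁ hS N (Abelian.Ext.mk₀ g)
      (by lia : 1 + 0 = 0 + 1) (Subsingleton.elim _ _)
    obtain ⟨h, rfl⟩ := (Abelian.Ext.mk₀_bijective _ _).2 x
    rw [Abelian.Ext.mk₀_comp_mk₀] at hx
    have hg := (Abelian.Ext.mk₀_bijective _ _).1 hx
    have h0 : F.map i.op ≫ δ = 0 := comp_distTriang_mor_zero₂₃ _ hT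
    rw [hψ, ← hg]
    simp only [op_comp, F.map_comp, Category.assoc]
    rw [h0, comp_zero]
  | succ n ih =>
    intro L _ hL
    obtain ⟨m, K, hK, i, p, w, hS⟩ := exists_cover L
    obtain ⟨δ, hT⟩ := H.tri i p w hS
    have hK' : Subsingleton (Abelian.Ext K N (n + 1)) := by
      refine subsingleton_of_forall_eq 0 fun x => ?_
      obtain ⟨y, hy⟩ := Abelian.Ext.contravariant_sequence_exact₁ hS N x
        (by lia : 1 + (n + 1) = (n + 1) + 1) (Subsingleton.elim _ _)
      rw [← hy, Abelian.Ext.eq_zero_of_projective y, Abelian.Ext.comp_zero]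
    intro φ
    exact tri_d3 hT (ih K hK hK') (by push_cast; lia) φ
      (H.van_to_free N hN m _ (by push_cast; lia) _)

end DualHyp

end AbstractDual

section Dag

open Limits Pretriangulated Opposite DerivedCategory

universe w

variable {R : Type} [CommRing R]

/-- The functor `Hom(-, D)`. -/
noncomputable def dgF (D : CochainComplex (ModuleCat.{0} R) ℤ) :
    (ModuleCat.{0} R)ᵒᵖ ⥤ CochainComplex (ModuleCat.{0} R) ℤ where
  obj L := (((linearCoyoneda R (ModuleCat.{0} R)).obj L).mapHomologicalComplex
    (ComplexShape.up ℤ)).obj D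
  map f := (NatTrans.mapHomologicalComplex ((linearCoyoneda R (ModuleCat.{0} R)).map f)
    (ComplexShape.up ℤ)).app D
  map_id L := by
    rw [CategoryTheory.Functor.map_id, NatTrans.mapHomologicalComplex_id]; rfl
  map_comp f g := by
    rw [Functor.map_comp, NatTrans.mapHomologicalComplex_comp]; rfl

variable (D : CochainComplex (ModuleCat.{0} R) ℤ)

lemma dgF_map_f_apply {L L' : ModuleCat.{0} R} (f : L ⟶ L') (j : ℤ) (φ : L' ⟶ D.X j) :
    (((dgF D).map f.op).f j).hom φ = f ≫ φ := rfl

lemma dgF_d_apply (L : ModuleCat.{0} R) (i j : ℤ) (φ : L ⟶ D.X i) :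
    (((dgF D).obj (op L)).d i j).hom φ = φ ≫ D.d i j := rfl

instance : (dgF D).Additive where
  map_add {X Y f g} := by
    refine HomologicalComplex.hom_ext _ _ fun j => ?_
    apply ModuleCat.hom_ext
    refine LinearMap.ext fun φ => ?_
    exact Preadditive.add_comp _ _ _ f.unop g.unop φ

lemma dgF_smul {L L' : ModuleCat.{0} R} (f : L ⟶ L') (r : R) :
    (dgF D).map (r • f).op = r • (dgF D).map f.op := by
  refine HomologicalComplex.hom_ext _ _ fun j => ?_
  apply ModuleCat.hom_ext
  refine LinearMap.ext fun φ => ?_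
  exact Linear.smul_comp _ _ _ r f φ

lemma dgF_shortExact (hD : ∀ j, Injective (D.X j)) {A B C : ModuleCat.{0} R} (i : A ⟶ B)
    (p : B ⟶ C) (w : i ≫ p = 0) (hS : (ShortComplex.mk i p w).ShortExact) :
    (ShortComplex.mk ((dgF D).map p.op) ((dgF D).map i.op)
      (by rw [← Functor.map_comp, ← op_comp, w, op_zero, Functor.map_zero])).ShortExact := by
  apply HomologicalComplex.shortExact_of_degreewise_shortExact
  intro j
  have := hS.epi_g
  have := hS.mono_f
  have hepi : Epi p := hS.epi_g
  have hmono : Mono i := hS.mono_f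
  refine { exact := ?_, mono_f := ?_, epi_g := ?_ }
  · rw [ShortComplex.moduleCat_exact_iff]
    intro φ hφ
    exact ⟨hS.exact.desc φ hφ, hS.exact.g_desc φ hφ⟩
  · refine (ModuleCat.mono_iff_injective _).2 ?_
    intro φ ψ h
    exact (cancel_epi p).1 h
  · refine (ModuleCat.epi_iff_surjective _).2 ?_
    intro φ
    have := hD j
    exact ⟨Injective.factorThru φ i, Injective.comp_factorThru φ i⟩

/-- `Hom(R, D) ≅ D`. -/
noncomputable def dgFOne : (dgF D).obj (op (A1 R)) ≅ D :=
  HomologicalComplex.Hom.isoOfComponents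
    (fun j => LinearEquiv.toModuleIso
      (show (A1 R ⟶ D.X j) ≃ₗ[R] D.X j from
        { toFun := fun φ => φ.hom (1 : R)
          map_add' := fun _ _ => rfl
          map_smul' := fun _ _ => rfl
          invFun := fun x => elt x
          left_inv := fun φ => by
            apply ModuleCat.hom_ext
            apply LinearMap.ext_ring
            simp [elt]
          right_inv := fun x => by simp [elt] }))
    (fun i j _ => by
      apply ModuleCat.hom_ext
      refine LinearMap.ext fun φ => ?_
      rfl)

lemma dgF_map_elt (r : A1 R ⟶ A1 R) :
    r = (r.hom (1 : R)) • 𝟙 (A1 R) := by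
  apply ModuleCat.hom_ext
  apply LinearMap.ext_ring
  simp

variable [HasDerivedCategory.{w} (ModuleCat.{0} R)]

/-- `RHom(-, D)`. -/
noncomputable def DF : (ModuleCat.{0} R)ᵒᵖ ⥤ DerivedCategory (ModuleCat.{0} R) :=
  dgF D ⋙ Q

instance : (DF D).Additive := by unfold DF; infer_instance

lemma DF_isTri (hD : ∀ j, Injective (D.X j)) : IsTri (DF D) := by
  intro A B C i p w hS
  exact ⟨_, triangleOfSES_distinguished (dgF_shortExact D hD i p w hS)⟩

lemma DF_smul {L L' : ModuleCat.{0} R} (f : L ⟶ L') (r : R) :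
    (DF D).map (r • f).op = r • (DF D).map f.op := by
  exact (congrArg Q.map (dgF_smul D f r)).trans (Functor.map_smul Q r _)

/-- `RHom(R, D) ≅ D`. -/
noncomputable def DFOne : (DF D).obj (op (A1 R)) ≅ Q.obj D := Q.mapIso (dgFOne D)

end Dag
section Dualizing

open Limits Pretriangulated Opposite DerivedCategory

universe w

variable {R : Type} [CommRing R] [HasDerivedCategory.{w} (ModuleCat.{0} R)]

lemma DF_surj (D : CochainComplex (ModuleCat.{0} R) ℤ)
    (h : ∀ ψ : Q.obj D ⟶ Q.obj D, ∃ a : R, ψ = a • 𝟙 _)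
    (φ : (DF D).obj (op (A1 R)) ⟶ (DF D).obj (op (A1 R))) :
    ∃ r : A1 R ⟶ A1 R, φ = (DF D).map r.op := by
  obtain ⟨a, ha⟩ := h ((DFOne D).inv ≫ φ ≫ (DFOne D).hom)
  refine ⟨a • 𝟙 _, ?_⟩
  rw [DF_smul, op_id, CategoryTheory.Functor.map_id, ← cancel_epi (DFOne D).inv,
    ← cancel_mono (DFOne D).hom, Category.assoc, ha]
  simp

lemma DF_inj (D : CochainComplex (ModuleCat.{0} R) ℤ)
    (h : ∀ a : R, a • 𝟙 (Q.obj D) = 0 → a = 0)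
    (r : A1 R ⟶ A1 R) (hr : (DF D).map r.op = 0) : r = 0 := by
  rw [dgF_map_elt r] at hr ⊢
  rw [DF_smul, op_id, CategoryTheory.Functor.map_id] at hr
  rw [h (r.hom (1 : R)) ?_, zero_smul]
  rw [← cancel_epi (DFOne D).hom, ← cancel_mono (DFOne D).inv]
  simpa using hr

lemma Q_hom_eq_zero_of_quotient {K L : CochainComplex (ModuleCat.{0} R) ℤ} (f : K ⟶ L)
    (h : (HomotopyCategory.quotient _ _).map f = 0) : Q.map f = 0 := by
  rw [← cancel_epi ((quotientCompQhIso _).hom.app K), ← quotientCompQhIso_hom_naturality, h]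
  simp

lemma isKInjective_of_bounded (D : CochainComplex (ModuleCat.{0} R) ℤ)
    (hD : ∀ j, Injective (D.X j)) (n : ℤ) (h : ∀ i, i < n → IsZero (D.X i)) :
    D.IsKInjective := by
  have : D.IsStrictlyGE n := by
    rw [CochainComplex.isStrictlyGE_iff]
    exact h
  exact CochainComplex.isKInjective_of_injective D n

lemma hv_Q_of_degrees (K L : CochainComplex (ModuleCat.{0} R) ℤ) [L.IsKInjective] (i : ℤ)
    (h : ∀ j, IsZero (K.X j) ∨ IsZero (L.X (j + i))) : HV (Q.obj K) (Q.obj L) i := by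
  intro f
  let e := (Q.commShiftIso i).app L
  obtain ⟨g, hg⟩ := exists_Q_map_of_isKInjective (K := K) (L := L⟦i⟧) (f ≫ e.inv)
  have hg0 : g = 0 := by
    refine HomologicalComplex.hom_ext _ _ (fun j => ?_)
    rcases h j with h | h
    · exact h.eq_of_src _ _
    · exact IsZero.eq_of_tgt (by exact h) _ _
  rw [← cancel_mono e.inv, zero_comp]
  exact hg.symm.trans (by rw [hg0, Functor.map_zero])

lemma hv_self_of_dualizing (D : CochainComplex (ModuleCat.{0} R) ℤ) [D.IsKInjective] (i : ℤ)
    (h : Subsingleton ((HomotopyCategory.quotient (ModuleCat.{0} R) (ComplexShape.up ℤ)).obj D ⟶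
      (((HomotopyCategory.quotient (ModuleCat.{0} R) (ComplexShape.up ℤ)).obj D)⟦i⟧))) :
    HV (Q.obj D) (Q.obj D) i := by
  intro f
  let e := (Q.commShiftIso i).app D
  obtain ⟨g, hg⟩ := exists_Q_map_of_isKInjective (K := D) (L := D⟦i⟧) (f ≫ e.inv)
  have hg0 : (HomotopyCategory.quotient (ModuleCat.{0} R) (ComplexShape.up ℤ)).map g = 0 := by
    rw [← cancel_mono (((HomotopyCategory.quotient (ModuleCat.{0} R)
      (ComplexShape.up ℤ)).commShiftIso i).hom.app D)]
    exact h.elim _ _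
  rw [← cancel_mono e.inv, zero_comp]
  exact hg.symm.trans (by rw [Q_hom_eq_zero_of_quotient _ hg0])

lemma dualHyp_of_dualizing [IsNoetherianRing R] (D : CochainComplex (ModuleCat.{0} R) ℤ)
    (hD : IsDualizingComplex R D) : DualHyp (DF D) (fun N => Module.Finite R N) := by
  obtain ⟨h1, ⟨n, h2⟩, h3, h4, h5⟩ := hD
  have hK : D.IsKInjective := isKInjective_of_bounded D h1 (-n) (fun i hi => h2 i (by
    rw [le_abs]; right; lia))
  have h11 : ∀ i : ℤ, i ≠ 0 → HV ((DF D).obj (op (A1 R))) ((DF D).obj (op (A1 R))) i :=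
    fun i hi => HV.of_iso (DFOne D).symm (DFOne D).symm (hv_self_of_dualizing D i (h4 i hi))
  refine ⟨fun N h => h, ?_, ?_, DF_surj D ?_, DF_inj D ?_, DF_isTri D h1⟩
  · intro N hN m K i p w hS
    have := hS.mono_f
    exact Module.Finite.of_injective i.hom ((ModuleCat.mono_iff_injective i).1 hS.mono_f)
  · have key : ∀ (t : ℕ) (i : ℤ), 1 ≤ i → 2 * n ≤ i + t → ∀ N : ModuleCat.{0} R,
        Module.Finite R N → HV ((DF D).obj (op N)) ((DF D).obj (op (A1 R))) i := by
      intro t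
      induction t with
      | zero =>
        intro i _ hi N _
        refine HV.of_iso (Iso.refl _) (DFOne D).symm (hv_Q_of_degrees ((dgF D).obj (op N)) D i ?_)
        intro j
        by_cases hj : (n : ℤ) ≤ |j|
        · left
          refine (ModuleCat.isZero_iff_subsingleton).2 ⟨fun a b => ?_⟩
          exact (h2 j hj).eq_of_tgt _ _
        · right
          refine h2 _ ?_
          rw [le_abs]; left
          rw [not_le, abs_lt] at hj
          push_cast at hi
          lia
      | succ t ih =>
        intro i hi1 hi N _
        by_cases hi2 : 2 * (n : ℤ) ≤ i + t
        · exact ih i hi1 hi2 N inferInstance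
        obtain ⟨m, K, _, a, p, w, hS⟩ := exists_cover N
        obtain ⟨δ, hT⟩ := DF_isTri D h1 a p w hS
        intro φ
        obtain ⟨ψ, rfl⟩ := tri_c1 hT (ih (i + 1) (by lia) (by push_cast at hi; lia) K inferInstance) φ
        rw [hv_free_left (h11 i (by lia)) m ψ, comp_zero]
    intro N hN i hi
    exact key (2 * n) i hi (by push_cast; lia) N hN
  · intro ψ
    obtain ⟨f, rfl⟩ := exists_Q_map_of_isKInjective ψ
    obtain ⟨a, ha⟩ := h5.2 ((HomotopyCategory.quotient _ _).map f)
    refine ⟨a, ?_⟩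
    rw [← CategoryTheory.Functor.map_id, ← Functor.map_smul,
      ← cancel_epi ((quotientCompQhIso _).hom.app D), ← quotientCompQhIso_hom_naturality, ← ha,
      quotientCompQhIso_hom_naturality]
  · intro a ha
    apply h5.1
    dsimp only
    rw [zero_smul, Functor.map_zero]
    apply (CochainComplex.IsKInjective.Qh_map_bijective
      ((HomotopyCategory.quotient _ _).obj D) D).injective
    rw [← CategoryTheory.Functor.map_id, ← Functor.map_smul] at ha
    rw [← cancel_mono ((quotientCompQhIso _).hom.app D), quotientCompQhIso_hom_naturality, ha]
    simp

end Dualizing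
section DualFinite

open Limits Pretriangulated Opposite DerivedCategory

universe w

variable {R : Type} [CommRing R]

lemma dgF_isZero_X (D : CochainComplex (ModuleCat.{0} R) ℤ) (j : ℤ) (h : IsZero (D.X j))
    (N : ModuleCat.{0} R) : IsZero (((dgF D).obj (op N)).X j) := by
  refine (ModuleCat.isZero_iff_subsingleton).2 ⟨fun a b => ?_⟩
  exact h.eq_of_tgt _ _

variable [HasDerivedCategory.{w} (ModuleCat.{0} R)]

lemma DF_isGE (D : CochainComplex (ModuleCat.{0} R) ℤ) (n : ℤ) (h : ∀ i, i < n → IsZero (D.X i))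
    (N : ModuleCat.{0} R) : ((DF D).obj (op N)).IsGE n := by
  have : CochainComplex.IsStrictlyGE ((dgF D).obj (op N)) n := by
    rw [CochainComplex.isStrictlyGE_iff]
    exact fun i hi => dgF_isZero_X D i (h i hi) N
  exact (isGE_Q_obj_iff _ n).2 inferInstance

lemma DF_isLE (D : CochainComplex (ModuleCat.{0} R) ℤ) (n : ℤ) (h : ∀ i, n < i → IsZero (D.X i))
    (N : ModuleCat.{0} R) : ((DF D).obj (op N)).IsLE n := by
  have : CochainComplex.IsStrictlyLE ((dgF D).obj (op N)) n := by
    rw [CochainComplex.isStrictlyLE_iff]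
    exact fun i hi => dgF_isZero_X D i (h i hi) N
  exact (isLE_Q_obj_iff _ n).2 inferInstance

lemma finite_of_decomp {X Y : ModuleCat.{0} R} (m : ℕ) (f : Fin m → (X ⟶ Y)) (g : Fin m → (Y ⟶ X))
    (h : ∑ j, g j ≫ f j = 𝟙 Y) (hX : Module.Finite R X) : Module.Finite R Y := by
  refine Module.Finite.of_surjective (∑ j, (f j).hom ∘ₗ LinearMap.proj (R := R)
    (φ := fun _ : Fin m => X) j) fun y => ⟨fun j => (g j).hom y, ?_⟩
  have h1 := congrArg (fun k => k.hom y) h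
  simp only [ModuleCat.hom_sum, LinearMap.sum_apply, ModuleCat.hom_comp, ModuleCat.hom_id,
    LinearMap.comp_apply, LinearMap.id_apply] at h1
  simpa using h1

lemma DF_finite_free (D : CochainComplex (ModuleCat.{0} R) ℤ) (i : ℤ)
    (h : Module.Finite R (D.homology i)) (m : ℕ) :
    Module.Finite R ((homologyFunctor (ModuleCat.{0} R) i).obj ((DF D).obj (op (Fr R m)))) := by
  have h1 : Module.Finite R ((homologyFunctor (ModuleCat.{0} R) i).obj ((DF D).obj (op (A1 R)))) :=
    finite_of_iso ((homologyFunctor (ModuleCat.{0} R) i).mapIso (DFOne D) ≪≫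
      (homologyFunctorFactors _ i).app D).symm h
  refine finite_of_decomp m (fun j => (homologyFunctor (ModuleCat.{0} R) i).map
    ((DF D).map (prF m j).op)) (fun j => (homologyFunctor (ModuleCat.{0} R) i).map
    ((DF D).map (inF m j).op)) ?_ h1
  rw [← CategoryTheory.Functor.map_id, ← F_decomp, Functor.map_sum]
  simp

lemma DF_finite [IsNoetherianRing R] (D : CochainComplex (ModuleCat.{0} R) ℤ)
    (hD : ∀ j, Injective (D.X j)) (n : ℤ) (h : ∀ i, i < n → IsZero (D.X i))
    (hfin : ∀ i, Module.Finite R (D.homology i)) (i : ℤ) (N : ModuleCat.{0} R)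
    (hN : Module.Finite R N) :
    Module.Finite R ((homologyFunctor (ModuleCat.{0} R) i).obj ((DF D).obj (op N))) := by
  have key : ∀ (t : ℕ) (i : ℤ), i < n + t → ∀ (N : ModuleCat.{0} R) (_ : Module.Finite R N),
      Module.Finite R ((homologyFunctor (ModuleCat.{0} R) i).obj ((DF D).obj (op N))) := by
    intro t
    induction t with
    | zero =>
      intro i hi N _
      have := DF_isGE D n h N
      exact finite_of_isZero _ ((isGE_iff _ n).1 this i (by simpa using hi))
    | succ t ih =>
      intro i hi N _
      obtain ⟨m, K, _, a, p, w, hS⟩ := exists_cover N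
      obtain ⟨δ, hT⟩ := DF_isTri D hD a p w hS
      refine finite_of_shortComplex_exact (HomologySequence.exact₁ _ hT (i - 1) i (by lia)) ?_ ?_
      · exact ih (i - 1) (by push_cast at hi; lia) K inferInstance
      · exact DF_finite_free D i (hfin i) m
  exact key (i - n + 1).toNat i (by lia) N hN

end DualFinite
section CharDual

open TensorProduct

variable {R : Type} [CommRing R]

/-- Swapping the arguments of a map into a character module. -/
noncomputable def flipChar {A B : Type} [AddCommGroup A] [AddCommGroup B] [Module R A] [Module R B]
    (c : A →ₗ[R] CharacterModule B) : B →ₗ[R] CharacterModule A :=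
  CharacterModule.curry (CharacterModule.dual (TensorProduct.comm R B A).toLinearMap
    (CharacterModule.uncurry c))

lemma flipChar_apply {A B : Type} [AddCommGroup A] [AddCommGroup B] [Module R A] [Module R B]
    (c : A →ₗ[R] CharacterModule B) (a : A) (b : B) : flipChar c b a = c a b := rfl

lemma exists_factor {X Y E : Type} [AddCommGroup X] [AddCommGroup Y] [AddCommGroup E] [Module R X]
    [Module R Y] [Module R E] [Module.Injective R E] (s : X →ₗ[R] Y) (b : X →ₗ[R] E)
    (h : ∀ x, s x = 0 → b x = 0) : ∃ g : Y →ₗ[R] E, ∀ x, g (s x) = b x := by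
  obtain ⟨g, hg⟩ := Module.Injective.out ((LinearMap.ker s).liftQ s le_rfl)
    (by rw [← LinearMap.ker_eq_bot]; exact Submodule.ker_liftQ_eq_bot _ _ _ le_rfl)
    ((LinearMap.ker s).liftQ b h)
  exact ⟨g, fun x => hg (Submodule.Quotient.mk x)⟩

lemma eval_injective [IsNoetherianRing R] {K N E : Type} [AddCommGroup K] [AddCommGroup N]
    [AddCommGroup E] [Module R K] [Module R N] [Module R E] [Module.Finite R K]
    [Module.Injective R E] (x : K ⊗[R] (N →ₗ[R] E))
    (hx : ∀ h : K →ₗ[R] N, TensorProduct.lift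
      ((LinearMap.id : (N →ₗ[R] E) →ₗ[R] (N →ₗ[R] E)).flip ∘ₗ h) x = 0) : x = 0 := by
  classical
  obtain ⟨r, q, hq⟩ := Module.Finite.exists_fin' R K
  have hfk : Module.Finite R (LinearMap.ker q) := inferInstance
  obtain ⟨s, a, ha⟩ := Module.Finite.exists_fin' R (LinearMap.ker q)
  -- write `x` as a sum
  obtain ⟨b, rfl⟩ : ∃ b : Fin r → (N →ₗ[R] E), x = ∑ j, q (Pi.single j 1) ⊗ₜ b j := by
    clear hx
    induction x using TensorProduct.induction_on with
    | zero => exact ⟨0, by simp⟩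
    | tmul k g =>
      obtain ⟨v, rfl⟩ := hq k
      refine ⟨fun j => v j • g, ?_⟩
      conv_lhs => rw [pi_eq_sum_univ' v]
      rw [map_sum, TensorProduct.sum_tmul]
      refine Finset.sum_congr rfl fun j _ => ?_
      rw [map_smul, TensorProduct.smul_tmul]
    | add x y hx' hy' =>
      obtain ⟨b₁, rfl⟩ := hx'
      obtain ⟨b₂, rfl⟩ := hy'
      exact ⟨b₁ + b₂, by simp [TensorProduct.tmul_add, Finset.sum_add_distrib]⟩
  have hb : ∀ h : K →ₗ[R] N, ∑ j, b j (h (q (Pi.single j 1))) = 0 := by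
    intro h
    simpa using hx h
  let A : Fin s → Fin r → R := fun k => (a (Pi.single k 1)).1
  let σ : (Fin r → N) →ₗ[R] (Fin s → N) :=
    LinearMap.pi fun k => ∑ j, A k j • LinearMap.proj j
  let β : (Fin r → N) →ₗ[R] E := ∑ j, b j ∘ₗ LinearMap.proj j
  obtain ⟨γ, hγ⟩ := exists_factor σ β (by
    intro v hv
    have hv' : ∀ k, ∑ j, A k j • v j = 0 := fun k => by simpa [σ] using congrFun hv k
    let t : (Fin r → R) →ₗ[R] N := Fintype.linearCombination R v
    have ht : (t ∘ₗ (LinearMap.ker q).subtype) ∘ₗ a = 0 := by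
      refine LinearMap.pi_ext' fun k => LinearMap.ext_ring ?_
      simpa [t, Fintype.linearCombination_apply] using hv' k
    have ht' : LinearMap.ker q ≤ LinearMap.ker t := by
      intro y hy
      obtain ⟨z, hz⟩ := ha ⟨y, hy⟩
      have := LinearMap.congr_fun ht z
      simp only [LinearMap.comp_apply, hz] at this
      exact this
    let h : K →ₗ[R] N := (LinearMap.ker q).liftQ t ht' ∘ₗ
      (LinearMap.quotKerEquivOfSurjective q hq).symm.toLinearMap
    have hh : ∀ w, h (q w) = t w := by
      intro w
      have : (LinearMap.quotKerEquivOfSurjective q hq).symm (q w) = Submodule.Quotient.mk w := by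
        rw [LinearEquiv.symm_apply_eq]; rfl
      change (LinearMap.ker q).liftQ t ht' ((LinearMap.quotKerEquivOfSurjective q hq).symm (q w)) = _
      rw [this]; rfl
    have := hb h
    simpa [hh, t, β] using this)
  have hbγ : ∀ j, b j = ∑ k, A k j • (γ ∘ₗ LinearMap.single R (fun _ => N) k) := by
    intro j
    ext n
    have h1 := hγ (Pi.single j n)
    have h2 : β (Pi.single j n) = b j n := by
      simp only [β, LinearMap.sum_apply, LinearMap.comp_apply, LinearMap.proj_apply]
      rw [Finset.sum_eq_single j (fun i _ hi => by rw [Pi.single_eq_of_ne hi, map_zero]) (by simp),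
        Pi.single_eq_same]
    have h3 : σ (Pi.single j n) = ∑ k, A k j • Pi.single k n := by
      ext k
      simp only [σ, LinearMap.pi_apply, LinearMap.sum_apply, LinearMap.smul_apply,
        LinearMap.proj_apply, Finset.sum_apply, Pi.smul_apply]
      rw [Finset.sum_eq_single j (fun i _ hi => by rw [Pi.single_eq_of_ne hi, smul_zero]) (by simp),
        Finset.sum_eq_single k (fun i _ hi => by rw [Pi.single_eq_of_ne hi.symm, smul_zero])
        (by simp), Pi.single_eq_same, Pi.single_eq_same]
    rw [← h2, ← h1, h3]
    simp
  calc ∑ j, q (Pi.single j 1) ⊗ₜ[R] b j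
      = ∑ j, ∑ k, (A k j • q (Pi.single j 1)) ⊗ₜ[R] (γ ∘ₗ LinearMap.single R (fun _ => N) k) := by
        refine Finset.sum_congr rfl fun j _ => ?_
        rw [hbγ j, TensorProduct.tmul_sum]
        refine Finset.sum_congr rfl fun k _ => ?_
        rw [TensorProduct.smul_tmul]
    _ = ∑ k, (q (A k)) ⊗ₜ[R] (γ ∘ₗ LinearMap.single R (fun _ => N) k) := by
        rw [Finset.sum_comm]
        refine Finset.sum_congr rfl fun k _ => ?_
        rw [← TensorProduct.sum_tmul]
        congr 1
        conv_rhs => rw [pi_eq_sum_univ' (A k)]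
        simp
    _ = 0 := by
        refine Finset.sum_eq_zero fun k _ => ?_
        rw [show q (A k) = 0 from (a (Pi.single k 1)).2, TensorProduct.zero_tmul]

lemma rTensor_inj_of_ext [IsNoetherianRing R] {K F N E : Type} [AddCommGroup K] [AddCommGroup F]
    [AddCommGroup N]
    [AddCommGroup E] [Module R K] [Module R F] [Module R N] [Module R E] [Module.Finite R K]
    [Module.Injective R E] (f : K →ₗ[R] F)
    (hf : ∀ h : K →ₗ[R] N, ∃ h' : F →ₗ[R] N, h' ∘ₗ f = h) :
    Function.Injective (f.rTensor (N →ₗ[R] E)) := by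
  rw [injective_iff_map_eq_zero]
  intro x hx
  refine eval_injective x fun h => ?_
  obtain ⟨h', rfl⟩ := hf h
  have : TensorProduct.lift
      ((LinearMap.id : (N →ₗ[R] E) →ₗ[R] (N →ₗ[R] E)).flip ∘ₗ (h' ∘ₗ f)) =
      TensorProduct.lift
      ((LinearMap.id : (N →ₗ[R] E) →ₗ[R] (N →ₗ[R] E)).flip ∘ₗ h') ∘ₗ f.rTensor (N →ₗ[R] E) := by
    ext; rfl
  rw [this, LinearMap.comp_apply, hx, map_zero]

lemma char_lift [IsNoetherianRing R] {K F N E : Type} [AddCommGroup K] [AddCommGroup F]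
    [AddCommGroup N]
    [AddCommGroup E] [Module R K] [Module R F] [Module R N] [Module R E] [Module.Finite R K]
    [Module.Injective R E] (f : K →ₗ[R] F)
    (hf : ∀ h : K →ₗ[R] N, ∃ h' : F →ₗ[R] N, h' ∘ₗ f = h)
    (φ : (N →ₗ[R] E) →ₗ[R] CharacterModule K) :
    ∃ ψ : (N →ₗ[R] E) →ₗ[R] CharacterModule F, CharacterModule.dual f ∘ₗ ψ = φ := by
  obtain ⟨ψ, hψ⟩ := rTensor_injective_iff_lcomp_surjective.1 (rTensor_inj_of_ext (E := E) f hf)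
    (flipChar φ)
  refine ⟨flipChar ψ, ?_⟩
  refine LinearMap.ext fun b => DFunLike.ext _ _ fun k => ?_
  exact congrArg (fun g => g k b) hψ

end CharDual
section CharExt

open TensorProduct Limits

variable {R : Type} [CommRing R]

lemma tensor_exact_of_char {M P0 P1 P2 : Type} [AddCommGroup M] [AddCommGroup P0] [AddCommGroup P1]
    [AddCommGroup P2] [Module R M] [Module R P0] [Module R P1] [Module R P2]
    (d' : P2 →ₗ[R] P1) (d : P1 →ₗ[R] P0)
    (h : ∀ f : P1 →ₗ[R] CharacterModule M, f ∘ₗ d' = 0 →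
      ∃ g : P0 →ₗ[R] CharacterModule M, g ∘ₗ d = f)
    (x : M ⊗[R] P1) (hx : d.lTensor M x = 0) : ∃ y, d'.lTensor M y = x := by
  by_contra hcon
  have hne : (Submodule.Quotient.mk x : (M ⊗[R] P1) ⧸ LinearMap.range (d'.lTensor M)) ≠ 0 := by
    rw [Ne, Submodule.Quotient.mk_eq_zero]
    exact hcon
  obtain ⟨c, hc⟩ := CharacterModule.exists_character_apply_ne_zero_of_ne_zero hne
  let c₁ : CharacterModule (M ⊗[R] P1) :=
    CharacterModule.dual (LinearMap.range (d'.lTensor M)).mkQ c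
  obtain ⟨g, hg⟩ := h (flipChar (CharacterModule.curry c₁)) (by
    refine LinearMap.ext fun p => DFunLike.ext _ _ fun m => ?_
    change c (Submodule.Quotient.mk (m ⊗ₜ d' p)) = 0
    have h0 : (Submodule.Quotient.mk (m ⊗ₜ[R] d' p) :
        (M ⊗[R] P1) ⧸ LinearMap.range (d'.lTensor M)) = 0 :=
      (Submodule.Quotient.mk_eq_zero _).2 (LinearMap.mem_range.2 ⟨m ⊗ₜ[R] p, rfl⟩)
    rw [h0]
    exact c.map_zero)
  have hc₁ : CharacterModule.dual (d.lTensor M) (CharacterModule.uncurry (flipChar g)) = c₁ := by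
    have h2 : CharacterModule.curry (CharacterModule.dual (d.lTensor M)
        (CharacterModule.uncurry (flipChar g))) = CharacterModule.curry c₁ := by
      refine LinearMap.ext fun m => DFunLike.ext _ _ fun p => ?_
      exact congrArg (fun f => f p m) hg
    exact CharacterModule.homEquiv.symm.injective h2
  apply hc
  change c₁ x = 0
  rw [← hc₁]
  change CharacterModule.uncurry (flipChar g) (d.lTensor M x) = 0
  rw [hx]
  exact AddMonoidHom.map_zero _

/-- The character module, bundled. -/
noncomputable abbrev chM (M : ModuleCat.{0} R) : ModuleCat.{0} R :=
  ModuleCat.of R (CharacterModule M)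

lemma torM_subsingleton_of_ext (M Z : ModuleCat.{0} R) (n : ℕ)
    (h : Subsingleton (Abelian.Ext Z (chM M) (n + 1))) : Subsingleton (TorM R (n + 1) M Z) := by
  let P := projectiveResolution Z
  rw [← extM_subsingleton_iff, extM_succ_subsingleton_iff P] at h
  rw [← ModuleCat.isZero_iff_subsingleton]
  unfold TorM
  refine IsZero.of_iso ?_ (P.isoLeftDerivedObj ((MonoidalCategory.tensoringLeft _).obj M) (n + 1))
  change IsZero (HomologicalComplex.homology _ (n + 1))
  rw [← HomologicalComplex.exactAt_iff_isZero_homology,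
    HomologicalComplex.exactAt_iff' _ (n + 2) (n + 1) n (by simp) (by simp),
    ShortComplex.moduleCat_exact_iff]
  intro x hx
  refine tensor_exact_of_char (M := M) (P.complex.d (n + 2) (n + 1)).hom
    (P.complex.d (n + 1) n).hom ?_ x hx
  intro f hf
  obtain ⟨g, hg⟩ := h (ModuleCat.ofHom f) (ModuleCat.hom_ext hf)
  exact ⟨g.hom, congrArg ModuleCat.Hom.hom hg⟩

lemma ext_char_of_ext [IsNoetherianRing R] (N E : ModuleCat.{0} R) [Injective E] (n : ℕ) :
    ∀ (M : ModuleCat.{0} R) (_ : Module.Finite R M) (_ : Subsingleton (Abelian.Ext M N (n + 1))),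
    Subsingleton (Abelian.Ext (ModuleCat.of R (N →ₗ[R] E)) (chM M) (n + 1)) := by
  have hE : Module.Injective R E := by
    rw [Module.injective_iff_injective_object]
    exact inferInstanceAs (Injective E)
  have hses : ∀ (M : ModuleCat.{0} R) (_ : Module.Finite R M), ∃ (m : ℕ) (K : ModuleCat.{0} R)
      (_ : Module.Finite R K) (i : K ⟶ Fr R m) (p : Fr R m ⟶ M) (w : i ≫ p = 0)
      (_ : (ShortComplex.mk i p w).ShortExact)
      (w' : ModuleCat.ofHom (CharacterModule.dual p.hom) ≫
        ModuleCat.ofHom (CharacterModule.dual i.hom) = 0),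
      (ShortComplex.mk (ModuleCat.ofHom (CharacterModule.dual p.hom))
        (ModuleCat.ofHom (CharacterModule.dual i.hom)) w').ShortExact := by
    intro M _
    obtain ⟨m, K, hK, i, p, w, hS⟩ := exists_cover M
    have hw : p.hom ∘ₗ i.hom = 0 := by
      rw [← ModuleCat.hom_comp, w]; rfl
    have hi : Function.Injective i.hom := (ModuleCat.mono_iff_injective i).1 hS.mono_f
    have hp : Function.Surjective p.hom := (ModuleCat.epi_iff_surjective p).1 hS.epi_g
    have hex := hS.exact
    rw [ShortComplex.moduleCat_exact_iff_range_eq_ker] at hex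
    refine ⟨m, K, hK, i, p, w, hS, ?_, ?_⟩
    · rw [← ModuleCat.ofHom_comp, ← CharacterModule.dual_comp, hw, CharacterModule.dual_zero]; rfl
    · refine { exact := ?_, mono_f := ?_, epi_g := ?_ }
      · rw [ShortComplex.moduleCat_exact_iff]
        intro (c : CharacterModule (Fr R m)) hc
        have hc' : ∀ k, c (i.hom k) = 0 := fun k =>
          congrArg (fun f : CharacterModule K => f k) hc
        have hker : ∀ y, p.hom y = 0 → c y = 0 := by
          intro y hy
          obtain ⟨k, rfl⟩ : y ∈ LinearMap.range i.hom := by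
            rw [show LinearMap.range i.hom = LinearMap.ker p.hom from hex]; exact hy
          exact hc' k
        choose s hs using hp
        refine ⟨(⟨⟨fun z => c (s z), ?_⟩, ?_⟩ : M →+ AddCircle (1 : ℚ)), ?_⟩
        · exact hker _ (hs 0)
        · intro x y
          have := hker (s (x + y) - (s x + s y)) (by rw [map_sub, map_add, hs, hs, hs, sub_self])
          have h2 : c (s (x + y)) - (c (s x) + c (s y)) = 0 := by
            rw [← this]
            exact ((AddMonoidHom.map_sub c _ _).trans 
              (congrArg (c (s (x + y)) - ·) (AddMonoidHom.map_add c (s x) (s y)))).symm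
          exact sub_eq_zero.1 h2
        · refine DFunLike.ext (F := CharacterModule (Fr R m)) _ _ fun y => ?_
          change c (s (p.hom y)) = c y
          have := hker (s (p.hom y) - y) (by rw [map_sub, hs, sub_self])
          exact sub_eq_zero.1 ((AddMonoidHom.map_sub c _ _).symm.trans this)
      · exact (ModuleCat.mono_iff_injective _).2 (CharacterModule.dual_injective_of_surjective _ hp)
      · exact (ModuleCat.epi_iff_surjective _).2 (CharacterModule.dual_surjective_of_injective _ hi)
  have hFinj : ∀ m : ℕ, Injective (chM (Fr R m)) := by
    intro m
    have : Module.Injective R (CharacterModule (Fr R m)) :=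
      Module.Flat.iff_characterModule_injective.1
        (inferInstanceAs (Module.Flat R (Fin m → R)))
    exact (Module.injective_iff_injective_object R _).1 this
  induction n with
  | zero =>
    intro M _ hM
    obtain ⟨m, K, hK, i, p, w, hS, w', hS'⟩ := hses M inferInstance
    have := hFinj m
    refine subsingleton_of_forall_eq 0 fun x => ?_
    obtain ⟨y, rfl⟩ := Abelian.Ext.covariant_sequence_exact₁ _ hS' x
      (Abelian.Ext.eq_zero_of_injective _) rfl
    obtain ⟨φ, rfl⟩ := (Abelian.Ext.mk₀_bijective _ _).2 y
    obtain ⟨ψ, hψ⟩ := char_lift (E := E) (N := N) i.hom (by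
      intro h
      obtain ⟨z, hz⟩ := Abelian.Ext.contravariant_sequence_exact₁ hS N
        (Abelian.Ext.mk₀ (ModuleCat.ofHom h)) (n₁ := 1) rfl (Subsingleton.elim _ _)
      obtain ⟨h', rfl⟩ := (Abelian.Ext.mk₀_bijective _ _).2 z
      rw [Abelian.Ext.mk₀_comp_mk₀] at hz
      exact ⟨h'.hom, congrArg ModuleCat.Hom.hom ((Abelian.Ext.mk₀_bijective _ _).1 hz)⟩) φ.hom
    have hφ : φ = ModuleCat.ofHom ψ ≫ ModuleCat.ofHom (CharacterModule.dual i.hom) :=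
      ModuleCat.hom_ext hψ.symm
    rw [hφ, ← Abelian.Ext.mk₀_comp_mk₀, Abelian.Ext.comp_assoc _ _ _ (zero_add 0) (zero_add 1) (by simp)]
    have := hS'.comp_extClass
    erw [this]
    rw [Abelian.Ext.comp_zero]
  | succ n ih =>
    intro M _ hM
    obtain ⟨m, K, hK, i, p, w, hS, w', hS'⟩ := hses M inferInstance
    have := hFinj m
    have h1 : Subsingleton (Abelian.Ext K N (n + 1)) := by
      refine subsingleton_of_forall_eq 0 fun x => ?_
      obtain ⟨y, rfl⟩ := Abelian.Ext.contravariant_sequence_exact₁ hS N x (n₁ := n + 1 + 1)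
        (by lia) (Subsingleton.elim _ _)
      have hy : y = 0 := Abelian.Ext.eq_zero_of_projective (P := Fr R m) y
      rw [hy, Abelian.Ext.comp_zero]
    have h2 := ih K hK h1
    refine subsingleton_of_forall_eq 0 fun x => ?_
    obtain ⟨y, rfl⟩ := Abelian.Ext.covariant_sequence_exact₁ _ hS' x
      (Abelian.Ext.eq_zero_of_injective _) rfl
    have hy : y = 0 := @Subsingleton.elim _ h2 _ _
    rw [hy, Abelian.Ext.zero_comp]

end CharExt
section MainB

open Limits Pretriangulated Opposite DerivedCategory

universe w

variable {R : Type} [CommRing R] [HasDerivedCategory.{w} (ModuleCat.{0} R)]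

lemma van_singleton_iff (X Y : ModuleCat.{0} R) :
    Van {sgl 0 Y} (sgl 0 X) ↔ ∃ c : ℕ, ∀ i : ℕ, c ≤ i → Subsingleton (Abelian.Ext X Y i) := by
  constructor
  · rintro ⟨c, hc⟩
    refine ⟨c.toNat, fun i hi => ?_⟩
    have h2 : Subsingleton (ShiftedHom (sgl 0 X) (sgl 0 Y) (i : ℤ)) :=
      ⟨fun f g => (hc i (by lia) _ rfl f).trans (hc i (by lia) _ rfl g).symm⟩
    exact (Abelian.Ext.homEquiv (X := X) (Y := Y) (n := i)).injective.subsingleton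
  · rintro ⟨c, hc⟩
    refine ⟨c, fun i hi Y' hY f => ?_⟩
    obtain rfl : Y' = sgl 0 Y := hY
    obtain ⟨k, rfl⟩ := Int.eq_ofNat_of_zero_le (show 0 ≤ i by lia)
    have h1 := hc k (by lia)
    have h2 : Subsingleton (sgl 0 X ⟶ (sgl 0 Y)⟦(k : ℤ)⟧) :=
      (Abelian.Ext.homEquiv (X := X) (Y := Y) (n := k)).symm.injective.subsingleton
    exact h2.elim _ _

lemma van_of_degreewise (S : Set (DerivedCategory (ModuleCat.{0} R))) (a : ℤ) (t : ℕ) :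
    ∀ (X : CochainComplex (ModuleCat.{0} R) ℤ)
      (_ : ∀ j, j < a ∨ a + t ≤ j → IsZero (X.X j)) (_ : ∀ j, Van S (sgl 0 (X.X j))),
      Van S (Q.obj X) := by
  induction t with
  | zero =>
    intro X h _
    have hX : IsZero X := by
      rw [IsZero.iff_id_eq_zero]
      refine HomologicalComplex.hom_ext _ _ fun j => ?_
      exact (h j (by simp; lia)).eq_of_src _ _
    have hQ : IsZero (Q.obj X) := Functor.map_isZero Q hX
    exact ⟨0, fun i _ Y _ f => hQ.eq_of_src _ _⟩
  | succ t ih =>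
    intro X h hv
    let b : ℤ := a + t
    let f : (HomologicalComplex.single (ModuleCat.{0} R) (ComplexShape.up ℤ) b).obj (X.X b) ⟶ X :=
      HomologicalComplex.mkHomFromSingle (𝟙 _) (fun k hk =>
        (h k (by right; simp at hk; push_cast; lia)).eq_of_tgt _ _)
    have hfb : IsIso (f.f b) := by
      dsimp [f]
      rw [HomologicalComplex.mkHomFromSingle_f]
      infer_instance
    have hmono : ∀ j, Mono (f.f j) := by
      intro j
      by_cases hj : j = b
      · subst hj; infer_instance
      · exact ⟨fun _ _ _ => (HomologicalComplex.isZero_single_obj_X _ _ _ _ hj).eq_of_tgt _ _⟩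
    have : Mono f := HomologicalComplex.mono_of_mono_f f hmono
    have hS : (ShortComplex.mk f (cokernel.π f) (cokernel.condition f)).ShortExact :=
      { exact := ShortComplex.exact_cokernel f }
    have hSj := fun j => hS.map_of_exact (HomologicalComplex.eval (ModuleCat.{0} R)
      (ComplexShape.up ℤ) j)
    have hiso : ∀ j, j ≠ b → IsIso ((cokernel.π f).f j) := by
      intro j hj
      have := (hSj j).isIso_g_iff.2 (HomologicalComplex.isZero_single_obj_X (ComplexShape.up ℤ) b (X.X b) j hj)
      exact this
    have hzero : IsZero ((cokernel f).X b) := by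
      have := (hSj b).isIso_f_iff.1 hfb
      exact this
    have hv1 : Van S (sgl b (X.X b)) := (van_sgl_iff b _).2 (hv b)
    have hv3 : Van S (Q.obj (cokernel f)) := by
      refine ih _ ?_ ?_
      · intro j hj
        by_cases hjb : j = b
        · subst hjb; exact hzero
        · have := hiso j hjb
          refine (h j ?_).of_iso (asIso ((cokernel.π f).f j)).symm
          push_cast
          lia
      · intro j
        by_cases hjb : j = b
        · subst hjb
          have hz : IsZero (sgl 0 ((cokernel f).X b)) := Functor.map_isZero _ hzero
          exact ⟨0, fun i _ Y _ f => hz.eq_of_src _ _⟩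
        · have := hiso j hjb
          exact (hv j).of_iso ((singleFunctor _ 0).mapIso (asIso ((cokernel.π f).f j)))
    exact Van.mid (triangleOfSES_distinguished hS) hv1 hv3

end MainB

lemma injDim_of_test (R : Type) [CommRing R] [IsNoetherianRing R] (hD : HasDualizingComplex R)
    (M : ModuleCat.{0} R) (hM : Module.Finite R M) (htest : IsTestModule R M)
    (N : ModuleCat.{0} R) (hN : Module.Finite R N)
    (hext : ExtEventuallyZero R M N) : ∃ c : ℕ, HasInjectiveDimensionLE N c := by
  let _ := HasDerivedCategory.standard (ModuleCat.{0} R)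
  obtain ⟨D, hD⟩ := hD
  have H := dualHyp_of_dualizing D hD
  obtain ⟨h1, ⟨n, h2⟩, h3, h4, h5⟩ := hD
  obtain ⟨n₀, hn₀⟩ := hext
  have hlow : ∀ i : ℤ, i < -n → Limits.IsZero (D.X i) := fun i hi => h2 i (by
    rw [le_abs]; right; lia)
  have hhigh : ∀ i : ℤ, n ≤ i → Limits.IsZero (D.X i) := fun i hi => h2 i (by
    rw [le_abs]; left; lia)
  have hvj : ∀ j, Van {sgl 0 (chM M)} (sgl 0 (((dgF D).obj (Opposite.op N)).X j)) := by
    intro j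
    have := h1 j
    let e : ModuleCat.of R (N →ₗ[R] D.X j) ≅ ((dgF D).obj (Opposite.op N)).X j :=
      LinearEquiv.toModuleIso (ModuleCat.homLinearEquiv (S := R) (M := N) (N := D.X j)).symm
    refine Van.of_iso ((DerivedCategory.singleFunctor _ 0).mapIso e) ?_
    rw [van_singleton_iff]
    refine ⟨n₀ + 1, fun i hi => ?_⟩
    obtain ⟨k, rfl⟩ : ∃ k, i = k + 1 := ⟨i - 1, by lia⟩
    exact ext_char_of_ext N (D.X j) k M hM ((extM_subsingleton_iff _ _ _).1 (hn₀ _ (by lia)))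
  have hvN : Van {sgl 0 (chM M)} ((DF D).obj (Opposite.op N)) :=
    van_of_degreewise _ (-n) (2 * n) _ (fun j hj => dgF_isZero_X D j (by
      rcases hj with hj | hj
      · exact hlow j hj
      · exact hhigh j (by push_cast at hj; lia)) N) hvj
  obtain ⟨Z, hZ, hSZ⟩ := devissage (-n) (2 * n) ((DF D).obj (Opposite.op N))
    (DF_isGE D _ hlow N) (DF_isLE D _ (fun i hi => hhigh i (by push_cast at hi; lia)) N)
    (fun i => DF_finite D h1 _ hlow h3 i N hN)
  have hvZ := (hSZ {sgl 0 (chM M)} (by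
    intro P _
    rw [van_singleton_iff]
    refine ⟨1, fun i hi => ?_⟩
    obtain ⟨k, rfl⟩ : ∃ k, i = k + 1 := ⟨i - 1, by lia⟩
    exact subsingleton_of_forall_eq 0 fun x => Abelian.Ext.eq_zero_of_projective x)).1 hvN
  rw [van_singleton_iff] at hvZ
  obtain ⟨c, hc⟩ := hvZ
  obtain ⟨d, hd⟩ := hasProjectiveDimensionLE_of_finProjDim Z (htest Z hZ ⟨c + 1, fun i hi => by
    obtain ⟨k, rfl⟩ : ∃ k, i = k + 1 := ⟨i - 1, by lia⟩
    exact torM_subsingleton_of_ext M Z k (hc _ (by lia))⟩)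
  let S : Set (DerivedCategory (ModuleCat.{0} R)) :=
    Set.range (fun L : ModuleCat.{0} R => (DF D).obj (Opposite.op L))
  have hSP : ∀ (P : ModuleCat.{0} R) (_ : Projective P), Van S (sgl 0 P) := by
    intro P _
    refine van_proj P S n ?_
    rintro _ ⟨L, rfl⟩
    exact ⟨(dgF D).obj (Opposite.op L), rfl, fun i hi => dgF_isZero_X D i (hhigh i hi) L⟩
  obtain ⟨c', hc'⟩ := (hSZ S hSP).2 (van_of_projDim S hSP d Z hd)
  refine ⟨c'.toNat, baer_injDim c'.toNat N fun I i hi => ?_⟩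
  obtain ⟨k, rfl⟩ : ∃ k, i = k + 1 := ⟨i - 1, by lia⟩
  exact H.ext_of_hv N hN k (ModuleCat.of R (R ⧸ I)) inferInstance
    (hc' _ (by lia) _ ⟨_, rfl⟩)

section AbstractPd

open Limits Pretriangulated Opposite

universe v u

set_option linter.unusedSectionVars false

variable {R : Type} [CommRing R] [IsNoetherianRing R]
variable {T : Type u} [Category.{v} T] [Preadditive T] [HasZeroObject T] [HasShift T ℤ]
  [∀ n : ℤ, (shiftFunctor T n).Additive] [Pretriangulated T]
variable {F : (ModuleCat.{0} R)ᵒᵖ ⥤ T} [F.Additive]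

lemma pd_closed {N K : ModuleCat.{0} R} {m : ℕ} (i : K ⟶ Fr R m) (p : Fr R m ⟶ N)
    (w : i ≫ p = 0) (hS : (ShortComplex.mk i p w).ShortExact) (n : ℕ)
    (hN : HasProjectiveDimensionLE N (n + 1)) : HasProjectiveDimensionLE K n :=
  (hS.hasProjectiveDimensionLT_X₃_iff n (inferInstanceAs (Projective (Fr R m)))).1 hN

lemma hv_pd (hF : IsTri F) (Y : T) (n : ℕ) : ∀ (N : ModuleCat.{0} R) (_ : Module.Finite R N)
    (_ : HasProjectiveDimensionLE N n) (i : ℤ)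
    (_ : ∀ j, i ≤ j → j ≤ i + n → HV (F.obj (op (A1 R))) Y j), HV (F.obj (op N)) Y i := by
  induction n with
  | zero =>
    intro N _ hN i h
    have : Projective N := projective_iff_hasProjectiveDimensionLT_one.2 hN
    obtain ⟨m, K, _, a, p, w, hS⟩ := exists_cover N
    have := hS.epi_g
    exact hv_retract_left (Projective.factorThru (𝟙 N) p) p (Projective.factorThru_comp _ _)
      (hv_free_left (h i le_rfl (by simp)) m)
  | succ n ih =>
    intro N _ hN i h φ
    obtain ⟨m, K, _, a, p, w, hS⟩ := exists_cover N
    obtain ⟨δ, hT⟩ := hF a p w hS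
    have hK := pd_closed a p w hS n hN
    obtain ⟨ψ, rfl⟩ := tri_c1 hT (ih K inferInstance hK (i + 1)
      (fun j h1 h2 => h j (by lia) (by push_cast; lia))) φ
    rw [hv_free_left (h i le_rfl (by push_cast; lia)) m ψ, comp_zero]

/-- The class of finitely generated modules of finite projective dimension. -/
def FPD (R : Type) [CommRing R] (N : ModuleCat.{0} R) : Prop :=
  Module.Finite R N ∧ ∃ n : ℕ, HasProjectiveDimensionLE N n

lemma FPD.closed {N K : ModuleCat.{0} R} (h : FPD R N) {m : ℕ} (i : K ⟶ Fr R m)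
    (p : Fr R m ⟶ N) (w : i ≫ p = 0) (hS : (ShortComplex.mk i p w).ShortExact) : FPD R K := by
  obtain ⟨_, n, hn⟩ := h
  have := hS.mono_f
  refine ⟨Module.Finite.of_injective i.hom ((ModuleCat.mono_iff_injective i).1 hS.mono_f), n, ?_⟩
  apply pd_closed i p w hS n
  have h1 : HasProjectiveDimensionLT N (n + 1) := hn
  exact hasProjectiveDimensionLT_of_ge N (n + 1) (n + 1 + 1) (by lia)

lemma dualHyp_fpd (hF : IsTri F)
    (h11 : ∀ i : ℤ, 1 ≤ i → HV (F.obj (op (A1 R))) (F.obj (op (A1 R))) i)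
    (surj : ∀ φ : F.obj (op (A1 R)) ⟶ F.obj (op (A1 R)), ∃ r : A1 R ⟶ A1 R, φ = F.map r.op)
    (inj : ∀ r : A1 R ⟶ A1 R, F.map r.op = 0 → r = 0) : DualHyp F (FPD R) where
  fin N h := h.1
  closed N h m K i p w hS := h.closed i p w hS
  van N h i hi := by
    obtain ⟨h1, n, hn⟩ := h
    exact hv_pd hF _ n N h1 hn i (fun j h1 _ => h11 j (by lia))
  surj := surj
  inj := inj
  tri := hF

lemma hneg_fpd (H : DualHyp F (FPD R))
    (h11 : ∀ i : ℤ, i ≤ -1 → HV (F.obj (op (A1 R))) (F.obj (op (A1 R))) i) (n : ℕ) :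
    ∀ (N : ModuleCat.{0} R) (_ : Module.Finite R N)
    (_ : HasProjectiveDimensionLE N n) (i : ℤ) (_ : i ≤ -1),
    HV (F.obj (op N)) (F.obj (op (A1 R))) i := by
  induction n with
  | zero =>
    intro N h1 hN i hi
    exact hv_pd H.tri _ 0 N h1 hN i (fun j _ h2 => h11 j (by push_cast at h2; lia))
  | succ n ih =>
    intro N _ hN i hi φ
    obtain ⟨m, K, _, a, p, w, hS⟩ := exists_cover N
    obtain ⟨δ, hT⟩ := H.tri a p w hS
    have hK := pd_closed a p w hS n hN
    have hK' : FPD R K := ⟨inferInstance, n, hK⟩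
    have h0 : δ ≫ φ⟦(1 : ℤ)⟧' = 0 := by
      by_cases h2 : i = -1
      · subst h2
        let e := (shiftFunctorCompIsoId T (-1 : ℤ) 1 (by lia)).app (F.obj (op (A1 R)))
        obtain ⟨f, hf⟩ := H.surj_all K hK' (δ ≫ φ⟦(1 : ℤ)⟧' ≫ e.hom)
        have h3 : F.map a.op ≫ δ = 0 := comp_distTriang_mor_zero₂₃ _ hT
        have h4 : f ≫ a = 0 := by
          apply H.inj_free
          rw [op_comp, F.map_comp, ← hf, reassoc_of% h3, zero_comp]
        have := hS.mono_f
        have h5 : f = 0 := by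
          rw [← cancel_mono a, h4, zero_comp]
        rw [← cancel_mono e.hom, Category.assoc, zero_comp]
        refine hf.trans ?_
        rw [h5, op_zero, F.map_zero]
      · exact (ih K inferInstance hK (i + 1) (by lia)).zero_of rfl _
    obtain ⟨ψ, hψ⟩ : ∃ ψ : (F.obj (op (Fr R m)))⟦(1 : ℤ)⟧ ⟶ ((F.obj (op (A1 R)))⟦i⟧)⟦(1 : ℤ)⟧,
        φ⟦(1 : ℤ)⟧' = (-(F.map p.op)⟦(1 : ℤ)⟧') ≫ ψ :=
      Triangle.yoneda_exact₃ _ (rot_of_distTriang _ hT) (φ⟦(1 : ℤ)⟧') h0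
    obtain ⟨χ, hχ⟩ := (shiftFunctor T (1 : ℤ)).map_surjective ψ
    have h1 : χ = 0 := hv_free_left (h11 i hi) m χ
    apply (shiftFunctor T (1 : ℤ)).map_injective
    rw [hψ, ← hχ, h1]
    simp

lemma hv_of_ext_fpd (H : DualHyp F (FPD R))
    (h11 : ∀ i : ℤ, i ≤ -1 → HV (F.obj (op (A1 R))) (F.obj (op (A1 R))) i)
    (h1L : ∀ i : ℤ, i ≤ -1 → ∀ L, HV (F.obj (op (A1 R))) (F.obj (op L)) i)
    (N : ModuleCat.{0} R) (hN : FPD R N) (n : ℕ) (L : ModuleCat.{0} R) (hL : Module.Finite R L)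
    (h : Subsingleton (Abelian.Ext L N (n + 1))) :
    HV (F.obj (op N)) (F.obj (op L)) ((n + 1 : ℕ) : ℤ) := by
  obtain ⟨hfin, t, ht⟩ := id hN
  refine H.hv_of_ext N hN (fun L hL => ?_) n L hL h
  refine H.hv_neg N (hneg_fpd H h11 t N hfin ht) (-1 - t) (fun L hL i hi => ?_) t L hL (-1)
    le_rfl (by lia)
  exact hv_pd H.tri _ t N hfin ht i (fun j _ _ => h1L j (by lia) L)

end AbstractPd

section AbstractRes

open Limits Pretriangulated Opposite

universe v u

set_option linter.unusedSectionVars false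

variable {R : Type} [CommRing R] [IsLocalRing R]

lemma exists_functional (V : Type) [AddCommGroup V] [Module R V]
    (hV : ∀ r ∈ maximalIdeal R, ∀ v : V, r • v = 0) (v : V) (hv : v ≠ 0) :
    ∃ l : V →ₗ[R] ResidueField R, l v = 1 := by
  have ht : Module.IsTorsionBySet R V (maximalIdeal R : Set R) := fun x a => hV a.1 a.2 x
  let _ : Module (ResidueField R) V := ht.module
  have hsm : ∀ (r : R) (x : V), (residue R r) • x = r • x := fun r x => rfl
  obtain ⟨f, hf⟩ := Module.exists_dual_forall_apply_eq_one (K := ResidueField R)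
    (LinearIndepOn.singleton (R := ResidueField R) (v := id) (i := v) hv)
  refine ⟨{ toFun := f, map_add' := map_add f, map_smul' := fun r x => ?_ }, ?_⟩
  · rw [← hsm, map_smul, RingHom.id_apply, smul_eq_mul, Algebra.smul_def]
    rfl
  · exact hf v rfl

variable [IsNoetherianRing R]

lemma exists_quot (N : Type) [AddCommGroup N] [Module R N] [Module.Finite R N] [Nontrivial N] :
    ∃ l : N →ₗ[R] ResidueField R, Function.Surjective l := by
  have h : (maximalIdeal R • ⊤ : Submodule R N) ≠ ⊤ := by
    intro h
    exact Submodule.top_ne_ideal_smul_of_le_jacobson_annihilator (R := R) (M := N)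
      (maximalIdeal_le_jacobson _) h.symm
  obtain ⟨x, hx⟩ : ∃ x : N, x ∉ (maximalIdeal R • ⊤ : Submodule R N) := by
    by_contra! hh
    exact h (eq_top_iff.2 fun x _ => hh x)
  obtain ⟨l, hl⟩ := exists_functional (N ⧸ (maximalIdeal R • ⊤ : Submodule R N)) (by
    intro r hr v
    obtain ⟨v, rfl⟩ := Submodule.mkQ_surjective _ v
    rw [← map_smul]
    exact (Submodule.Quotient.mk_eq_zero _).2 (Submodule.smul_mem_smul hr trivial))
    (Submodule.mkQ _ x) (by simpa using hx)
  refine ⟨l ∘ₗ Submodule.mkQ _, fun y => ?_⟩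
  obtain ⟨r, rfl⟩ := residue_surjective y
  refine ⟨r • x, ?_⟩
  rw [map_smul, LinearMap.comp_apply, hl]
  simp [Algebra.smul_def]

variable {T : Type u} [Category.{v} T] [Preadditive T] [HasZeroObject T] [HasShift T ℤ]
  [∀ n : ℤ, (shiftFunctor T n).Additive] [Pretriangulated T]
variable {F : (ModuleCat.{0} R)ᵒᵖ ⥤ T} [F.Additive]

lemma res_key (hF : IsTri F) (S : T) (hS1 : ∀ j : ℤ, 1 ≤ j → HV (F.obj (op (A1 R))) S j)
    (hkill : ∀ r ∈ maximalIdeal R, ∀ ω : F.obj (op (A1 R)) ⟶ S,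
      F.map (r • 𝟙 (A1 R)).op ≫ ω = 0)
    (N : ModuleCat.{0} R) [Nontrivial N] (hN : FPD R N)
    (h0 : ∀ f : F.obj (op N) ⟶ S, f = 0) (θ : F.obj (op (A1 R)) ⟶ S) : θ = 0 := by
  have := hN.1
  obtain ⟨l, hl⟩ := exists_quot (R := R) N
  obtain ⟨m, K, _, a, p, w, hS⟩ := exists_cover N
  obtain ⟨δ, hT⟩ := hF a p w hS
  have hK := hN.closed a p w hS
  obtain ⟨m', K', _, a', p', w', hS'⟩ := exists_cover K
  obtain ⟨δ', hT'⟩ := hF a' p' w' hS'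
  have hK' := hK.closed a' p' w' hS'
  have hpi : Function.Surjective p.hom := (ModuleCat.epi_iff_surjective p).1 hS.epi_g
  -- the lift
  let π : A1 R ⟶ ModuleCat.of R (ResidueField R) :=
    ModuleCat.ofHom (Algebra.linearMap R (ResidueField R))
  have hπ : Epi π := (ModuleCat.epi_iff_surjective π).2 residue_surjective
  let q : N ⟶ ModuleCat.of R (ResidueField R) := ModuleCat.ofHom l
  let lam : Fr R m ⟶ A1 R := Projective.factorThru (p ≫ q) π
  have hlam : lam ≫ π = p ≫ q := Projective.factorThru_comp _ _
  obtain ⟨x, hx⟩ : ∃ x : Fr R m, IsUnit (lam.hom x : R) := by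
    obtain ⟨y, hy⟩ := hl 1
    obtain ⟨x, rfl⟩ := hpi y
    refine ⟨x, ?_⟩
    have h1 : residue R (lam.hom x) = 1 :=
      (congrArg (fun f => f.hom x) hlam).trans hy
    by_contra hx
    have h2 := (residue_eq_zero_iff (lam.hom x : R)).2 ((mem_maximalIdeal _).2 hx)
    rw [h1] at h2
    exact one_ne_zero h2
  obtain ⟨u, hu⟩ := hx
  let s : A1 R ⟶ Fr R m := elt (((u⁻¹ : Rˣ) : R) • x)
  have hs : s ≫ lam = 𝟙 _ := by
    apply ModuleCat.hom_ext
    apply LinearMap.ext_ring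
    have : lam.hom ((1 : R) • (((u⁻¹ : Rˣ) : R) • x)) = (1 : R) := by
      rw [one_smul, map_smul, ← hu]
      exact u.inv_mul
    exact this
  obtain ⟨χ, hχ⟩ := tri_c2 hT (F.map s.op ≫ θ) (h0 _)
  obtain ⟨ω, hω⟩ := tri_c1_zero hT' (hv_pd hF _ _ K' hK'.1 hK'.2.choose_spec 1
    (fun j hj _ => hS1 j hj)) χ
  have h1 : θ = F.map (p' ≫ a ≫ lam).op ≫ ω := by
    have : F.map lam.op ≫ F.map s.op = 𝟙 _ := by
      rw [← F.map_comp, ← op_comp, hs, op_id, F.map_id]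
    rw [← Category.id_comp θ, ← this, Category.assoc, hχ, hω]
    simp
  have h2 : p' ≫ a ≫ lam ≫ π = 0 := by
    rw [hlam, reassoc_of% w, zero_comp, comp_zero]
  rw [h1, ← Category.id_comp (p' ≫ a ≫ lam), ← sum_prF_inF, Preadditive.sum_comp, op_sum,
    F.map_sum, Preadditive.sum_comp]
  refine Finset.sum_eq_zero fun j _ => ?_
  rw [Category.assoc, dgF_map_elt (inF m' j ≫ p' ≫ a ≫ lam), op_comp, F.map_comp]
  have hr : ((inF m' j ≫ p' ≫ a ≫ lam).hom (1 : R) : R) ∈ maximalIdeal R := by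
    rw [← residue_eq_zero_iff]
    have h3 : inF m' j ≫ p' ≫ a ≫ lam ≫ π = 0 := by rw [h2, comp_zero]
    exact congrArg (fun f => f.hom (1 : R)) h3
  rw [Category.assoc]
  exact hkill _ hr _

end AbstractRes

section Retract

open Limits Pretriangulated Opposite DerivedCategory

universe w

variable {R : Type} [CommRing R]

lemma single_retract (C : CochainComplex (ModuleCat.{0} R) ℤ) (i : ℤ) (V : ModuleCat.{0} R)
    (z : V ⟶ C.X i) (hz : z ≫ C.d i (i + 1) = 0) (l : C.X i ⟶ V) (hl : C.d (i - 1) i ≫ l = 0)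
    (hzl : z ≫ l = 𝟙 V) :
    ∃ (s : (HomologicalComplex.single _ (ComplexShape.up ℤ) i).obj V ⟶ C)
      (r : C ⟶ (HomologicalComplex.single _ (ComplexShape.up ℤ) i).obj V), s ≫ r = 𝟙 _ := by
  refine ⟨HomologicalComplex.mkHomFromSingle z ?_, HomologicalComplex.mkHomToSingle l ?_, ?_⟩
  · rintro k hk
    obtain rfl : i + 1 = k := hk
    exact hz
  · rintro k hk
    obtain rfl : k = i - 1 := by
      have : k + 1 = i := hk
      lia
    exact hl
  · apply HomologicalComplex.from_single_hom_ext
    simp [reassoc_of% hzl]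

variable [HasDerivedCategory.{w} (ModuleCat.{0} R)]

lemma hv_retract_single (C : CochainComplex (ModuleCat.{0} R) ℤ) (i : ℤ) (V : ModuleCat.{0} R)
    (s : (HomologicalComplex.single _ (ComplexShape.up ℤ) i).obj V ⟶ C)
    (r : C ⟶ (HomologicalComplex.single _ (ComplexShape.up ℤ) i).obj V) (hsr : s ≫ r = 𝟙 _)
    (X : DerivedCategory (ModuleCat.{0} R)) (h : HV X (Q.obj C) i) (f : X ⟶ sgl 0 V) : f = 0 := by
  let e : (sgl i V)⟦i⟧ ≅ sgl 0 V := ((singleFunctors (ModuleCat.{0} R)).shiftIso i 0 i (by lia)).app V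
  let s' : sgl i V ⟶ Q.obj C := Q.map s
  let r' : Q.obj C ⟶ sgl i V := Q.map r
  have h1 : s' ≫ r' = 𝟙 _ := (Q.map_comp s r).symm.trans ((congrArg Q.map hsr).trans (Q.map_id _))
  have h2 : f ≫ e.inv ≫ s'⟦i⟧' = 0 := h _
  have h3 : f = (f ≫ e.inv ≫ s'⟦i⟧') ≫ r'⟦i⟧' ≫ e.hom := by
    simp only [Category.assoc]
    rw [← Functor.map_comp_assoc, h1]
    simp
  rw [h3, h2, zero_comp]

lemma res_kill [IsLocalRing R] (r : R) (hr : r ∈ maximalIdeal R) :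
    r • 𝟙 (ModuleCat.of R (ResidueField R)) = 0 := by
  apply ModuleCat.hom_ext
  refine LinearMap.ext fun x => ?_
  change r • x = 0
  rw [Algebra.smul_def]
  have : algebraMap R (ResidueField R) r = 0 := (residue_eq_zero_iff r).2 hr
  rw [this, zero_mul]

lemma sgl_kill [IsLocalRing R] (r : R) (hr : r ∈ maximalIdeal R)
    {X : DerivedCategory (ModuleCat.{0} R)}
    (f : X ⟶ sgl 0 (ModuleCat.of R (ResidueField R))) : r • f = 0 := by
  have h2 : r • 𝟙 (sgl 0 (ModuleCat.of R (ResidueField R))) = 0 := by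
    rw [← CategoryTheory.Functor.map_id, ← Functor.map_smul, res_kill r hr, Functor.map_zero]
  rw [← Category.comp_id f, ← Linear.comp_smul, h2, comp_zero]

lemma dgF_residue_retract [IsLocalRing R] (D : CochainComplex (ModuleCat.{0} R) ℤ) (i : ℤ)
    (z : ModuleCat.of R (ResidueField R) ⟶ D.X i) (hz : z ≫ D.d i (i + 1) = 0)
    (hb : ∀ y : ModuleCat.of R (ResidueField R) ⟶ D.X (i - 1), y ≫ D.d (i - 1) i ≠ z)
    (X : DerivedCategory (ModuleCat.{0} R))
    (h : HV X ((DF D).obj (op (ModuleCat.of R (ResidueField R)))) i)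
    (f : X ⟶ sgl 0 (ModuleCat.of R (ResidueField R))) : f = 0 := by
  let k := ModuleCat.of R (ResidueField R)
  let C := (dgF D).obj (op k)
  have hkill : ∀ r ∈ maximalIdeal R, ∀ v : C.X i, r • v = 0 := by
    intro r hr v
    let v' : k ⟶ D.X i := v
    have : r • v' = 0 := by
      rw [← Category.id_comp v', ← Linear.smul_comp, res_kill r hr, zero_comp]
    exact this
  let B := LinearMap.range (C.d (i - 1) i).hom
  obtain ⟨l, hl⟩ := exists_functional (C.X i ⧸ B) (by
    intro r hr v
    obtain ⟨v, rfl⟩ := Submodule.mkQ_surjective _ v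
    rw [← map_smul, hkill r hr, map_zero]) (Submodule.mkQ B z) (by
      intro hh
      obtain ⟨y, hy⟩ := (Submodule.Quotient.mk_eq_zero _).1 hh
      exact hb y hy)
  let zz : ResidueField R →ₗ[R] C.X i := Submodule.liftQ (maximalIdeal R)
    (LinearMap.toSpanSingleton R (C.X i) z) (fun r hr => hkill r hr z)
  obtain ⟨s, r, hsr⟩ := single_retract C i k (ModuleCat.ofHom zz) (by
      apply ModuleCat.hom_ext
      refine LinearMap.ext fun x => ?_
      obtain ⟨x, rfl⟩ := residue_surjective x
      have : (C.d i (i + 1)).hom (x • (show C.X i from z)) = 0 := by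
        rw [map_smul]
        have : (C.d i (i + 1)).hom z = 0 := hz
        rw [this, smul_zero]
      exact this)
    (ModuleCat.ofHom (l ∘ₗ Submodule.mkQ B)) (by
      apply ModuleCat.hom_ext
      refine LinearMap.ext fun x => ?_
      have : Submodule.mkQ B ((C.d (i - 1) i).hom x) = 0 :=
        (Submodule.Quotient.mk_eq_zero _).2 ⟨x, rfl⟩
      exact (congrArg l this).trans (map_zero l)) (by
      apply ModuleCat.hom_ext
      refine LinearMap.ext fun x => ?_
      obtain ⟨x, rfl⟩ := residue_surjective x
      have : l (Submodule.mkQ B (x • (show C.X i from z))) = residue R x := by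
        rw [map_smul, map_smul]
        refine (congrArg (x • ·) hl).trans ?_
        simp [Algebra.smul_def]
      exact this)
  exact hv_retract_single C i k s r hsr X h f

end Retract

section GorLocal

open Limits Pretriangulated Opposite DerivedCategory

universe w

variable {R : Type} [CommRing R]

lemma isZero_single_X (X : ModuleCat.{0} R) (i : ℤ) (hi : i ≠ 0) :
    IsZero (((HomologicalComplex.single (ModuleCat.{0} R) (ComplexShape.up ℤ) 0).obj X).X i) :=
  HomologicalComplex.isZero_single_obj_X (ComplexShape.up ℤ) 0 X i hi

instance proj_A1 : Projective (A1 R) := by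
  rw [← IsProjective.iff_projective]; infer_instance

variable [HasDerivedCategory.{w} (ModuleCat.{0} R)]

lemma hv_A1_sgl (X : ModuleCat.{0} R) (i : ℤ) (hi : i ≠ 0) : HV (sgl 0 (A1 R)) (sgl 0 X) i :=
  fun f => hom_proj_eq_zero (A1 R)
    ((HomologicalComplex.single (ModuleCat.{0} R) (ComplexShape.up ℤ) 0).obj X) i
    (isZero_single_X X i hi) f

/-- The injective resolution in the derived category. -/
noncomputable def QI (I : InjectiveResolution (A1 R)) : sgl 0 (A1 R) ≅ Q.obj I.cochainComplex :=
  (asIso (Q.map I.ι') : _)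

lemma gor_local [IsLocalRing R] [IsNoetherianRing R] (N : ModuleCat.{0} R) [Nontrivial N]
    (hN : FPD R N) (c : ℕ) (hc : HasInjectiveDimensionLE N c) :
    FinInjDim R (A1 R) := by
  let I : InjectiveResolution (A1 R) := InjectiveResolution.of (A1 R)
  let D := I.cochainComplex
  let e : (DF D).obj (op (A1 R)) ≅ sgl 0 (A1 R) := DFOne D ≪≫ (QI I).symm
  have hF : IsTri (DF D) := DF_isTri D (fun j => inferInstanceAs (Injective (I.cochainComplex.X j)))
  have h11 : ∀ i : ℤ, i ≠ 0 → HV ((DF D).obj (op (A1 R))) ((DF D).obj (op (A1 R))) i :=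
    fun i hi => HV.of_iso e.symm e.symm (hv_A1_sgl _ i hi)
  have h1L : ∀ i : ℤ, i ≤ -1 → ∀ L, HV ((DF D).obj (op (A1 R))) ((DF D).obj (op L)) i :=
    fun i hi L => HV.of_iso e.symm (Iso.refl _) (fun f => hom_proj_eq_zero (A1 R) _ i
      (dgF_isZero_X D i (CochainComplex.isZero_of_isStrictlyGE I.cochainComplex 0 _ (by lia)) L) f)
  have H : DualHyp (DF D) (FPD R) := by
    refine dualHyp_fpd hF (fun i hi => h11 i (by lia)) (DF_surj D ?_) (DF_inj D ?_)
    · intro ψ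
      obtain ⟨g, hg⟩ := (singleFunctor (ModuleCat.{0} R) 0).map_surjective
        ((QI I).hom ≫ ψ ≫ (QI I).inv)
      refine ⟨g.hom (1 : R), ?_⟩
      rw [dgF_map_elt g, Functor.map_smul, CategoryTheory.Functor.map_id] at hg
      rw [← cancel_epi (QI I).hom, ← cancel_mono (QI I).inv, Category.assoc, ← hg]
      simp [D]
    · intro a ha
      have h1 : (singleFunctor (ModuleCat.{0} R) 0).map (a • 𝟙 (A1 R)) = 0 := by
        rw [Functor.map_smul, CategoryTheory.Functor.map_id, ← cancel_mono (QI I).hom]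
        have := congrArg (fun t => (QI I).hom ≫ t) ha
        simpa [D] using this
      have h2 : a • 𝟙 (A1 R) = 0 :=
        (singleFunctor (ModuleCat.{0} R) 0).map_injective (by rw [h1, Functor.map_zero])
      have h3 := congrArg (fun t : A1 R ⟶ A1 R => t.hom (1 : R)) h2
      simpa using h3
  let k := ModuleCat.of R (ResidueField R)
  have hkfin : Module.Finite R k := inferInstanceAs (Module.Finite R (ResidueField R))
  have hHV : ∀ n : ℕ, c ≤ n → HV ((DF D).obj (op N)) ((DF D).obj (op k)) ((n + 1 : ℕ) : ℤ) := by
    intro n hn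
    refine hv_of_ext_fpd H (fun i hi => h11 i (by lia)) h1L N hN n k hkfin ?_
    have : HasInjectiveDimensionLT N (c + 1) := hc
    exact HasInjectiveDimensionLT.subsingleton N (c + 1) (n + 1) (by lia) k
  have hext : ∀ i, c < i → Subsingleton (Abelian.Ext k (A1 R) i) := by
    intro i hi
    obtain ⟨n, rfl⟩ : ∃ n, i = n + 1 := ⟨i - 1, by lia⟩
    refine subsingleton_of_forall_eq 0 fun α => ?_
    obtain ⟨f, hf, rfl⟩ := I.extMk_surjective α (n + 2) rfl
    rw [I.extMk_eq_zero_iff f (n + 2) rfl hf n rfl]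
    by_contra! hcon
    let z : k ⟶ D.X ((n + 1 : ℕ) : ℤ) := f ≫ (I.cochainComplexXIso _ (n + 1) rfl).inv
    have hcontra := res_key hF (sgl 0 k)
      (fun j hj => HV.of_iso e.symm (Iso.refl _) (hv_A1_sgl _ j (by lia)))
      (fun r hr ω => by
        rw [DF_smul, op_id, CategoryTheory.Functor.map_id, Linear.smul_comp]
        exact sgl_kill r hr _) N hN
      (dgF_residue_retract D _ z (by
        simp only [z, D, Category.assoc]
        rw [I.cochainComplex_d _ _ (n + 1) (n + 2) rfl (by push_cast; lia)]
        simp [reassoc_of% hf]) (by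
        intro y hy
        apply hcon (y ≫ (I.cochainComplexXIso _ n (by push_cast; lia)).hom)
        have := congrArg (fun t => t ≫ (I.cochainComplexXIso _ (n + 1) rfl).hom) hy
        simp only [z, D, Category.assoc] at this
        rw [I.cochainComplex_d _ _ n (n + 1) (by push_cast; lia) rfl] at this
        simpa using this) _ (hHV n (by lia)))
    let π : A1 R ⟶ k := ModuleCat.ofHom (Algebra.linearMap R (ResidueField R))
    have h1 : e.hom ≫ (singleFunctor (ModuleCat.{0} R) 0).map π = 0 := hcontra _
    have h2 : (singleFunctor (ModuleCat.{0} R) 0).map π = 0 := by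
      rw [← cancel_epi e.hom, h1, comp_zero]
    have h3 : π = 0 :=
      (singleFunctor (ModuleCat.{0} R) 0).map_injective (by rw [h2, Functor.map_zero])
    have h4 := congrArg (fun t : A1 R ⟶ k => t.hom (1 : R)) h3
    have h5 : algebraMap R (ResidueField R) 1 = 0 := h4
    rw [map_one] at h5
    exact one_ne_zero h5
  have := baer_injDim c (A1 R) (fun J i hi => ext_subsingleton_of_residueField (A1 R) c hext
    (R ⧸ J) i hi)
  exact finInjDim_of_hasInjectiveDimensionLT (A1 R) c

end GorLocal

theorem cohenMacaulay_of_testModule_ext_vanishing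
    (R : Type) [CommRing R] [IsNoetherianRing R] (hD : HasDualizingComplex R)
    (M : ModuleCat R) (hM : Module.Finite R M) (htest : IsTestModule R M)
    (N : ModuleCat R) (hN : Module.Finite R N)
    (hsupp : Module.support R N = Set.univ)
    (hext : ExtEventuallyZero R M N) :
    IsCohenMacaulayRing R ∧ (FinProjDim R N → IsGorensteinRing R) := by
  obtain ⟨c, hc⟩ := injDim_of_test R hD M hM htest N hN hext
  refine ⟨cm_of_injDim N hsupp c hc, fun hpd => ?_⟩
  intro p hp
  obtain ⟨n, hn⟩ := hasProjectiveDimensionLE_of_finProjDim N hpd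
  have h1 := finite_localizedModule p N
  have h2 : HasInjectiveDimensionLE (N.localizedModule p.primeCompl) c :=
    ModuleCat.localizedModule_hasInjectiveDimensionLE c p.primeCompl N
  have h3 : HasProjectiveDimensionLE (N.localizedModule p.primeCompl) n :=
    ModuleCat.localizedModule_hasProjectiveDimensionLE n p.primeCompl N
  have : IsNoetherianRing (Localization.AtPrime p) :=
    IsLocalization.isNoetherianRing p.primeCompl _ inferInstance
  have h4 : Nontrivial (N.localizedModule p.primeCompl) := by
    by_contra hcon
    have h5 : Subsingleton (N.localizedModule p.primeCompl) := not_nontrivial_iff_subsingleton.1 hcon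
    have h6 := support_localizedModule p N hsupp
    rw [Module.support_eq_empty_iff.2 h5] at h6
    exact Set.empty_ne_univ h6
  let _ := HasDerivedCategory.standard (ModuleCat.{0} (Localization.AtPrime p))
  exact gor_local (N.localizedModule p.primeCompl) ⟨h1, n, h3⟩ c h2
end

section
/- Let R be a Cohen-Macaulay local ring with canonical module ω, and let (−)† = Hom_R(−,ω). For a maximal Cohen-Macaulay R-module M: M is a test module (Tor-vanishing against M detects finite projective dimension) if and only if M† has the property that every finitely generated R-module N with Ext^i_R(N, M†) = 0 for all i >> 0 has finite projective dimension. -/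
open CategoryTheory IsLocalRing

/-- A canonical module of a local ring: a finitely generated maximal
Cohen-Macaulay module of finite injective dimension whose homothety map
`R → Hom(ω,ω)` is bijective. -/
def IsCanonicalModule (R : Type) [CommRing R] [IsLocalRing R]
    (ω : Type) [AddCommGroup ω] [Module R ω] : Prop :=
  Module.Finite R ω ∧
  (moduleDepth R (ModuleCat.of R ω) : WithBot ℕ∞) = ringKrullDim R ∧
  FinInjDim R (ModuleCat.of R ω) ∧
  Function.Bijective (fun r : R => r • (LinearMap.id : ω →ₗ[R] ω))

open CategoryTheory.Abelian in
/-- Vanishing of `Ext^j(N, W)`. -/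
def VExt (R : Type) [CommRing R] (W : Type) [AddCommGroup W] [Module R W] (j : ℕ)
    (N : Type) [AddCommGroup N] [Module R N] : Prop :=
  Subsingleton (CategoryTheory.Abelian.Ext (ModuleCat.of R N) (ModuleCat.of R W) j)

section VLemmas

open CategoryTheory.Abelian

variable {R : Type} [CommRing R] {W : Type} [AddCommGroup W] [Module R W]
  {A B C : Type} [AddCommGroup A] [Module R A] [AddCommGroup B] [Module R B]
  [AddCommGroup C] [Module R C]

lemma ses_aux {f : A →ₗ[R] B} {g : B →ₗ[R] C}
    (hf : Function.Injective f) (hg : Function.Surjective g) (hfg : Function.Exact f g) :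
    (ModuleCat.shortComplexOfCompEqZero f g hfg.linearMap_comp_eq_zero).ShortExact where
  exact := ModuleCat.shortComplex_exact _ hfg
  mono_f := (ModuleCat.mono_iff_injective _).2 hf
  epi_g := (ModuleCat.epi_iff_surjective _).2 hg

lemma VExt.left {f : A →ₗ[R] B} {g : B →ₗ[R] C}
    (hf : Function.Injective f) (hg : Function.Surjective g) (hfg : Function.Exact f g)
    {j : ℕ} (hB : VExt R W j B) (hC : VExt R W (j + 1) C) : VExt R W j A := by
  unfold VExt at *
  refine subsingleton_of_forall_eq 0 fun x => ?_
  obtain ⟨y, rfl⟩ := Ext.contravariant_sequence_exact₁ (ses_aux hf hg hfg) _ x (n₁ := j + 1)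
    (by omega) (hC.elim _ _)
  have : y = 0 := hB.elim _ _
  rw [this, Ext.comp_zero]

lemma VExt.right {f : A →ₗ[R] B} {g : B →ₗ[R] C}
    (hf : Function.Injective f) (hg : Function.Surjective g) (hfg : Function.Exact f g)
    {j : ℕ} (hA : VExt R W j A) (hB : VExt R W (j + 1) B) : VExt R W (j + 1) C := by
  unfold VExt at *
  refine subsingleton_of_forall_eq 0 fun x => ?_
  obtain ⟨y, rfl⟩ := Ext.contravariant_sequence_exact₃ (ses_aux hf hg hfg) _ x (n₀ := j)
    (hB.elim _ _) (by omega)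
  have : y = 0 := hA.elim _ _
  rw [this, Ext.comp_zero]

lemma VExt.mid {f : A →ₗ[R] B} {g : B →ₗ[R] C}
    (hf : Function.Injective f) (hg : Function.Surjective g) (hfg : Function.Exact f g)
    {j : ℕ} (hA : VExt R W j A) (hC : VExt R W j C) : VExt R W j B := by
  unfold VExt at *
  refine subsingleton_of_forall_eq 0 fun x => ?_
  obtain ⟨y, rfl⟩ := Ext.contravariant_sequence_exact₂ (ses_aux hf hg hfg) _ x
    (hA.elim _ _)
  have : y = 0 := hC.elim _ _
  rw [this, Ext.comp_zero]

lemma VExt.of_surj_aux {f : A →ₗ[R] B} {g : B →ₗ[R] C}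
    (hf : Function.Injective f) (hg : Function.Surjective g) (hfg : Function.Exact f g)
    (hC : VExt R W 1 C) (φ : A →ₗ[R] W) : ∃ ψ : B →ₗ[R] W, ψ ∘ₗ f = φ := by
  unfold VExt at *
  obtain ⟨y, hy⟩ := Ext.contravariant_sequence_exact₁ (ses_aux hf hg hfg) _
    (Ext.mk₀ (ModuleCat.ofHom φ)) (n₁ := 1) (by omega) (hC.elim _ _)
  obtain ⟨ψ, rfl⟩ := Ext.addEquiv₀.symm.surjective y
  refine ⟨ψ.hom, ?_⟩
  have h2 : Ext.mk₀ ((ModuleCat.ofHom f) ≫ ψ) = Ext.mk₀ (ModuleCat.ofHom φ) := by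
    rw [← hy, Ext.addEquiv₀_symm_apply, Ext.mk₀_comp_mk₀]
  have h3 := (Ext.mk₀_bijective _ _).1 h2
  have := congrArg ModuleCat.Hom.hom h3
  simpa using this

lemma VExt.subsing [Subsingleton A] (j : ℕ) : VExt R W j A := by
  unfold VExt
  refine subsingleton_of_forall_eq 0 fun x => ?_
  have : (𝟙 (ModuleCat.of R A)) = 0 := by
    ext x; exact Subsingleton.elim _ _
  rw [← Ext.mk₀_id_comp x, this, Ext.mk₀_zero, Ext.zero_comp]

lemma VExt.congr (e : A ≃ₗ[R] B) {j : ℕ} (h : VExt R W j A) : VExt R W j B :=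
  VExt.mid (f := e.toLinearMap) (g := (0 : B →ₗ[R] PUnit)) e.injective
    (fun _ => ⟨0, rfl⟩) (fun x => ⟨fun _ => e.surjective x, fun _ => rfl⟩) h (VExt.subsing j)

lemma VExt.proj [Module.Projective R A] (j : ℕ) : VExt R W (j + 1) A := by
  unfold VExt
  have : Projective (ModuleCat.of R A) := (IsProjective.iff_projective A).1 inferInstance
  exact subsingleton_of_forall_eq 0 fun x => Ext.eq_zero_of_projective x

lemma VExt.sum_aux {ι : Type} [Fintype ι] (i : ι → (A →ₗ[R] B)) (p : ι → (B →ₗ[R] A))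
    (h : ∑ k, i k ∘ₗ p k = LinearMap.id) {j : ℕ} (hA : VExt R W j A) : VExt R W j B := by
  unfold VExt at *
  refine subsingleton_of_forall_eq 0 fun x => ?_
  have : (𝟙 (ModuleCat.of R B)) = ∑ k, ModuleCat.ofHom (p k) ≫ ModuleCat.ofHom (i k) := by
    ext x
    have := congrArg (fun f => f x) h
    simp at this
    simp [ModuleCat.hom_sum, this]
  rw [← Ext.mk₀_id_comp x, this, Ext.mk₀_sum, Ext.sum_comp]
  refine Finset.sum_eq_zero fun k _ => ?_
  rw [← Ext.mk₀_comp_mk₀_assoc]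
  have : (Ext.mk₀ (ModuleCat.ofHom (i k))).comp x (zero_add j) = 0 := hA.elim _ _
  rw [this, Ext.comp_zero]

lemma smul_id_comp_aux {A W : ModuleCat R} (x : R) {j : ℕ} (y : Ext A W j) :
    (Ext.mk₀ (x • 𝟙 A)).comp y (zero_add j) = x • y := by
  rw [Ext.mk₀_smul, Ext.smul_comp, Ext.mk₀_id_comp]

lemma VExt.nakayama [IsLocalRing R] [IsNoetherianRing R] [Module.Finite R W] [Module.Finite R A]
    {x : R} (hx : x ∈ maximalIdeal R) (hreg : IsSMulRegular A x) {j : ℕ}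
    (h : VExt R W (j + 1) (QuotSMulTop x A)) : VExt R W j A := by
  unfold VExt at *
  have key : ∀ e : Ext (ModuleCat.of R A) (ModuleCat.of R W) j, ∃ e', x • e' = e := by
    intro e
    have hse : (ModuleCat.smulShortComplex (ModuleCat.of R A) x).ShortExact :=
      IsSMulRegular.smulShortComplex_shortExact (M := ModuleCat.of R A) hreg
    obtain ⟨y, hy⟩ := Ext.contravariant_sequence_exact₁ hse _ e (n₁ := j + 1)
      (by omega) (h.elim _ _)
    refine ⟨y, ?_⟩
    rw [← hy]
    exact (smul_id_comp_aux x y).symm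
  have := Submodule.eq_bot_of_le_smul_of_le_jacobson_bot (maximalIdeal R)
    (⊤ : Submodule R (Ext (ModuleCat.of R A) (ModuleCat.of R W) j)) Module.Finite.fg_top
    (fun e _ => by
      obtain ⟨e', rfl⟩ := key e
      exact Submodule.smul_mem_smul hx trivial) (IsLocalRing.maximalIdeal_le_jacobson _)
  exact (Submodule.subsingleton_iff R).1 (subsingleton_of_bot_eq_top this.symm)

end VLemmas

section DepthPart

set_option linter.unusedSectionVars false

open scoped Pointwise

open CategoryTheory.Abelian

variable {R : Type} [CommRing R] [IsLocalRing R] [IsNoetherianRing R]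

lemma subsingleton_hom_of_ext0 {A B : Type} [AddCommGroup A] [Module R A] [AddCommGroup B]
    [Module R B] (h : Subsingleton (Ext (ModuleCat.of R A) (ModuleCat.of R B) 0)) :
    Subsingleton (A →ₗ[R] B) :=
  ((Ext.addEquiv₀ (X := ModuleCat.of R A) (Y := ModuleCat.of R B)).trans
    ModuleCat.homAddEquiv).symm.toEquiv.subsingleton

lemma subsingleton_ext0_of_hom {A B : Type} [AddCommGroup A] [Module R A] [AddCommGroup B]
    [Module R B] (h : Subsingleton (A →ₗ[R] B)) :
    Subsingleton (Ext (ModuleCat.of R A) (ModuleCat.of R B) 0) :=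
  (Ext.addEquiv₀.trans ModuleCat.homAddEquiv).toEquiv.subsingleton

lemma exists_regular_aux {A : Type} [AddCommGroup A] [Module R A] [Module.Finite R A]
    (h : VExt R A 0 (ResidueField R)) : ∃ x ∈ maximalIdeal R, IsSMulRegular A x := by
  have := subsingleton_hom_of_ext0 h
  obtain ⟨x, hx, hr⟩ := IsSMulRegular.subsingleton_linearMap_iff.1 this
  refine ⟨x, ?_, hr⟩
  have h1 : x • (1 : ResidueField R) = 0 := Module.mem_annihilator.1 hx 1
  rwa [Algebra.smul_def, mul_one, ResidueField.algebraMap_eq, residue_eq_zero_iff] at h1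

lemma depth_quot {A : Type} [AddCommGroup A] [Module R A]
    {x : R} (hr : IsSMulRegular A x) {t : ℕ}
    (h1 : VExt R A t (ResidueField R)) (h2 : VExt R A (t + 1) (ResidueField R)) :
    VExt R (QuotSMulTop x A) t (ResidueField R) := by
  unfold VExt at *
  have hse := IsSMulRegular.smulShortComplex_shortExact (M := ModuleCat.of R A) hr
  refine subsingleton_of_forall_eq 0 fun e => ?_
  obtain ⟨y, hy⟩ := Ext.covariant_sequence_exact₃ _ hse e (n₁ := t + 1) rfl (h2.elim _ _)
  have h0 : y = 0 := h1.elim _ _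
  rw [← hy, h0, Ext.zero_comp]
  rfl

lemma comp_smul_id_aux {A W : ModuleCat R} (x : R) {j : ℕ} (y : Ext A W j)
    (hx : x • 𝟙 A = 0) :
    y.comp (Ext.mk₀ (x • 𝟙 W)) (add_zero j) = 0 := by
  rw [Ext.mk₀_smul, Ext.comp_smul, Ext.comp_mk₀_id, ← smul_id_comp_aux, hx, Ext.mk₀_zero,
    Ext.zero_comp]

lemma depth_quot_nonzero {A : Type} [AddCommGroup A] [Module R A]
    {x : R} (hx : x ∈ maximalIdeal R) (hr : IsSMulRegular A x) {t : ℕ}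
    (h1 : VExt R (QuotSMulTop x A) t (ResidueField R)) :
    VExt R A (t + 1) (ResidueField R) := by
  unfold VExt at *
  have hse := IsSMulRegular.smulShortComplex_shortExact (M := ModuleCat.of R A) hr
  refine subsingleton_of_forall_eq 0 fun e => ?_
  have hk : x • 𝟙 (ModuleCat.of R (ResidueField R)) = 0 := by
    ext y
    change x • y = 0
    rw [Algebra.smul_def, ResidueField.algebraMap_eq, (residue_eq_zero_iff x).2 hx, zero_mul]
  obtain ⟨y, hy⟩ := Ext.covariant_sequence_exact₁ _ hse e (comp_smul_id_aux x e hk) (n₀ := t) rfl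
  have h0 : y = 0 := h1.elim _ _
  rw [← hy, h0, Ext.zero_comp]
  rfl

lemma exists_Q {W : Type} [AddCommGroup W] [Module R W] (t : ℕ) :
    ∀ (s : ℕ) (Q : Type) [AddCommGroup Q] [Module R Q] [Module.Finite R Q],
    (∀ i < t, VExt R Q i (ResidueField R)) → ¬ VExt R Q t (ResidueField R) →
    (∀ i > s, VExt R W i Q) →
    ∃ (Q' : Type) (_ : AddCommGroup Q') (_ : Module R Q') (_ : Module.Finite R Q'),
      ¬ VExt R Q' 0 (ResidueField R) ∧ ∀ i > s + t, VExt R W i Q' := by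
  induction t with
  | zero =>
    intro s Q _ _ _ _ h2 h3
    exact ⟨Q, inferInstance, inferInstance, inferInstance, h2, h3⟩
  | succ t ih =>
    intro s Q _ _ _ h1 h2 h3
    obtain ⟨x, hx, hr⟩ := exists_regular_aux (h1 0 (by omega))
    obtain ⟨Q', a, b, c, h4, h5⟩ := ih (s + 1) (QuotSMulTop x Q)
      (fun i hi => depth_quot hr (h1 i (by omega)) (h1 (i + 1) (by omega)))
      (fun h => h2 (depth_quot_nonzero hx hr h))
      (fun i hi => by
        obtain ⟨i, rfl⟩ : ∃ k, i = k + 1 := ⟨i - 1, by omega⟩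
        exact VExt.right (f := LinearMap.lsmul R Q x) (g := (x • (⊤ : Submodule R Q)).mkQ)
          hr (Submodule.mkQ_surjective _)
          (LinearMap.exact_lsmul_mkQ_smul_top Q x) (h3 i (by omega)) (h3 (i + 1) (by omega)))
    exact ⟨Q', a, b, c, h4, fun i hi => h5 i (by omega)⟩

lemma inj_bound {W : Type} [AddCommGroup W] [Module R W] [Module.Finite R W] {d n : ℕ}
    (hR1 : ∀ i < d, VExt R R i (ResidueField R)) (hR2 : ¬ VExt R R d (ResidueField R))
    (hW : ∀ i > n, ∀ (L : Type) [AddCommGroup L] [Module R L], VExt R W i L) :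
    ∀ i > d, ∀ (L : Type) [AddCommGroup L] [Module R L] [Module.Finite R L], VExt R W i L := by
  obtain ⟨Q, _, _, _, hQ0, hQ⟩ := exists_Q (R := R) (W := W) d 0 R hR1 hR2
    (fun i hi => by
      obtain ⟨i, rfl⟩ : ∃ k, i = k + 1 := ⟨i - 1, by omega⟩
      exact VExt.proj i)
  have hinj : ∃ f : ResidueField R →ₗ[R] Q, Function.Injective f := by
    by_contra hcon
    apply hQ0
    refine subsingleton_ext0_of_hom (subsingleton_of_forall_eq 0 fun f => ?_)
    by_contra hf
    apply hcon
    refine ⟨f, ?_⟩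
    rw [injective_iff_map_eq_zero]
    intro a ha
    by_contra ha0
    apply hf
    ext y
    obtain ⟨r, hr⟩ := residue_surjective (y * a⁻¹)
    have : y = r • a := by
      rw [Algebra.smul_def, ResidueField.algebraMap_eq, hr, inv_mul_cancel_right₀ ha0]
    rw [this, map_smul, ha, smul_zero, LinearMap.zero_apply]
  obtain ⟨f, hf⟩ := hinj
  suffices H : ∀ m : ℕ, ∀ i > d, i + m > n → ∀ (L : Type) [AddCommGroup L] [Module R L]
      [Module.Finite R L], VExt R W i L from
    fun i hi L _ _ _ => H (n + 1) i hi (by omega) L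
  intro m
  induction m with
  | zero => intro i _ hi L _ _ _; exact hW i (by omega) L
  | succ m ih =>
    intro i hi hin L _ _ hL
    replace ih := ih (i + 1) (by omega) (by omega)
    induction hL using IsNoetherianRing.induction_on_isQuotientEquivQuotientPrime R with
    | subsingleton N => exact VExt.subsing i
    | exact N₁ N₂ N₃ f g hf hg hfg h₁ h₃ => exact VExt.mid hf hg hfg h₁ h₃
    | quotient N p e =>
      refine VExt.congr e.symm ?_
      by_cases hp : p.1 = maximalIdeal R
      · have hk : VExt R W i (ResidueField R) :=
          VExt.left hf (Submodule.mkQ_surjective _) (LinearMap.exact_map_mkQ_range f)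
            (hQ i (by omega)) (ih _)
        rw [hp]
        exact hk
      · obtain ⟨x, hx, hxp⟩ : ∃ x ∈ maximalIdeal R, x ∉ p.1 := by
          by_contra hcon
          push Not at hcon
          exact hp ((IsLocalRing.eq_maximalIdeal
            ((maximalIdeal.isMaximal R).eq_of_le p.2.ne_top hcon ▸ maximalIdeal.isMaximal R)))
        refine VExt.nakayama hx ?_ (ih _)
        intro a b hab
        induction a using Submodule.Quotient.induction_on with | _ a => ?_
        induction b using Submodule.Quotient.induction_on with | _ b => ?_
        have hab' : (Submodule.Quotient.mk (x • a) : R ⧸ p.1) = Submodule.Quotient.mk (x • b) := hab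
        rw [Submodule.Quotient.eq] at hab' ⊢
        rw [← smul_sub, smul_eq_mul] at hab'
        exact (p.2.mem_or_mem hab').resolve_left hxp

lemma mcm_vanish {W : Type} [AddCommGroup W] [Module R W] [Module.Finite R W] {d : ℕ}
    (hW : ∀ i > d, ∀ (L : Type) [AddCommGroup L] [Module R L] [Module.Finite R L], VExt R W i L)
    (t : ℕ) : ∀ (A : Type) [AddCommGroup A] [Module R A] [Module.Finite R A],
    (∀ i < t, VExt R A i (ResidueField R)) → ∀ i, i + t > d → VExt R W i A := by
  induction t with
  | zero => intro A _ _ _ _ i hi; exact hW i hi A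
  | succ t ih =>
    intro A _ _ _ h i hi
    obtain ⟨x, hx, hr⟩ := exists_regular_aux (h 0 (by omega))
    exact VExt.nakayama hx hr (ih _
      (fun i hi => depth_quot hr (h i (by omega)) (h (i + 1) (by omega))) _ (by omega))

end DepthPart

section Duality

set_option linter.unusedSectionVars false

variable {R : Type} [CommRing R] [IsNoetherianRing R] {W : Type} [AddCommGroup W] [Module R W]

/-- The dual `f†` of a linear map. -/
def dmap (W : Type) [AddCommGroup W] [Module R W] {A B : Type} [AddCommGroup A] [Module R A]
    [AddCommGroup B] [Module R B] (f : A →ₗ[R] B) : (B →ₗ[R] W) →ₗ[R] (A →ₗ[R] W) :=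
  LinearMap.lcomp R W f

lemma dmap_apply {A B : Type} [AddCommGroup A] [Module R A]
    [AddCommGroup B] [Module R B] (f : A →ₗ[R] B) (φ : B →ₗ[R] W) : dmap W f φ = φ ∘ₗ f := rfl

/-- Evaluation to the bidual. -/
def evd (W : Type) [AddCommGroup W] [Module R W] (A : Type) [AddCommGroup A] [Module R A] :
    A →ₗ[R] ((A →ₗ[R] W) →ₗ[R] W) := LinearMap.flip LinearMap.id

lemma evd_apply {A : Type} [AddCommGroup A] [Module R A] (a : A) (φ : A →ₗ[R] W) :
    evd W A a φ = φ a := rfl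

lemma evd_nat {A B : Type} [AddCommGroup A] [Module R A]
    [AddCommGroup B] [Module R B] (f : A →ₗ[R] B) (a : A) :
    dmap W (dmap W f) (evd W A a) = evd W B (f a) := rfl

variable {A B C D : Type} [AddCommGroup A] [Module R A] [AddCommGroup B] [Module R B]
  [AddCommGroup C] [Module R C] [AddCommGroup D] [Module R D]

lemma dmap_injective {g : B →ₗ[R] C} (hg : Function.Surjective g) :
    Function.Injective (dmap W g) := by
  intro φ ψ h
  ext c
  obtain ⟨b, rfl⟩ := hg c
  exact LinearMap.congr_fun h b

lemma dmap_exact_of_surj {f : A →ₗ[R] B} {g : B →ₗ[R] C} (hg : Function.Surjective g)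
    (hfg : Function.Exact f g) : Function.Exact (dmap W g) (dmap W f) := by
  intro φ
  constructor
  · intro h
    have hk : LinearMap.ker g ≤ LinearMap.ker φ := by
      intro b hb
      obtain ⟨a, rfl⟩ := (hfg b).1 hb
      exact LinearMap.congr_fun h a
    let e := g.quotKerEquivOfSurjective hg
    refine ⟨(LinearMap.ker g).liftQ φ hk ∘ₗ e.symm.toLinearMap, ?_⟩
    ext b
    have : e.symm (g b) = Submodule.Quotient.mk b := by
      rw [LinearEquiv.symm_apply_eq]; rfl
    simp [dmap_apply, this]
  · rintro ⟨ψ, rfl⟩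
    ext a
    simp [dmap_apply, hfg.apply_apply_eq_zero a]

lemma rangeRestrict_eq_zero_aux (g : B →ₗ[R] C) (b : B) : g.rangeRestrict b = 0 ↔ g b = 0 := by
  rw [← Subtype.coe_inj]; rfl

lemma ses_range {f : A →ₗ[R] B} {g : B →ₗ[R] C} (hfg : Function.Exact f g) :
    Function.Exact (LinearMap.range f).subtype g.rangeRestrict := by
  intro b
  rw [rangeRestrict_eq_zero_aux, hfg b]
  simp

lemma dmap_exact {f : A →ₗ[R] B} {g : B →ₗ[R] C} {h : C →ₗ[R] D} (hfg : Function.Exact f g)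
    (hgh : Function.Exact g h) (hV : VExt R W 1 (LinearMap.range h)) :
    Function.Exact (dmap W g) (dmap W f) := by
  have h1 : Function.Exact f g.rangeRestrict := by
    intro b
    rw [rangeRestrict_eq_zero_aux, hfg b]
  have h2 := dmap_exact_of_surj (W := W) g.surjective_rangeRestrict h1
  intro φ
  rw [h2 φ]
  constructor
  · rintro ⟨ψ, rfl⟩
    obtain ⟨χ, rfl⟩ := VExt.of_surj_aux (Submodule.subtype_injective (LinearMap.range g))
      h.surjective_rangeRestrict (ses_range hgh) hV ψ
    exact ⟨χ, rfl⟩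
  · rintro ⟨ψ, rfl⟩
    exact ⟨ψ ∘ₗ (LinearMap.range g).subtype, rfl⟩

/-- The `k`-th inclusion of `W` into the dual of a free module. -/
def freeInc (W : Type) [AddCommGroup W] [Module R W] {n : ℕ} (k : Fin n) :
    W →ₗ[R] ((Fin n → R) →ₗ[R] W) :=
  LinearMap.smulRightₗ (LinearMap.proj k : (Fin n → R) →ₗ[R] R)

lemma freeInc_apply {n : ℕ} (k : Fin n) (w : W) (x : Fin n → R) :
    freeInc W k w x = x k • w := rfl

lemma freeInc_sum {n : ℕ} (φ : (Fin n → R) →ₗ[R] W) :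
    ∑ k, freeInc W k (φ (Pi.single k 1)) = φ := by
  refine LinearMap.pi_ext' fun i => LinearMap.ext_ring ?_
  simp only [LinearMap.comp_apply, LinearMap.single_apply, LinearMap.sum_apply, freeInc_apply]
  rw [Finset.sum_eq_single i]
  · simp
  · intro b _ hb
    simp [Pi.single_eq_of_ne hb]
  · simp

lemma free_dual_X (hX : ∀ j, VExt R W (j + 1) W) (n j : ℕ) :
    VExt R W (j + 1) ((Fin n → R) →ₗ[R] W) := by
  refine VExt.sum_aux (A := W) (ι := Fin n) (fun k => freeInc W k)
    (fun k => LinearMap.applyₗ (Pi.single k 1)) ?_ (hX j)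
  ext1 φ
  simpa using freeInc_sum φ

lemma free_evd (hW : Function.Bijective (fun r : R => r • (LinearMap.id : W →ₗ[R] W))) (n : ℕ) :
    Function.Bijective (evd (R := R) W (Fin n → R)) := by
  constructor
  · rw [injective_iff_map_eq_zero]
    intro x hx
    ext k
    apply hW.1
    ext w
    have := LinearMap.congr_fun hx (freeInc W k w)
    rw [evd_apply, freeInc_apply] at this
    simpa using this
  · intro Φ
    choose r hr using fun k => hW.2 (Φ ∘ₗ freeInc W k)
    refine ⟨r, ?_⟩
    ext φ
    rw [evd_apply]
    conv_rhs => rw [← freeInc_sum φ, map_sum]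
    conv_lhs => rw [← freeInc_sum φ, LinearMap.sum_apply]
    refine Finset.sum_congr rfl fun k _ => ?_
    rw [freeInc_apply]
    exact LinearMap.congr_fun (hr k) _

lemma exists_syz (A : Type) [AddCommGroup A] [Module R A] [Module.Finite R A]
    (hA : ∀ j, VExt R W (j + 1) A) :
    ∃ (n : ℕ) (K : Type) (_ : AddCommGroup K) (_ : Module R K) (_ : Module.Finite R K)
      (f : K →ₗ[R] (Fin n → R)) (g : (Fin n → R) →ₗ[R] A), Function.Injective f ∧
      Function.Surjective g ∧ Function.Exact f g ∧ (∀ j, VExt R W (j + 1) K) := by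
  obtain ⟨n, g, hg⟩ := Module.Finite.exists_fin' R A
  have hex : Function.Exact (LinearMap.ker g).subtype g := LinearMap.exact_subtype_ker_map g
  exact ⟨n, LinearMap.ker g, inferInstance, inferInstance, inferInstance, _, g,
    Submodule.subtype_injective _, hg, hex,
    fun j => VExt.left (Submodule.subtype_injective _) hg hex (VExt.proj j) (hA (j + 1))⟩

lemma dual_X {N : ℕ}
    (hN : ∀ i > N, ∀ (L : Type) [AddCommGroup L] [Module R L], VExt R W i L)
    (hX : ∀ j, VExt R W (j + 1) W) (m : ℕ) :
    ∀ j, j + m ≥ N → ∀ (A : Type) [AddCommGroup A] [Module R A] [Module.Finite R A],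
    (∀ j, VExt R W (j + 1) A) → VExt R W (j + 1) (A →ₗ[R] W) := by
  induction m with
  | zero => intro j hj A _ _ _ _; exact hN _ (by omega) _
  | succ m ih =>
    intro j hj A _ _ _ hA
    obtain ⟨n, K, _, _, _, f, g, hf, hg, hfg, hK⟩ := exists_syz A hA
    exact VExt.left (dmap_injective hg) (fun φ => VExt.of_surj_aux hf hg hfg (hA 0) φ)
      (dmap_exact_of_surj hg hfg) (free_dual_X hX n j) (ih (j + 1) (by omega) K hK)

lemma evd_surj {N : ℕ}
    (hN : ∀ i > N, ∀ (L : Type) [AddCommGroup L] [Module R L], VExt R W i L)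
    (hX : ∀ j, VExt R W (j + 1) W)
    (hW : Function.Bijective (fun r : R => r • (LinearMap.id : W →ₗ[R] W)))
    (A : Type) [AddCommGroup A] [Module R A] [Module.Finite R A]
    (hA : ∀ j, VExt R W (j + 1) A) : Function.Surjective (evd (R := R) W A) := by
  obtain ⟨n, K, _, _, _, f, g, hf, hg, hfg, hK⟩ := exists_syz A hA
  intro Φ
  obtain ⟨Ψ, hΨ⟩ := VExt.of_surj_aux (dmap_injective hg)
    (fun φ => VExt.of_surj_aux hf hg hfg (hA 0) φ)
      (dmap_exact_of_surj hg hfg) (dual_X hN hX N 0 (by omega) K hK) Φ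
  obtain ⟨x, rfl⟩ := (free_evd hW n).2 Ψ
  exact ⟨g x, by rw [← hΨ]; rfl⟩

lemma evd_bij {N : ℕ}
    (hN : ∀ i > N, ∀ (L : Type) [AddCommGroup L] [Module R L], VExt R W i L)
    (hX : ∀ j, VExt R W (j + 1) W)
    (hW : Function.Bijective (fun r : R => r • (LinearMap.id : W →ₗ[R] W)))
    (A : Type) [AddCommGroup A] [Module R A] [Module.Finite R A]
    (hA : ∀ j, VExt R W (j + 1) A) : Function.Bijective (evd (R := R) W A) := by
  refine ⟨?_, evd_surj hN hX hW A hA⟩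
  obtain ⟨n, K, _, _, _, f, g, hf, hg, hfg, hK⟩ := exists_syz A hA
  rw [injective_iff_map_eq_zero]
  intro a ha
  obtain ⟨x, rfl⟩ := hg a
  have hex : Function.Exact (dmap W (dmap W f)) (dmap W (dmap W g)) :=
    dmap_exact_of_surj (fun φ => VExt.of_surj_aux hf hg hfg (hA 0) φ)
      (dmap_exact_of_surj hg hfg)
  obtain ⟨Ψ, hΨ⟩ := (hex (evd W _ x)).1 (by rw [evd_nat, ha])
  obtain ⟨k, rfl⟩ := evd_surj hN hX hW K hK Ψ
  rw [evd_nat] at hΨ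
  rw [← (free_evd hW n).1 hΨ]
  exact hfg.apply_apply_eq_zero k

lemma seq_down {N : ℕ}
    (hN : ∀ i > N, ∀ (L : Type) [AddCommGroup L] [Module R L], VExt R W i L)
    (C : ℕ → Type) [∀ i, AddCommGroup (C i)] [∀ i, Module R (C i)]
    (d : ∀ i, C (i + 1) →ₗ[R] C i) (hC : ∀ i j, VExt R W (j + 1) (C i)) (n : ℕ)
    (hex : ∀ i ≥ n, Function.Exact (d (i + 1)) (d i)) :
    ∃ m, ∀ i ≥ m, Function.Exact (dmap W (d i)) (dmap W (d (i + 1))) := by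
  have key : ∀ k j, j + k ≥ N → VExt R W (j + 1) (LinearMap.range (d (n + k))) := by
    intro k
    induction k with
    | zero => intro j hj; exact hN _ (by omega) _
    | succ k ih =>
      intro j hj
      exact VExt.left (Submodule.subtype_injective _) (d (n + k)).surjective_rangeRestrict
        (ses_range (hex (n + k) (by omega))) (hC _ j) (ih (j + 1) (by omega))
  refine ⟨n + N + 1, fun i hi => ?_⟩
  obtain ⟨k, rfl⟩ : ∃ k, i = n + (N + k) + 1 := ⟨i - n - N - 1, by omega⟩
  exact dmap_exact (hex _ (by omega)) (hex _ (by omega)) (key (N + k) 0 (by omega))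

lemma seq_up {N : ℕ}
    (hN : ∀ i > N, ∀ (L : Type) [AddCommGroup L] [Module R L], VExt R W i L)
    (C : ℕ → Type) [∀ i, AddCommGroup (C i)] [∀ i, Module R (C i)]
    (d : ∀ i, C i →ₗ[R] C (i + 1)) (hC : ∀ i j, VExt R W (j + 1) (C i)) (n : ℕ)
    (hex : ∀ i ≥ n, Function.Exact (d i) (d (i + 1))) :
    ∀ i ≥ n, Function.Exact (dmap W (d (i + 1))) (dmap W (d i)) := by
  have key : ∀ k j, j + k ≥ N → ∀ i ≥ n, VExt R W (j + 1) (LinearMap.range (d i)) := by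
    intro k
    induction k with
    | zero => intro j hj i _; exact hN _ (by omega) _
    | succ k ih =>
      intro j hj i hi
      exact VExt.left (Submodule.subtype_injective _) (d (i + 1)).surjective_rangeRestrict
        (ses_range (hex i hi)) (hC _ j) (ih (j + 1) (by omega) (i + 1) (by omega))
  intro i hi
  exact dmap_exact (hex _ hi) (hex _ (by omega)) (key N 0 (by omega) (i + 1 + 1) (by omega))

lemma seq_iff {N : ℕ}
    (hN : ∀ i > N, ∀ (L : Type) [AddCommGroup L] [Module R L], VExt R W i L)
    (hX : ∀ j, VExt R W (j + 1) W)
    (hW : Function.Bijective (fun r : R => r • (LinearMap.id : W →ₗ[R] W)))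
    (C : ℕ → Type) [∀ i, AddCommGroup (C i)] [∀ i, Module R (C i)] [∀ i, Module.Finite R (C i)]
    (d : ∀ i, C (i + 1) →ₗ[R] C i) (hC : ∀ i j, VExt R W (j + 1) (C i)) :
    (∃ n, ∀ i ≥ n, Function.Exact (d (i + 1)) (d i)) ↔
    ∃ m, ∀ i ≥ m, Function.Exact (dmap W (d i)) (dmap W (d (i + 1))) := by
  constructor
  · rintro ⟨n, hn⟩
    exact seq_down hN C d hC n hn
  · rintro ⟨n, hn⟩
    refine ⟨n, fun i hi => ?_⟩
    have h := seq_up hN (fun i => C i →ₗ[R] W) (fun i => dmap W (d i))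
      (fun i j => dual_X hN hX N j (by omega) (C i) (hC i)) n hn i hi
    have e := fun i => evd_bij hN hX hW (C i) (hC i)
    refine (Function.Exact.iff_of_ladder_linearEquiv (e₁ := LinearEquiv.ofBijective _ (e (i + 1 + 1)))
      (e₂ := LinearEquiv.ofBijective _ (e (i + 1))) (e₃ := LinearEquiv.ofBijective _ (e i))
      ?_ ?_).1 h
    · rfl
    · rfl

end Duality

section Resolution

open CategoryTheory.Limits

variable {R : Type} [CommRing R]

/-- Functions-level criterion: every cocycle is a coboundary. -/
def CobProp {X : ModuleCat R} (P : ProjectiveResolution X) (Y : ModuleCat.{0} R) (n : ℕ) : Prop :=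
  ∀ f : P.complex.X (n + 1) ⟶ Y, P.complex.d (n + 2) (n + 1) ≫ f = 0 →
    ∃ g : P.complex.X n ⟶ Y, P.complex.d (n + 1) n ≫ g = f

lemma ext_iff_cob {X : ModuleCat R} (P : ProjectiveResolution X) (Y : ModuleCat.{0} R) (n : ℕ) :
    Subsingleton (Abelian.Ext X Y (n + 1)) ↔ CobProp P Y n := by
  constructor
  · intro h f hf
    exact (P.extMk_eq_zero_iff f (n + 2) rfl hf n rfl).1 (Subsingleton.elim _ _)
  · intro h
    have key : ∀ x : Abelian.Ext X Y (n + 1), x = 0 := by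
      intro x
      obtain ⟨f, hf, rfl⟩ := P.extMk_surjective x (n + 2) rfl
      exact (P.extMk_eq_zero_iff f (n + 2) rfl hf n rfl).2 (h f hf)
    exact ⟨fun a b => by rw [key a, key b]⟩

lemma extM_iff_exact {X : ModuleCat R} (P : ProjectiveResolution X) (Y : ModuleCat.{0} R) (n : ℕ) :
    Subsingleton (ExtM R n X Y) ↔ (P.complex.linearYonedaObj R Y).ExactAt n := by
  rw [HomologicalComplex.exactAt_iff_isZero_homology, ← (P.isoExt (R := R) n Y).isZero_iff,
    ModuleCat.isZero_iff_subsingleton]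
  rfl

lemma extM_iff_cob {X : ModuleCat R} (P : ProjectiveResolution X) (Y : ModuleCat.{0} R) (n : ℕ) :
    Subsingleton (ExtM R (n + 1) X Y) ↔ CobProp P Y n := by
  rw [extM_iff_exact P, HomologicalComplex.exactAt_iff' _ n (n + 1) (n + 2) (by simp) (by simp),
    ShortComplex.moduleCat_exact_iff]
  rfl

lemma extM_zero {X : ModuleCat R} (Y : ModuleCat.{0} R) :
    Subsingleton (ExtM R 0 X Y) ↔ Subsingleton (X ⟶ Y) := by
  let P := ProjectiveResolution.of X
  rw [extM_iff_exact P, HomologicalComplex.exactAt_iff' _ 0 0 1 (by simp) (by simp),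
    ShortComplex.moduleCat_exact_iff]
  have hf0 : (HomologicalComplex.sc' (P.complex.linearYonedaObj R Y) 0 0 1).f = 0 :=
    (P.complex.linearYonedaObj R Y).shape 0 0 (by change ¬ (0 + 1 = 0); omega)
  rw [hf0]
  have hepi : Epi (P.π.f 0) := inferInstance
  constructor
  · intro h
    have key : ∀ f : X ⟶ Y, f = 0 := by
      intro f
      have hc : P.complex.d 1 0 ≫ P.π.f 0 ≫ f = 0 :=
        (Category.assoc _ _ _).symm.trans
          ((congrArg (fun q => q ≫ f) P.complex_d_comp_π_f_zero).trans zero_comp)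
      obtain ⟨x, hx⟩ := h (P.π.f 0 ≫ f) hc
      have hx' : P.π.f 0 ≫ f = 0 := hx.symm
      exact (cancel_epi (P.π.f 0)).1 (hx'.trans comp_zero.symm)
    exact ⟨fun a b => by rw [key a, key b]⟩
  · intro h f hf
    have hf' : P.complex.d 1 0 ≫ (show P.complex.X 0 ⟶ Y from f) = 0 := hf
    refine ⟨0, ?_⟩
    have hE := P.exact₀
    have h2 := hE.g_desc (show P.complex.X 0 ⟶ Y from f) hf'
    have h3 : hE.desc (show P.complex.X 0 ⟶ Y from f) hf' = 0 := h.elim _ _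
    rw [h3, comp_zero] at h2
    exact h2

lemma bridge (X Y : ModuleCat.{0} R) (n : ℕ) :
    Subsingleton (ExtM R n X Y) ↔ Subsingleton (Abelian.Ext X Y n) := by
  cases n with
  | zero => rw [extM_zero, Abelian.Ext.addEquiv₀.toEquiv.subsingleton_congr]
  | succ n => rw [extM_iff_cob (ProjectiveResolution.of X), ext_iff_cob (ProjectiveResolution.of X)]

open TensorProduct in
lemma torM_iff {X : ModuleCat R} (P : ProjectiveResolution X) (M : Type) [AddCommGroup M]
    [Module R M] (n : ℕ) :
    Subsingleton (TorM R (n + 1) (ModuleCat.of R M) X) ↔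
      Function.Exact (LinearMap.lTensor M (P.complex.d (n + 2) (n + 1)).hom)
        (LinearMap.lTensor M (P.complex.d (n + 1) n).hom) := by
  have e := P.isoLeftDerivedObj ((MonoidalCategory.tensoringLeft (ModuleCat.{0} R)).obj
    (ModuleCat.of R M)) (n + 1)
  have h1 : Subsingleton (TorM R (n + 1) (ModuleCat.of R M) X) ↔
      IsZero ((HomologicalComplex.homologyFunctor (ModuleCat.{0} R) _ (n + 1)).obj
        ((((MonoidalCategory.tensoringLeft (ModuleCat.{0} R)).obj
    (ModuleCat.of R M)).mapHomologicalComplex _).obj P.complex)) := by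
    rw [← e.isZero_iff, ModuleCat.isZero_iff_subsingleton]
    rfl
  rw [h1]
  change IsZero (HomologicalComplex.homology _ _) ↔ _
  rw [← HomologicalComplex.exactAt_iff_isZero_homology,
    HomologicalComplex.exactAt_iff' _ (n + 2) (n + 1) n (by simp) (by simp),
    ShortComplex.ShortExact.moduleCat_exact_iff_function_exact]
  rfl

lemma exists_cov (K : Type) [AddCommGroup K] [Module R K] [Module.Finite R K] :
    ∃ (n : ℕ) (g : (Fin n → R) →ₗ[R] K), Function.Surjective g :=
  Module.Finite.exists_fin' R K

/-- Rank of a chosen finite free cover. -/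
noncomputable def rkc (K : Type) [AddCommGroup K] [Module R K] [Module.Finite R K] : ℕ :=
  (exists_cov (R := R) K).choose

/-- A chosen finite free cover. -/
noncomputable def cov (K : Type) [AddCommGroup K] [Module R K] [Module.Finite R K] :
    (Fin (rkc (R := R) K) → R) →ₗ[R] K := (exists_cov (R := R) K).choose_spec.choose

lemma cov_surj (K : Type) [AddCommGroup K] [Module R K] [Module.Finite R K] :
    Function.Surjective (cov (R := R) K) := (exists_cov (R := R) K).choose_spec.choose_spec

/-- The syzygy sequence. -/
noncomputable def syzSeq [IsNoetherianRing R] (N : Type) [AddCommGroup N] [Module R N]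
    [Module.Finite R N] : ℕ → Σ n : ℕ, Submodule R (Fin n → R)
  | 0 => ⟨rkc (R := R) N, LinearMap.ker (cov N)⟩
  | i + 1 => ⟨rkc (R := R) (syzSeq N i).2, LinearMap.ker (cov (syzSeq N i).2)⟩

lemma exact_cov_aux {A B C : Type} [AddCommGroup A] [Module R A] [AddCommGroup B] [Module R B]
    [AddCommGroup C] [Module R C] (S : Submodule R B) (c : A →ₗ[R] S)
    (hc : Function.Surjective c) (g : B →ₗ[R] C) (hg : LinearMap.ker g = S) :
    Function.Exact (S.subtype ∘ₗ c) g := by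
  rw [LinearMap.exact_iff, LinearMap.range_comp_of_range_eq_top _
      (LinearMap.range_eq_top.2 hc), Submodule.range_subtype]
  exact hg

lemma exists_free_res [IsNoetherianRing R] (N : Type) [AddCommGroup N] [Module R N]
    [Module.Finite R N] :
    ∃ (r : ℕ → ℕ) (d : ∀ i, (Fin (r (i + 1)) → R) →ₗ[R] (Fin (r i) → R))
      (ε : (Fin (r 0) → R) →ₗ[R] N), Function.Surjective ε ∧ Function.Exact (d 0) ε ∧
      ∀ i, Function.Exact (d (i + 1)) (d i) := by
  refine ⟨fun i => (syzSeq (R := R) N i).1,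
    fun i => (syzSeq (R := R) N i).2.subtype ∘ₗ cov (syzSeq (R := R) N i).2, cov N, cov_surj N, ?_, ?_⟩
  · exact exact_cov_aux _ _ (cov_surj _) _ rfl
  · intro i
    exact exact_cov_aux _ _ (cov_surj _) _
      (LinearMap.ker_comp_of_ker_eq_bot _ (Submodule.ker_subtype _))

lemma exists_res [IsNoetherianRing R] (N : ModuleCat.{0} R) [Module.Finite R N] :
    ∃ P : ProjectiveResolution N, ∀ i, ∃ n : ℕ, Nonempty (P.complex.X i ≃ₗ[R] (Fin n → R)) := by
  obtain ⟨r, d, ε, hε, h0, hd⟩ := exists_free_res (R := R) N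
  let K : ChainComplex (ModuleCat.{0} R) ℕ := ChainComplex.of (fun i => ModuleCat.of R (Fin (r i) → R))
    (fun i => ModuleCat.ofHom (d i)) (fun i => by
      ext1
      exact (hd i).linearMap_comp_eq_zero)
  have hKd : ∀ i, K.d (i + 1) i = ModuleCat.ofHom (d i) := fun i =>
    ChainComplex.of_d (fun i => ModuleCat.of R (Fin (r i) → R)) (fun i => ModuleCat.ofHom (d i)) i
  let ε' : K.X 0 ⟶ N := ModuleCat.ofHom ε
  have hz : K.d 1 0 ≫ ε' = 0 := by
    rw [hKd 0]
    ext1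
    exact h0.linearMap_comp_eq_zero
  refine ⟨{ complex := K
            projective := fun n => ?_
            π := (ChainComplex.toSingle₀Equiv _ _).symm ⟨ε', hz⟩
            quasiIso := ⟨fun n => ?_⟩ }, fun i => ⟨r i, ⟨LinearEquiv.refl _ _⟩⟩⟩
  · change Projective (ModuleCat.of R (Fin (r n) → R))
    infer_instance
  · cases n with
    | zero =>
      rw [ChainComplex.quasiIsoAt₀_iff, ShortComplex.quasiIso_iff_of_zeros']
      · have hτ : ((HomologicalComplex.shortComplexFunctor' (ModuleCat.{0} R)
            (ComplexShape.down ℕ) 1 0 0).map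
            ((K.toSingle₀Equiv N).symm ⟨ε', hz⟩)).τ₂ = ε' :=
          ChainComplex.toSingle₀Equiv_symm_apply_f_zero _ _
        refine ⟨?_, ?_⟩
        · rw [ShortComplex.ShortExact.moduleCat_exact_iff_function_exact]
          have hE : Function.Exact (K.d 1 0) ε' := by
            rw [hKd 0]
            exact h0
          intro x
          have hG := congrArg (fun q : K.X 0 ⟶ N => q.hom x) hτ
          exact (iff_of_eq (congrArg (fun y => y = 0) hG)).trans (hE x)
        · have hepi : Epi ε' := (ModuleCat.epi_iff_surjective ε').2 hε
          rw [hτ]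
          exact hepi
      all_goals rfl
    | succ n =>
      rw [quasiIsoAt_iff_exactAt']
      · rw [HomologicalComplex.exactAt_iff' _ (n + 1 + 1) (n + 1) n (by simp) (by simp),
          ShortComplex.ShortExact.moduleCat_exact_iff_function_exact]
        change Function.Exact (K.d (n + 1 + 1) (n + 1)) (K.d (n + 1) n)
        rw [hKd, hKd]
        exact hd n
      · apply ChainComplex.exactAt_succ_single_obj

end Resolution

section Final

open TensorProduct

variable {R : Type} [CommRing R]

lemma cob_iff_exact [IsNoetherianRing R] {X : ModuleCat.{0} R} (P : ProjectiveResolution X) (M W : Type) [AddCommGroup M]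
    [Module R M] [AddCommGroup W] [Module R W] (n : ℕ) :
    CobProp P (ModuleCat.of R (M →ₗ[R] W)) n ↔
      Function.Exact (dmap W (LinearMap.lTensor M (P.complex.d (n + 1) n).hom))
        (dmap W (LinearMap.lTensor M (P.complex.d (n + 2) (n + 1)).hom)) := by
  constructor
  · intro h φ
    constructor
    · intro hφ
      obtain ⟨g, hg⟩ := h (ModuleCat.ofHom (TensorProduct.curry φ).flip) (by
        ext p m
        exact LinearMap.congr_fun hφ (m ⊗ₜ p))
      let g' : P.complex.X n →ₗ[R] (M →ₗ[R] W) := g.hom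
      refine ⟨TensorProduct.lift g'.flip, ?_⟩
      refine TensorProduct.ext' fun m p => ?_
      exact LinearMap.congr_fun (LinearMap.congr_fun (congrArg ModuleCat.Hom.hom hg) p) m
    · rintro ⟨ψ, rfl⟩
      have hdd : (P.complex.d (n + 1) n).hom ∘ₗ (P.complex.d (n + 2) (n + 1)).hom = 0 :=
        congrArg ModuleCat.Hom.hom (P.complex.d_comp_d (n + 2) (n + 1) n)
      rw [dmap_apply, dmap_apply, LinearMap.comp_assoc, ← LinearMap.lTensor_comp, hdd,
        LinearMap.lTensor_zero, LinearMap.comp_zero]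
  · intro h f hf
    let f' : P.complex.X (n + 1) →ₗ[R] (M →ₗ[R] W) := f.hom
    obtain ⟨ψ, hψ⟩ := (h (TensorProduct.lift f'.flip)).1 (by
      refine TensorProduct.ext' fun m p => ?_
      exact LinearMap.congr_fun (LinearMap.congr_fun (congrArg ModuleCat.Hom.hom hf) p) m)
    refine ⟨ModuleCat.ofHom (TensorProduct.curry ψ).flip, ?_⟩
    ext p m
    exact LinearMap.congr_fun hψ (m ⊗ₜ p)

lemma VExt.tensor_free {W M F : Type} [AddCommGroup W] [Module R W] [AddCommGroup M] [Module R M]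
    [AddCommGroup F] [Module R F] {n : ℕ} (e : F ≃ₗ[R] (Fin n → R)) {j : ℕ} (h : VExt R W j M) :
    VExt R W j (M ⊗[R] F) := by
  refine VExt.sum_aux (A := M) (ι := Fin n)
    (fun k => (TensorProduct.mk R M F).flip (e.symm (Pi.single k 1)))
    (fun k => (TensorProduct.rid R M).toLinearMap ∘ₗ
      LinearMap.lTensor M (LinearMap.proj k ∘ₗ e.toLinearMap)) ?_ h
  refine TensorProduct.ext' fun m x => ?_
  simp only [LinearMap.sum_apply, LinearMap.comp_apply, LinearMap.lTensor_tmul,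
    LinearEquiv.coe_coe, TensorProduct.rid_tmul, LinearMap.proj_apply, LinearMap.flip_apply,
    TensorProduct.mk_apply, LinearMap.id_apply]
  simp only [TensorProduct.smul_tmul]
  rw [← TensorProduct.tmul_sum]
  congr 1
  apply e.injective
  rw [map_sum]
  simp only [map_smul, LinearEquiv.apply_symm_apply]
  exact (pi_eq_sum_univ' (e x)).symm

lemma depth_extract [IsLocalRing R] {A : Type} [AddCommGroup A] [Module R A] {d : ℕ}
    (h : moduleDepth R (ModuleCat.of R A) = d) :
    (∀ i < d, VExt R A i (ResidueField R)) ∧ ¬ VExt R A d (ResidueField R) := by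
  have key : ∀ i, VExt R A i (ResidueField R) ↔
      ¬ Nontrivial (ExtM R i (ModuleCat.of R (ResidueField R)) (ModuleCat.of R A)) := by
    intro i
    rw [not_nontrivial_iff_subsingleton, bridge]
    rfl
  constructor
  · intro i hi
    rw [key]
    intro hnt
    have : moduleDepth R (ModuleCat.of R A) ≤ i := sInf_le ⟨i, rfl, hnt⟩
    rw [h] at this
    have : d ≤ i := by exact_mod_cast this
    omega
  · rw [key, not_not]
    have hne : {d : ℕ∞ | ∃ n : ℕ, d = (n : ℕ∞) ∧ Nontrivial (ExtM R n
        (ModuleCat.of R (ResidueField R)) (ModuleCat.of R A))}.Nonempty := by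
      by_contra hemp
      rw [Set.not_nonempty_iff_eq_empty] at hemp
      rw [moduleDepth, hemp, sInf_empty] at h
      exact ENat.top_ne_natCast d h
    obtain ⟨n, hn, hnt⟩ := csInf_mem hne
    have : (d : ℕ∞) = n := by rw [← h]; exact hn
    have : d = n := by exact_mod_cast this
    rw [this]
    exact hnt

lemma tor_ext_iff [IsLocalRing R] [IsNoetherianRing R]
    (hCM : IsCohenMacaulayLocalRing R)
    (ω : Type) [AddCommGroup ω] [Module R ω] (hω : IsCanonicalModule R ω)
    (M : Type) [AddCommGroup M] [Module R M] [Module.Finite R M]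
    (hMCM : (moduleDepth R (ModuleCat.of R M) : WithBot ℕ∞) = ringKrullDim R)
    (N : ModuleCat.{0} R) (hN : Module.Finite R N) :
    TorEventuallyZero R (ModuleCat.of R M) N ↔
      ExtEventuallyZero R N (ModuleCat.of R (M →ₗ[R] ω)) := by
  obtain ⟨hfin, hdω, ⟨n, hinj⟩, hbij⟩ := hω
  obtain ⟨d, hd⟩ : ∃ d : ℕ, moduleDepth R (ModuleCat.of R R) = d := by
    have h1 : (moduleDepth R (ModuleCat.of R R) : WithBot ℕ∞) < ⊤ := by
      rw [show (moduleDepth R (ModuleCat.of R R) : WithBot ℕ∞) = ringKrullDim R from hCM]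
      exact ringKrullDim_lt_top
    have h2 : moduleDepth R (ModuleCat.of R R) ≠ ⊤ := by
      intro h
      rw [h] at h1
      exact lt_irrefl _ h1
    obtain ⟨d, hd⟩ := ENat.ne_top_iff_exists.1 h2
    exact ⟨d, hd.symm⟩
  have hCM' : (moduleDepth R (ModuleCat.of R R) : WithBot ℕ∞) = ringKrullDim R := hCM
  rw [hd] at hCM'
  have hdM : moduleDepth R (ModuleCat.of R M) = d := WithBot.coe_injective (hMCM.trans hCM'.symm)
  have hdW : moduleDepth R (ModuleCat.of R ω) = d := WithBot.coe_injective (hdω.trans hCM'.symm)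
  have hNinj : ∀ i > n, ∀ (L : Type) [AddCommGroup L] [Module R L], VExt R ω i L :=
    fun i hi L _ _ => (bridge _ _ _).1 (hinj i hi (ModuleCat.of R L))
  have hb := inj_bound (depth_extract hd).1 (depth_extract hd).2 hNinj
  have hX : ∀ j, VExt R ω (j + 1) ω := fun j =>
    mcm_vanish hb d ω (depth_extract hdW).1 (j + 1) (by omega)
  have hY : ∀ j, VExt R ω (j + 1) M := fun j =>
    mcm_vanish hb d M (depth_extract hdM).1 (j + 1) (by omega)
  obtain ⟨P, hP⟩ := exists_res N
  have hPf : ∀ i, Module.Finite R (P.complex.X i) := by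
    intro i
    obtain ⟨m, ⟨e⟩⟩ := hP i
    exact Module.Finite.equiv e.symm
  have hC : ∀ i j, VExt R ω (j + 1) (M ⊗[R] P.complex.X i) := by
    intro i j
    obtain ⟨m, ⟨e⟩⟩ := hP i
    exact VExt.tensor_free e (hY j)
  have hseq := seq_iff hNinj hX hbij (fun i => M ⊗[R] P.complex.X i)
    (fun i => LinearMap.lTensor M (P.complex.d (i + 1) i).hom) hC
  have shift : ∀ p : ℕ → Prop, (∃ n, ∀ i, n ≤ i → p i) ↔ ∃ n, ∀ i ≥ n, p (i + 1) := by
    intro p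
    constructor
    · rintro ⟨n, hn⟩
      exact ⟨n, fun i hi => hn _ (by omega)⟩
    · rintro ⟨n, hn⟩
      refine ⟨n + 1, fun i hi => ?_⟩
      obtain ⟨k, rfl⟩ : ∃ k, i = k + 1 := ⟨i - 1, by omega⟩
      exact hn k (by omega)
  rw [TorEventuallyZero, ExtEventuallyZero,
    shift (fun i => Subsingleton (TorM R i (ModuleCat.of R M) N)),
    shift (fun i => Subsingleton (ExtM R i N (ModuleCat.of R (M →ₗ[R] ω))))]
  simp only [torM_iff P, extM_iff_cob P, cob_iff_exact]
  exact hseq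

end Final

/-- Over a Cohen-Macaulay local ring with canonical module `ω`, a maximal
Cohen-Macaulay module `M` is a test module iff `M† = Hom(M,ω)` detects finite
projective dimension through Ext-vanishing. -/
theorem testModule_iff_dual_ext_detects
    (R : Type) [CommRing R] [IsLocalRing R] [IsNoetherianRing R]
    (hCM : IsCohenMacaulayLocalRing R)
    (ω : Type) [AddCommGroup ω] [Module R ω] (hω : IsCanonicalModule R ω)
    (M : Type) [AddCommGroup M] [Module R M] [Module.Finite R M]
    (hMCM : (moduleDepth R (ModuleCat.of R M) : WithBot ℕ∞) = ringKrullDim R) :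
    IsTestModule R (ModuleCat.of R M) ↔
      ∀ N : ModuleCat R, Module.Finite R N →
        ExtEventuallyZero R N (ModuleCat.of R (M →ₗ[R] ω)) → FinProjDim R N := by
  exact forall_congr' fun N => forall_congr' fun hN => by
    rw [tor_ext_iff hCM ω hω M hMCM N hN]
end
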